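/- Let $G$ be a finite simple connected undirected graph with exactly three leaves (vertices of degree one). For $S\subseteq V(G)$ let $G[S]$ be the induced subgraph and $N(S)$ the set of vertices outside $S$ with a neighbor in $S$. A sapling is an induced subgraph of $G$ that is a tree containing all three leaves of $G$. Rungs and sprouts. For vertex sets $U,W$, a $UW$-rung is an induced path of $G$ that is either a single vertex of $U\cap W$ or has one end-vertex in $U$ and the other in $W$, and that is inclusion-minimal (as a vertex set) with this property. For vertex sets $S,V_1,V_2$, an $(S,V_1,V_2)$-sprout is an induced subgraph of $G$ that is (S1) a tree meeting each of $S$, $V_1$, $V_2$ in exactly one vertex; or (S2) the union of an $SV_1$-rung not meeting $V_2$ and an $SV_2$-rung not meeting $V_1$; or (S3) the union of a $V_1V_2$-rung not meeting $S$ and an $S(V_1\cup V_2)$-rung; in (S2) and (S3) the two rungs are disjoint and no edge of $G$ joins them. Nets. Let $X\subseteq V(G)$. An $X$-net is a loopless multigraph $\mathbb H$ whose vertices (nodes) and edges (arcs) are subsets of $X$, such that, with $\nabla(\mathbb H)$ obtained from $\mathbb H$ by adding an edge between each pair of its leaf nodes (nodes incident to exactly one arc): (N1) $\mathbb H$ is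 connected and $\nabla(\mathbb H)$ is biconnected; (N2) the arcs are nonempty and partition $X$, and there is at least one arc; (N3) $\mathbb H$ has exactly three leaf nodes, each consisting of a single leaf of $G$; (N4) for each arc $E$ with end-nodes $U,W$, every vertex of $E$ lies on a $UW$-rung contained in $G[E]$; (N5) for each arc $E$ and node $V$, $E\cap V\neq\varnothing$ if and only if $V$ is an end-node of $E$; (N6) for $u\in E$, $v\in F$ with $E\neq F$ arcs, $uv$ is an edge of $G$ if and only if $E$ and $F$ have a common end-node containing both $u$ and $v$. Chunks and self-aiding nets. A split component of $\mathbb H$ with split pair $\{U,W\}$ is either an arc with end-nodes $U,W$, or, when $\{U,W\}$ is a cutset of $\nabla(\mathbb H)$, a subgraph of $\mathbb H$ that is a maximal subgraph of $\nabla(\mathbb H)$ among those that contain $U$ and $W$ and in which $U$ and $W$ are nonadjacent and do not form a cutset (a pair is a cutset if its deletion leaves a disconnected graph). A $UW$-chunk is the union (as a subset of $X$) of the arcs of one or more split components with split pair $\{U,W\}$. A chunk is maximal if no chunk properly contains it. $\mathbb H$ is self-aiding if it does not change when, for every maximal chunk $C$ with split pair $\{U,W\}$, all arcs meeting $C$ are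 replaced by the single arc $C$ with end-nodes $U,W$ and the nodes all of whose incident arcs are deleted are removed. Wild and sticky sets. A set $S\subseteq X$ is tamed if every two vertices of $S$ lie in a common arc or a common node; a set $Y\subseteq V(G)\setminus X$ is tamed if $N(Y)\cap X$ is tamed. A set $Y\subseteq V(G)\setminus X$ is wild if $G[Y]$ is a path, $Y$ is not tamed, and every proper subset $Z\subsetneq Y$ such that $G[Z]$ is a path is tamed. A set $S\subseteq X$ is solid if it is a node, or it is a subset of an arc $E$ with end-nodes $U,W$ such that $G[E]$ contains no $(S,U,W)$-sprout. Let $Y\subseteq V(G)\setminus X$ be such that $G[Y]$ is a path. $Y$ is solid if $N(Y)\cap X$ is the union of two solid sets and no internal vertex of the path $G[Y]$ has a neighbor in $X$. $Y$ is podded if there is a $V_1V_2$-chunk $C$ such that (P1) $N(Y)\cap X\subseteq V_1\cup C\cup V_2$, and (P2) for each $i\in\{1,2\}$ and each end-vertex $y$ of the path $G[Y]$, $N(y)\cap V_i\subseteq C$ or $V_i\subseteq C\cup N(y)$. $Y$ is sticky if it is solid or podded. Theorem. Let $\mathbb H$ be a self-aiding $X$-net of $G$ and let $Y$ be a wild set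 that is not sticky, such that $N(Y)\cap X=M_1\cup M_2$, where each of $M_1$ and $M_2$ is contained in a node or in an arc of $\mathbb H$. Then $G[X\cup Y]$ contains a sapling of $G$. -/

import Mathlib

namespace ThreeInATree

/-! ### Leaves, induced paths, rungs, saplings -/

/-- A leaf of a simple graph: a vertex of degree one. -/
def IsLeaf {V : Type*} (G : SimpleGraph V) (v : V) : Prop := ∃! w, G.Adj v w

/-- `G[P]` is a path (with at least one vertex). -/
def IsPathSet {V : Type*} (G : SimpleGraph V) (P : Set V) : Prop :=
  ∃ n : ℕ, Nonempty (SimpleGraph.pathGraph (n + 1) ≃g G.induce P)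

/-- `v` is an end-vertex of the path `G[P]`: a vertex with at most one neighbor in `P`. -/
def IsEndOf {V : Type*} (G : SimpleGraph V) (P : Set V) (v : V) : Prop :=
  v ∈ P ∧ ∀ a ∈ P, ∀ b ∈ P, G.Adj v a → G.Adj v b → a = b

/-- `G[P]` is an induced `UW`-path: a single vertex of `U ∩ W`, or a path with one
end-vertex in `U` and the other end-vertex in `W`. -/
def IsUWPath {V : Type*} (G : SimpleGraph V) (U W P : Set V) : Prop :=
  (∃ x, x ∈ U ∧ x ∈ W ∧ P = {x}) ∨
  (IsPathSet G P ∧ ∃ u w, u ≠ w ∧ u ∈ U ∧ w ∈ W ∧ IsEndOf G P u ∧ IsEndOf G P w)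

/-- `G[P]` is a `UW`-rung: an induced `UW`-path that is vertex-minimal (with respect to
inclusion of vertex sets). A rung of `G[A]` is a rung of `G` with `P ⊆ A`. -/
def IsRung {V : Type*} (G : SimpleGraph V) (U W P : Set V) : Prop :=
  IsUWPath G U W P ∧ ∀ Q, Q ⊆ P → IsUWPath G U W Q → Q = P

/-- `G[T]` is a sapling: an induced tree containing all leaves of `G`. -/
def IsSapling {V : Type*} (G : SimpleGraph V) (T : Set V) : Prop :=
  (G.induce T).IsTree ∧ ∀ v, IsLeaf G v → v ∈ T

/-- `P` and `Q` are disjoint and no edge of `G` joins them, i.e. `G[P ∪ Q]` is the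
disjoint union of `G[P]` and `G[Q]`. -/
def Apart {V : Type*} (G : SimpleGraph V) (P Q : Set V) : Prop :=
  Disjoint P Q ∧ ∀ u ∈ P, ∀ v ∈ Q, ¬ G.Adj u v

/-- `G[T]` is an `(S, V₁, V₂)`-sprout. In the second and third types the induced subgraph
`G[T]` consists of two disjoint rungs and no further edges. -/
def IsSprout {V : Type*} (G : SimpleGraph V) (S V₁ V₂ T : Set V) : Prop :=
  ((G.induce T).IsTree ∧ (∃! x, x ∈ T ∩ S) ∧ (∃! x, x ∈ T ∩ V₁) ∧ (∃! x, x ∈ T ∩ V₂)) ∨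
  (∃ P Q, T = P ∪ Q ∧ Apart G P Q ∧
    IsRung G S V₁ P ∧ Disjoint P V₂ ∧ IsRung G S V₂ Q ∧ Disjoint Q V₁) ∨
  (∃ P Q, T = P ∪ Q ∧ Apart G P Q ∧
    IsRung G V₁ V₂ P ∧ Disjoint P S ∧ IsRung G S (V₁ ∪ V₂) Q)

/-! ### Nets -/

/-- A multigraph whose nodes and arcs are vertex sets; `ends E` is the unordered pair of
end-nodes of the arc `E` (and is irrelevant when `E` is not an arc). -/
structure Net (V : Type*) where
  nodes : Set (Set V)
  arcs : Set (Set V)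
  ends : Set V → Sym2 (Set V)

/-- A leaf node: a node incident to exactly one arc. -/
def Net.IsLeafNode {V : Type*} (H : Net V) (N : Set V) : Prop :=
  N ∈ H.nodes ∧ ∃! E, E ∈ H.arcs ∧ N ∈ H.ends E

/-- The simple graph underlying `ℍ`. -/
def Net.graph {V : Type*} (H : Net V) : SimpleGraph H.nodes :=
  SimpleGraph.fromRel fun U W => ∃ E ∈ H.arcs, H.ends E = s((U : Set V), (W : Set V))

/-- The simple graph underlying `∇(ℍ)`: an edge is added between each pair of leaf nodes. -/
def Net.nabla {V : Type*} (H : Net V) : SimpleGraph H.nodes :=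
  H.graph ⊔ SimpleGraph.fromRel fun U W => H.IsLeafNode U ∧ H.IsLeafNode W

/-- A biconnected graph: connected, and still connected after deleting any one vertex. -/
def IsBiconnected {α : Type*} (Γ : SimpleGraph α) : Prop :=
  Γ.Connected ∧ ∀ v : α, (Γ.induce {v}ᶜ).Connected

/-- `H` is an `X`-net of `G`. -/
structure IsNet {V : Type*} (G : SimpleGraph V) (X : Set V) (H : Net V) : Prop where
  nodes_sub : ∀ N ∈ H.nodes, N ⊆ X
  ends_mem : ∀ E ∈ H.arcs, ∀ N ∈ H.ends E, N ∈ H.nodes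
  loopless : ∀ E ∈ H.arcs, ¬ (H.ends E).IsDiag
  conn : H.graph.Connected
  bicon : IsBiconnected H.nabla
  arcs_nonempty : H.arcs.Nonempty
  arc_nonempty : ∀ E ∈ H.arcs, E.Nonempty
  arcs_disjoint : ∀ E ∈ H.arcs, ∀ F ∈ H.arcs, E ≠ F → Disjoint E F
  arcs_cover : ⋃₀ H.arcs = X
  leaf_count : {N | H.IsLeafNode N}.ncard = 3
  leaf_single : ∀ N, H.IsLeafNode N → ∃ v, IsLeaf G v ∧ N = {v}
  rungs : ∀ E ∈ H.arcs, ∀ U W, H.ends E = s(U, W) →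
    ∀ x ∈ E, ∃ P, x ∈ P ∧ P ⊆ E ∧ IsRung G U W P
  meets_iff : ∀ E ∈ H.arcs, ∀ N ∈ H.nodes, ((E ∩ N).Nonempty ↔ N ∈ H.ends E)
  adj_iff : ∀ E ∈ H.arcs, ∀ F ∈ H.arcs, E ≠ F → ∀ u ∈ E, ∀ v ∈ F,
    (G.Adj u v ↔ ∃ N ∈ H.nodes, N ∈ H.ends E ∧ N ∈ H.ends F ∧ u ∈ N ∧ v ∈ N)

/-! ### Split components, chunks, aiding nets -/

/-- In the subgraph `Γ'` of `∇(ℍ)` that contains `U` and `W`, the nodes `U` and `W` are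
nonadjacent and do not form a cutset (deleting both does not leave a disconnected graph). -/
def UnsplitBy {α : Type*} {Γ : SimpleGraph α} (Γ' : Γ.Subgraph) (U W : α) : Prop :=
  U ∈ Γ'.verts ∧ W ∈ Γ'.verts ∧ ¬ Γ'.Adj U W ∧ (Γ'.deleteVerts {U, W}).coe.Preconnected

/-- `𝒜` is the arc set of a split component of `ℍ` with split pair `{U, W}`: a single arc
with end-nodes `U` and `W`, or, for a cutset `{U, W}` of `∇(ℍ)`, the arcs of a subgraph `Γ'`
of `ℍ` that is a maximal subgraph of `∇(ℍ)` in which `U` and `W` are nonadjacent and do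
not form a cutset. -/
def IsSplitArcSet {V : Type*} (H : Net V) (U W : H.nodes) (𝒜 : Set (Set V)) : Prop :=
  (∃ E ∈ H.arcs, H.ends E = s((U : Set V), (W : Set V)) ∧ 𝒜 = {E}) ∨
  (U ≠ W ∧ ¬ (H.nabla.induce {U, W}ᶜ).Preconnected ∧
    ∃ Γ' : H.nabla.Subgraph,
      UnsplitBy Γ' U W ∧ (∀ Γ'' : H.nabla.Subgraph, Γ' ≤ Γ'' → UnsplitBy Γ'' U W → Γ'' = Γ') ∧
      (∀ A B, Γ'.Adj A B → H.graph.Adj A B) ∧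
      𝒜 = {E | E ∈ H.arcs ∧ ∃ A B, Γ'.Adj A B ∧ H.ends E = s((A : Set V), (B : Set V))})

/-- `C` is a `UW`-chunk of `ℍ`: the union of the arcs of one or more split components with
split pair `{U, W}`. -/
def IsChunk {V : Type*} (H : Net V) (U W : H.nodes) (C : Set V) : Prop :=
  ∃ 𝔖 : Set (Set (Set V)), 𝔖.Nonempty ∧ (∀ 𝒜 ∈ 𝔖, IsSplitArcSet H U W 𝒜) ∧ C = ⋃₀ (⋃₀ 𝔖)

/-- A maximal chunk: a chunk not properly contained in any chunk. -/
def IsMaxChunk {V : Type*} (H : Net V) (C : Set V) : Prop :=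
  (∃ U W, IsChunk H U W C) ∧ ∀ C' U W, IsChunk H U W C' → C ⊆ C' → C' = C

/-- `H'` is obtained from `H` by applying the operation `merge(C)` for each chunk `C` in `𝒞`:
all arcs meeting `C` are replaced by the single arc `C` between the nodes of its split pair,
and nodes whose incident arcs are all deleted are deleted. -/
structure IsMerge {V : Type*} (H : Net V) (𝒞 : Set (Set V)) (H' : Net V) : Prop where
  arcs : H'.arcs = {E | E ∈ H.arcs ∧ ∀ C ∈ 𝒞, Disjoint E C} ∪ 𝒞
  ends_old : ∀ E ∈ H.arcs, (∀ C ∈ 𝒞, Disjoint E C) → H'.ends E = H.ends E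
  ends_new : ∀ C ∈ 𝒞, ∃ U W : H.nodes,
    IsChunk H U W C ∧ H'.ends C = s((U : Set V), (W : Set V))
  nodes : H'.nodes = {N | N ∈ H.nodes ∧ ∃ E ∈ H'.arcs, N ∈ H'.ends E}

/-- `H'` aids `H` (`H' = ℍ†`): it is obtained from `H` by merging every maximal chunk. -/
def Aids {V : Type*} (H' H : Net V) : Prop := IsMerge H {C | IsMaxChunk H C} H'

/-- A net is self-aiding if it aids itself. -/
def SelfAiding {V : Type*} (H : Net V) : Prop := Aids H H

/-! ### Tamed, wild, solid, podded and sticky sets -/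

/-- A set `S ⊆ X` is `ℍ`-tamed: every two of its vertices lie in a common arc or in a
common node of `ℍ`. -/
def Tamed {V : Type*} (H : Net V) (S : Set V) : Prop :=
  ∀ u ∈ S, ∀ v ∈ S, (∃ E ∈ H.arcs, u ∈ E ∧ v ∈ E) ∨ (∃ N ∈ H.nodes, u ∈ N ∧ v ∈ N)

/-- `N(Y) ∩ X`, for `Y` disjoint from `X`. -/
def nbrIn {V : Type*} (G : SimpleGraph V) (X Y : Set V) : Set V := {x ∈ X | ∃ y ∈ Y, G.Adj y x}

/-- An `ℍ`-wild set: a set `Y ⊆ V(G) ∖ X` that is minimal among those `ℍ`-untamed sets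
which induce a path. -/
def Wild {V : Type*} (G : SimpleGraph V) (X : Set V) (H : Net V) (Y : Set V) : Prop :=
  Disjoint Y X ∧ IsPathSet G Y ∧ ¬ Tamed H (nbrIn G X Y) ∧
    ∀ Z, Z ⊂ Y → IsPathSet G Z → Tamed H (nbrIn G X Z)

/-- An `ℍ`-solid subset of `X`: a node of `ℍ`, or a subset `S` of an arc `E` with end-nodes
`U` and `W` such that `G[E]` contains no `(S, U, W)`-sprout. -/
def SolidSet {V : Type*} (G : SimpleGraph V) (H : Net V) (S : Set V) : Prop :=
  S ∈ H.nodes ∨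
    ∃ E ∈ H.arcs, ∃ U W, H.ends E = s(U, W) ∧ S ⊆ E ∧ ¬ ∃ T, T ⊆ E ∧ IsSprout G S U W T

/-- An `ℍ`-solid set `Y ⊆ V(G) ∖ X` inducing a path: `N(Y) ∩ X` is the union of two
`ℍ`-solid sets, and no internal vertex of the path has a neighbor in `X`. -/
def Solid {V : Type*} (G : SimpleGraph V) (X : Set V) (H : Net V) (Y : Set V) : Prop :=
  (∃ S₁ S₂, SolidSet G H S₁ ∧ SolidSet G H S₂ ∧ nbrIn G X Y = S₁ ∪ S₂) ∧
    ∀ y ∈ Y, ¬ IsEndOf G Y y → nbrIn G X {y} = ∅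

/-- `C` is a pod of `Y` in `ℍ`: a `V₁V₂`-chunk with `N(Y) ∩ X ⊆ V₁ ∪ C ∪ V₂` such that for
each `i`, `N(y) ∩ Vᵢ ⊆ C` or `Vᵢ ⊆ C ∪ N(y)` holds at an end-vertex `y` of the path `G[Y]`,
whichever end-vertex `y` is. -/
def IsPod {V : Type*} (G : SimpleGraph V) (X : Set V) (H : Net V) (Y C : Set V) : Prop :=
  ∃ V₁ V₂ : H.nodes, IsChunk H V₁ V₂ C ∧
    nbrIn G X Y ⊆ (V₁ : Set V) ∪ C ∪ (V₂ : Set V) ∧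
    ∀ W : H.nodes, W = V₁ ∨ W = V₂ → ∀ y, IsEndOf G Y y →
      G.neighborSet y ∩ (W : Set V) ⊆ C ∨ (W : Set V) ⊆ C ∪ G.neighborSet y

/-- `Y` is `ℍ`-podded. -/
def Podded {V : Type*} (G : SimpleGraph V) (X : Set V) (H : Net V) (Y : Set V) : Prop :=
  ∃ C, IsPod G X H Y C

/-- `Y` is `ℍ`-sticky. -/
def Sticky {V : Type*} (G : SimpleGraph V) (X : Set V) (H : Net V) (Y : Set V) : Prop :=
  Solid G X H Y ∨ Podded G X H Y

end ThreeInATree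

namespace ThreeInATree

open SimpleGraph

section Trees

variable {V : Type*} {G : SimpleGraph V}

theorem isAcyclic_pathGraph (n : ℕ) : (pathGraph n).IsAcyclic := by
  rw [isAcyclic_iff_forall_adj_isBridge]
  have key : ∀ i j : Fin n, i.val + 1 = j.val → (pathGraph n).IsBridge s(i, j) := by
    intro i j hij
    have inv : ∀ u v : Fin n, ((pathGraph n).deleteEdges {s(i, j)}).Reachable u v →
        u.val ≤ i.val → v.val ≤ i.val := by
      rintro u v ⟨p⟩
      induction p with
      | nil => exact id
      | @cons a b c h p ih =>
        intro ha
        apply ih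
        rw [deleteEdges_adj, pathGraph_adj] at h
        obtain ⟨h1, h2⟩ := h
        by_contra hb
        apply h2
        have : a = i ∧ b = j := by
          constructor <;> ext <;> omega
        simp [this.1, this.2]
    rw [isBridge_iff]
    intro hr
    have := inv _ _ hr le_rfl
    omega
  intro u v h
  rw [pathGraph_adj] at h
  rcases h with h | h
  · exact key _ _ h
  · rw [Sym2.eq_swap]; exact key _ _ h

theorem isTree_induce_of_isPathSet {P : Set V} (h : IsPathSet G P) : (G.induce P).IsTree := by
  obtain ⟨n, ⟨e⟩⟩ := h
  exact e.isTree_iff.1 ⟨pathGraph_connected n, isAcyclic_pathGraph _⟩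

theorem mem_support_map {W : Type*} {Γ : SimpleGraph W} {f : G →g Γ} {u v : V} {p : G.Walk u v}
    {x : W} (hx : x ∈ (p.map f).support) : ∃ y ∈ p.support, f y = x := by
  rw [Walk.support_map, List.mem_map] at hx
  exact hx

theorem isAcyclic_induce_iff {S : Set V} : (G.induce S).IsAcyclic ↔
    ∀ v (c : G.Walk v v), c.IsCycle → ¬ ∀ x ∈ c.support, x ∈ S := by
  constructor
  · intro h v c hc hS
    apply h (c.induce S hS)
    have : ((c.induce S hS).map (Embedding.induce S).toHom).IsCycle := by
      rw [Walk.map_induce]; exact hc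
    exact this.of_map
  · intro h v c hc
    refine h v (c.map (Embedding.induce S).toHom)
      (hc.map (Embedding.induce (G := G) S).injective) ?_
    intro x hx
    obtain ⟨y, -, rfl⟩ := mem_support_map hx
    exact y.2

theorem support_subset_of_closed {Γ : SimpleGraph V} {S : Set V}
    (hS : ∀ a b, Γ.Adj a b → a ∈ S → b ∈ S) {u v : V} (p : Γ.Walk u v) (hu : u ∈ S) :
    ∀ x ∈ p.support, x ∈ S := by
  induction p with
  | nil => simpa
  | cons h p ih =>
    intro x hx
    rw [Walk.support_cons, List.mem_cons] at hx
    rcases hx with rfl | hx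
    · exact hu
    · exact ih (hS _ _ h hu) x hx

/-- Two disjoint induced trees joined by exactly one edge form an induced tree. -/
theorem isTree_union {A B : Set V} (hA : (G.induce A).IsTree) (hB : (G.induce B).IsTree)
    (hd : Disjoint A B) {a b : V} (ha : a ∈ A) (hb : b ∈ B) (hab : G.Adj a b)
    (huniq : ∀ x ∈ A, ∀ y ∈ B, G.Adj x y → x = a ∧ y = b) : (G.induce (A ∪ B)).IsTree := by
  refine ⟨connected_induce_union hA.connected.preconnected hB.connected.preconnected ha hb hab, ?_⟩
  rw [Set.disjoint_left] at hd
  have hA' := isAcyclic_induce_iff.1 hA.isAcyclic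
  have hB' := isAcyclic_induce_iff.1 hB.isAcyclic
  set Γ : SimpleGraph (A ∪ B : Set V) :=
    (G.induce (A ∪ B)).deleteEdges {s(⟨a, Or.inl ha⟩, ⟨b, Or.inr hb⟩)} with hΓ
  have clA : ∀ x y, Γ.Adj x y → x.1 ∈ A → y.1 ∈ A := by
    intro x y h hx
    rw [hΓ, deleteEdges_adj] at h
    rcases y.2 with hy | hy
    · exact hy
    · obtain ⟨h1, h2⟩ := huniq _ hx _ hy h.1
      exact absurd (by rw [Set.mem_singleton_iff]; congr <;> exact Subtype.ext ‹_›) h.2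
  have clB : ∀ x y, Γ.Adj x y → x.1 ∈ B → y.1 ∈ B := by
    intro x y h hx
    rcases y.2 with hy | hy
    · exact absurd hx (hd (clA _ _ h.symm hy))
    · exact hy
  have hΓle : Γ ≤ G.induce (A ∪ B) := deleteEdges_le _
  have hacy : Γ.IsAcyclic := by
    intro v c hc
    let f : Γ →g G := (Embedding.induce (A ∪ B)).toHom.comp (Hom.ofLE hΓle)
    have hf : Function.Injective f := Subtype.val_injective
    have hcyc : (c.map f).IsCycle := hc.map hf
    rcases v.2 with hv | hv
    · refine hA' _ _ hcyc ?_
      intro x hx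
      rw [Walk.support_map, List.mem_map] at hx
      obtain ⟨y, hy, rfl⟩ := hx
      exact support_subset_of_closed (S := {x : (A ∪ B : Set V) | x.1 ∈ A}) clA c hv y hy
    · refine hB' _ _ hcyc ?_
      intro x hx
      rw [Walk.support_map, List.mem_map] at hx
      obtain ⟨y, hy, rfl⟩ := hx
      exact support_subset_of_closed (S := {x : (A ∪ B : Set V) | x.1 ∈ B}) clB c hv y hy
  have hnr : ¬ Γ.Reachable ⟨a, Or.inl ha⟩ ⟨b, Or.inr hb⟩ := by
    rintro ⟨p⟩
    exact hd (support_subset_of_closed (S := {x : (A ∪ B : Set V) | x.1 ∈ A}) clA p ha _ p.end_mem_support) hb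
  refine (hacy.sup_edge_of_not_reachable hnr).anti ?_
  intro x y hxy
  by_cases h : s(x, y) = s(⟨a, Or.inl ha⟩, ⟨b, Or.inr hb⟩)
  · right
    rw [edge_adj]
    refine ⟨?_, hxy.ne⟩
    simpa using h
  · left
    rw [hΓ, deleteEdges_adj]
    exact ⟨hxy, h⟩

theorem isTree_singleton (x : V) : (G.induce ({x} : Set V)).IsTree :=
  IsTree.of_subsingleton

theorem exists_walk_of_induce_preconnected {C : Set V} (hC : (G.induce C).Preconnected)
    {u v : V} (hu : u ∈ C) (hv : v ∈ C) : ∃ p : G.Walk u v, ∀ x ∈ p.support, x ∈ C := by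
  obtain ⟨p⟩ := hC ⟨u, hu⟩ ⟨v, hv⟩
  refine ⟨p.map (Embedding.induce C).toHom, ?_⟩
  intro x hx
  obtain ⟨y, -, rfl⟩ := mem_support_map hx
  exact y.2

/-- A shortest path between two sets inside a connected set. -/
theorem exists_bridge {C A B : Set V} (hC : (G.induce C).Preconnected)
    (hA : (C ∩ A).Nonempty) (hB : (C ∩ B).Nonempty) :
    ∃ F ⊆ C, (G.induce F).IsTree ∧ (∃! x, x ∈ F ∩ A) ∧ (∃! x, x ∈ F ∩ B) ∧
      IsUWPath G A B F := by
  classical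
  let Q : ℕ → Prop := fun n => ∃ a ∈ A, ∃ b ∈ B, ∃ p : G.Walk a b,
    (∀ x ∈ p.support, x ∈ C) ∧ p.length = n
  have hex : ∃ n, Q n := by
    obtain ⟨a, ha, haA⟩ := hA
    obtain ⟨b, hb, hbB⟩ := hB
    obtain ⟨p, hp⟩ := exists_walk_of_induce_preconnected hC ha hb
    exact ⟨_, a, haA, b, hbB, p, hp, rfl⟩
  obtain ⟨a, ha, b, hb, p, hp, hlen⟩ := Nat.find_spec hex
  have hmin : ∀ a' ∈ A, ∀ b' ∈ B, ∀ q : G.Walk a' b', (∀ x ∈ q.support, x ∈ p.support) →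
      p.length ≤ q.length := by
    intro a' ha' b' hb' q hq
    rw [hlen]
    exact Nat.find_min' hex ⟨a', ha', b', hb', q, fun x hx => hp x (hq x hx), rfl⟩
  have hAi : ∀ i ≤ p.length, p.getVert i ∈ A → i = 0 := by
    intro i hi hiA
    have := hmin _ hiA _ hb (p.drop i) (fun x hx => (p.isSubwalk_drop i).support_subset hx)
    rw [Walk.drop_length] at this
    omega
  have hBi : ∀ i ≤ p.length, p.getVert i ∈ B → i = p.length := by
    intro i hi hiB
    have := hmin _ ha _ hiB (p.take i) (fun x hx => (p.isSubwalk_take i).support_subset hx)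
    rw [Walk.take_length] at this
    omega
  have hinj : ∀ i ≤ p.length, ∀ j ≤ p.length, p.getVert i = p.getVert j → i < j → False := by
    intro i hi j hj hij hlt
    have := hmin _ ha _ hb ((p.take i).append ((p.drop j).copy hij.symm rfl)) (by
      intro x hx
      rw [Walk.mem_support_append_iff, Walk.support_copy] at hx
      rcases hx with hx | hx
      · exact (p.isSubwalk_take i).support_subset hx
      · exact (p.isSubwalk_drop j).support_subset hx)
    rw [Walk.length_append, Walk.length_copy, Walk.take_length, Walk.drop_length] at this
    omega
  have hadj : ∀ i ≤ p.length, ∀ j ≤ p.length, G.Adj (p.getVert i) (p.getVert j) → i < j →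
      i + 1 = j := by
    intro i hi j hj hij hlt
    have := hmin _ ha _ hb ((p.take i).append (Walk.cons hij (p.drop j))) (by
      intro x hx
      rw [Walk.mem_support_append_iff, Walk.support_cons, List.mem_cons] at hx
      rcases hx with hx | rfl | hx
      · exact (p.isSubwalk_take i).support_subset hx
      · exact p.getVert_mem_support i
      · exact (p.isSubwalk_drop j).support_subset hx)
    rw [Walk.length_append, Walk.length_cons, Walk.take_length, Walk.drop_length] at this
    omega
  have hmem : ∀ x, x ∈ p.support ↔ ∃ i ≤ p.length, p.getVert i = x := by
    intro x
    rw [Walk.mem_support_iff_exists_getVert]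
    constructor
    · rintro ⟨i, h1, h2⟩; exact ⟨i, h2, h1⟩
    · rintro ⟨i, h1, h2⟩; exact ⟨i, h2, h1⟩
  let f : Fin (p.length + 1) → {x | x ∈ p.support} := fun i =>
    ⟨p.getVert i, p.getVert_mem_support i⟩
  have hf : Function.Bijective f := by
    constructor
    · intro i j hij
      have hij' : p.getVert i = p.getVert j := congrArg Subtype.val hij
      rcases lt_trichotomy i.val j.val with h | h | h
      · exact (hinj i (by omega) j (by omega) hij' h).elim
      · exact Fin.ext h
      · exact (hinj j (by omega) i (by omega) hij'.symm h).elim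
    · rintro ⟨x, hx⟩
      obtain ⟨i, hi, rfl⟩ := (hmem x).1 hx
      exact ⟨⟨i, by omega⟩, rfl⟩
  have hpath : IsPathSet G {x | x ∈ p.support} := by
    refine ⟨p.length, ⟨⟨Equiv.ofBijective f hf, ?_⟩⟩⟩
    intro i j
    rw [pathGraph_adj]
    change G.Adj (p.getVert i) (p.getVert j) ↔ _
    constructor
    · intro h
      rcases lt_trichotomy i.val j.val with h' | h' | h'
      · exact Or.inl (hadj i (by omega) j (by omega) h h')
      · rw [h'] at h; exact (G.loopless.irrefl _ h).elim
      · exact Or.inr (hadj j (by omega) i (by omega) h.symm h')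
    · rintro (h | h)
      · rw [← h]; exact p.adj_getVert_succ (by omega)
      · rw [← h]; exact (p.adj_getVert_succ (by omega)).symm
  refine ⟨{x | x ∈ p.support}, hp, isTree_induce_of_isPathSet hpath, ?_, ?_, ?_⟩
  · refine ⟨a, ⟨p.start_mem_support, ha⟩, ?_⟩
    rintro x ⟨hx, hxA⟩
    obtain ⟨i, hi, rfl⟩ := (hmem x).1 hx
    rw [hAi i hi hxA, Walk.getVert_zero]
  · refine ⟨b, ⟨p.end_mem_support, hb⟩, ?_⟩
    rintro x ⟨hx, hxB⟩
    obtain ⟨i, hi, rfl⟩ := (hmem x).1 hx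
    rw [hBi i hi hxB, Walk.getVert_length]
  · by_cases hab : a = b
    · left
      refine ⟨a, ha, hab ▸ hb, ?_⟩
      have h0 : p.length = 0 := by
        have := hBi 0 (by omega) (by rw [Walk.getVert_zero]; exact hab ▸ hb)
        omega
      ext x
      rw [Set.mem_ofPred_eq, hmem, Set.mem_singleton_iff]
      constructor
      · rintro ⟨i, hi, rfl⟩
        rw [show i = 0 by omega, Walk.getVert_zero]
      · rintro rfl
        exact ⟨0, by omega, Walk.getVert_zero _⟩
    · right
      refine ⟨hpath, a, b, hab, ha, hb, ⟨p.start_mem_support, ?_⟩, ⟨p.end_mem_support, ?_⟩⟩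
      · have key : ∀ x ∈ p.support, G.Adj a x → x = p.getVert 1 := by
          intro x hx hax
          obtain ⟨i, hi, rfl⟩ := (hmem x).1 hx
          have hi0 : 0 < i := by
            rcases Nat.eq_zero_or_pos i with h | h
            · subst h; rw [Walk.getVert_zero] at hax; exact (G.loopless.irrefl _ hax).elim
            · exact h
          rw [← hadj 0 (by omega) i hi (by rw [Walk.getVert_zero]; exact hax) hi0]
        intro x hx y hy hax hay
        rw [key x hx hax, key y hy hay]
      · have key : ∀ x ∈ p.support, G.Adj b x → x = p.getVert (p.length - 1) := by
          intro x hx hbx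
          obtain ⟨i, hi, rfl⟩ := (hmem x).1 hx
          have hi0 : i < p.length := by
            rcases Nat.eq_or_lt_of_le hi with h | h
            · subst h; rw [Walk.getVert_length] at hbx; exact (G.loopless.irrefl _ hbx).elim
            · exact h
          rw [← hadj i hi p.length le_rfl (by rw [Walk.getVert_length]; exact hbx.symm) hi0]
          simp
        intro x hx y hy hax hay
        rw [key x hx hax, key y hy hay]

theorem isUWPath_preconnected {U W P : Set V} (h : IsUWPath G U W P) :
    (G.induce P).Preconnected ∧ (P ∩ U).Nonempty ∧ (P ∩ W).Nonempty := by
  rcases h with ⟨x, hU, hW, rfl⟩ | ⟨h, u, w, -, hu, hw, hu', hw'⟩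
  · exact ⟨(isTree_singleton x).connected.preconnected, ⟨x, rfl, hU⟩, ⟨x, rfl, hW⟩⟩
  · exact ⟨(isTree_induce_of_isPathSet h).connected.preconnected, ⟨u, hu'.1, hu⟩, ⟨w, hw'.1, hw⟩⟩

theorem IsRung.tree {U W P : Set V} (h : IsRung G U W P) :
    (G.induce P).IsTree ∧ (∃! x, x ∈ P ∩ U) ∧ (∃! x, x ∈ P ∩ W) := by
  obtain ⟨h1, h2, h3⟩ := isUWPath_preconnected h.1
  obtain ⟨F, hF, ht, hU, hW, hp⟩ := exists_bridge h1 h2 h3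
  obtain rfl := h.2 F hF hp
  exact ⟨ht, hU, hW⟩

/-- Removing a vertex with at most one neighbour keeps an induced subgraph connected. -/
theorem preconnected_diff_of_isEndOf {R : Set V} (hR : (G.induce R).Preconnected) {r : V}
    (hr : IsEndOf G R r) : (G.induce (R \ {r})).Preconnected := by
  classical
  rintro ⟨u, hu⟩ ⟨v, hv⟩
  obtain ⟨p, hp⟩ := exists_walk_of_induce_preconnected hR hu.1 hv.1
  have hq : ∀ x ∈ p.bypass.support, x ∈ R := fun x hx => hp x (p.support_bypass_subset_support hx)
  have hpath : p.bypass.IsPath := p.bypass_isPath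
  generalize p.bypass = q at hq hpath
  have hrq : r ∉ q.support := by
    intro hmem
    obtain ⟨i, hi, hil⟩ := Walk.mem_support_iff_exists_getVert.1 hmem
    have h0 : i ≠ 0 := by rintro rfl; rw [Walk.getVert_zero] at hi; exact hu.2 hi
    have hl : i ≠ q.length := by rintro rfl; rw [Walk.getVert_length] at hi; exact hv.2 hi
    have e1 : G.Adj r (q.getVert (i + 1)) := hi ▸ q.adj_getVert_succ (by omega)
    have e2 : G.Adj r (q.getVert (i - 1)) := by
      have := q.adj_getVert_succ (i := i - 1) (by omega)
      rw [show i - 1 + 1 = i by omega, hi] at this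
      exact this.symm
    have := hr.2 _ (hq _ (q.getVert_mem_support _)) _ (hq _ (q.getVert_mem_support _)) e1 e2
    have := hpath.getVert_injOn (show i + 1 ≤ q.length by omega) (show i - 1 ≤ q.length by omega)
      this
    omega
  exact ⟨q.induce (R \ {r}) (fun x hx => ⟨hq x hx, fun h => hrq (h ▸ hx)⟩)⟩

end Trees

end ThreeInATree

namespace ThreeInATree

open SimpleGraph

section Menger

variable {V : Type*} {Γ : SimpleGraph V}

/-- `v` can be reached from `A` by a walk of `Γ` avoiding `S`. -/
inductive ReachAvoid (Γ : SimpleGraph V) (A S : Set V) : V → Prop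
  | base {a : V} : a ∈ A → a ∉ S → ReachAvoid Γ A S a
  | step {v w : V} : ReachAvoid Γ A S v → Γ.Adj v w → w ∉ S → ReachAvoid Γ A S w

theorem ReachAvoid.notMem {A S : Set V} {v : V} (h : ReachAvoid Γ A S v) : v ∉ S := by
  cases h <;> assumption

theorem ReachAvoid.exists_walk {A S : Set V} {v : V} (h : ReachAvoid Γ A S v) :
    ∃ a ∈ A, ∃ p : Γ.Walk a v, ∀ x ∈ p.support, x ∉ S := by
  induction h with
  | base ha hS => exact ⟨_, ha, Walk.nil, by simpa using hS⟩
  | step _ hvw hw ih =>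
    obtain ⟨a, ha, p, hp⟩ := ih
    refine ⟨a, ha, p.concat hvw, ?_⟩
    intro x hx
    rw [Walk.support_concat, List.mem_append, List.mem_singleton] at hx
    rcases hx with hx | rfl
    · exact hp x hx
    · exact hw

theorem ReachAvoid.append {A S : Set V} {u v : V} (hu : ReachAvoid Γ A S u) (p : Γ.Walk u v)
    (hp : ∀ x ∈ p.support, x ∉ S) : ReachAvoid Γ A S v := by
  induction p with
  | nil => exact hu
  | cons h p ih =>
    exact ih (hu.step h (hp _ (by simp))) fun x hx => hp x (by simp [hx])

theorem ReachAvoid.mono {Γ' : SimpleGraph V} {A S S' : Set V} (hS : ∀ x, x ∉ S → x ∉ S')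
    (hΓ : Γ ≤ Γ') {v : V} (h : ReachAvoid Γ A S v) : ReachAvoid Γ' A S' v := by
  induction h with
  | base ha h => exact .base ha (hS _ h)
  | step _ h h' ih => exact ih.step (hΓ h) (hS _ h')

theorem ReachAvoid.symm {A B S : Set V} {b : V} (h : ReachAvoid Γ A S b) (hb : b ∈ B) :
    ∃ a ∈ A, ReachAvoid Γ B S a := by
  obtain ⟨a, ha, p, hp⟩ := h.exists_walk
  refine ⟨a, ha, ReachAvoid.append (.base hb h.notMem) p.reverse ?_⟩
  intro x hx
  rw [Walk.support_reverse, List.mem_reverse] at hx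
  exact hp x hx

/-- Two sets reachable from `A` and from `B` that meet give a connection from `A` to `B`. -/
theorem ReachAvoid.meet {A B S : Set V} {v : V} (h : ReachAvoid Γ A S v)
    (h' : ReachAvoid Γ B S v) : ∃ b ∈ B, ReachAvoid Γ A S b := by
  obtain ⟨b, hb, p, hp⟩ := h'.exists_walk
  refine ⟨b, hb, h.append p.reverse ?_⟩
  intro x hx
  rw [Walk.support_reverse, List.mem_reverse] at hx
  exact hp x hx

/-- A vertex outside a set containing the sources is reached through an edge leaving the set. -/
theorem ReachAvoid.exists_boundary {A S D : Set V} {b : V} (h : ReachAvoid Γ A S b)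
    (hA : ∀ a ∈ A, a ∉ S → a ∈ D) (hb : b ∉ D) :
    ∃ u ∈ D, ∃ v ∉ D, u ∉ S ∧ v ∉ S ∧ Γ.Adj u v := by
  induction h with
  | base ha hS => exact absurd (hA _ ha hS) hb
  | @step v w hv hvw hw ih =>
    by_cases hvD : v ∈ D
    · exact ⟨v, hvD, w, hb, hv.notMem, hw, hvw⟩
    · exact ih hvD

theorem exists_trimmed {C A : Set V} (hC : (Γ.induce C).Preconnected) (hA : (C ∩ A).Nonempty)
    {p : V} (hp : p ∈ C) :
    ∃ F ⊆ C, p ∈ F ∧ (F ∩ A).Nonempty ∧ (Γ.induce F).Preconnected ∧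
      ∀ v ∈ F, v ≠ p → ReachAvoid Γ A (insert p Fᶜ) v := by
  obtain ⟨F, hF, ht, ⟨a, ha, -⟩, ⟨p', hp', -⟩, hUW⟩ :=
    exists_bridge hC hA (B := {p}) ⟨p, hp, rfl⟩
  obtain rfl : p' = p := hp'.2
  refine ⟨F, hF, hp'.1, ⟨a, ha⟩, ht.connected.preconnected, ?_⟩
  rcases hUW with ⟨x, hxA, rfl, rfl⟩ | ⟨-, u, w, hne, hu, rfl, huF, hwF⟩
  · intro v hv hne
    exact absurd hv hne
  · intro v hv hne'
    have hpre := preconnected_diff_of_isEndOf ht.connected.preconnected hwF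
    obtain ⟨q, hq⟩ := exists_walk_of_induce_preconnected hpre (u := u) (v := v)
      ⟨huF.1, hne⟩ ⟨hv, hne'⟩
    have hq' : ∀ x ∈ q.support, x ∉ insert w Fᶜ := by
      intro x hx hx'
      rcases hx' with rfl | hx'
      · exact (hq _ hx).2 rfl
      · exact hx' (hq _ hx).1
    exact ReachAvoid.append (.base hu (hq' _ q.start_mem_support)) q hq'

theorem exists_transversal {k : ℕ} {C : Fin k → Set V} [Finite V]
    (hd : Pairwise fun i j => Disjoint (C i) (C j)) {P : Set V} (hP : P.ncard ≤ k)
    (hm : ∀ i, (C i ∩ P).Nonempty) :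
    ∃ g : Fin k → V, Function.Injective g ∧ (∀ i, g i ∈ C i ∧ g i ∈ P) ∧
      (∀ p ∈ P, ∃ i, g i = p) ∧ ∀ i, ∀ p ∈ C i, p ∈ P → p = g i := by
  choose g hg using hm
  have hinj : Function.Injective g := by
    intro i j hij
    by_contra hne
    exact Set.disjoint_left.1 (hd hne) (hg i).1 (hij ▸ (hg j).1)
  have hrange : Set.range g = P := by
    apply Set.eq_of_subset_of_ncard_le
    · rintro _ ⟨i, rfl⟩; exact (hg i).2
    · rw [← Set.image_univ, Set.ncard_image_of_injective _ hinj, Set.ncard_univ, Nat.card_fin]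
      exact hP
    · exact Set.toFinite _
  have hsurj : ∀ p ∈ P, ∃ i, g i = p := fun p hp => by rw [← hrange] at hp; exact hp
  refine ⟨g, hinj, fun i => hg i, hsurj, ?_⟩
  intro i p hpC hpP
  obtain ⟨j, rfl⟩ := hsurj p hpP
  by_contra hne
  exact Set.disjoint_left.1 (hd fun h => hne (by rw [h])) hpC (hg j).1

/-- The separation step in the proof of Menger's theorem: sets of fewer than `k` vertices do not
separate `A` from `insert x S` after the edge `xy` has been deleted. -/
theorem reachAvoid_deleteEdge {A B S : Set V} {x y : V} {k : ℕ}
    (h : ∀ S : Set V, S.ncard < k → ∃ b ∈ B, ReachAvoid Γ A S b)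
    (hsep : ∀ b ∈ B, ¬ ReachAvoid (Γ.deleteEdges {s(x, y)}) A S b)
    (hy : ReachAvoid (Γ.deleteEdges {s(x, y)}) B S y) (Z : Set V) (hZ : Z.ncard < k) :
    ∃ p ∈ insert x S, ReachAvoid (Γ.deleteEdges {s(x, y)}) A Z p := by
  by_contra hcon
  push Not at hcon
  have hsub : ∀ v, ReachAvoid (Γ.deleteEdges {s(x, y)}) A Z v →
      ReachAvoid (Γ.deleteEdges {s(x, y)}) A S v := by
    intro v hv
    induction hv with
    | base ha hZ => exact .base ha fun hS => hcon _ (Or.inr hS) (.base ha hZ)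
    | step hv hvw hw ih => exact ih.step hvw fun hS => hcon _ (Or.inr hS) (hv.step hvw hw)
  obtain ⟨b, hb, hr⟩ := h Z hZ
  obtain ⟨u, hu, v, hv, huZ, hvZ, huv⟩ := hr.exists_boundary
    (D := {v | ReachAvoid (Γ.deleteEdges {s(x, y)}) A Z v})
    (fun a ha haZ => .base ha haZ) (fun hb' => hsep b hb (hsub _ hb'))
  by_cases he : s(u, v) = s(x, y)
  · rw [Sym2.eq_iff] at he
    rcases he with ⟨rfl, rfl⟩ | ⟨rfl, rfl⟩
    · exact hcon _ (Or.inl rfl) hu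
    · obtain ⟨b', hb', hr'⟩ := (hsub _ hu).meet hy
      exact hsep b' hb' hr'
  · exact hv (ReachAvoid.step hu (by rw [deleteEdges_adj]; exact ⟨huv, he⟩) hvZ)

/-- Menger's theorem: if no set of fewer than `k` vertices separates `A` from `B`, then there are
`k` disjoint connected sets each meeting `A` and `B`. -/
theorem exists_disjoint_connected [Finite V] (k : ℕ) (n : ℕ) : ∀ (Γ : SimpleGraph V) (A B : Set V),
    Γ.edgeSet.ncard = n →
    (∀ S : Set V, S.ncard < k → ∃ b ∈ B, ReachAvoid Γ A S b) →
    ∃ C : Fin k → Set V, (Pairwise fun i j => Disjoint (C i) (C j)) ∧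
      ∀ i, (Γ.induce (C i)).Preconnected ∧ (C i ∩ A).Nonempty ∧ (C i ∩ B).Nonempty := by
  induction n with
  | zero =>
    intro Γ A B hn h
    have hE : Γ.edgeSet = ∅ := (Set.ncard_eq_zero (Set.toFinite _)).1 hn
    have hk : k ≤ (A ∩ B).ncard := by
      by_contra hlt
      obtain ⟨b, hb, hr⟩ := h (A ∩ B) (by omega)
      cases hr with
      | base ha hS => exact hS ⟨ha, hb⟩
      | @step v w _ hvw _ =>
        have : s(v, b) ∈ Γ.edgeSet := hvw
        rw [hE] at this
        exact this
    obtain ⟨t, ht, htc⟩ := Set.exists_subset_card_eq hk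
    have e : Nonempty (Fin k ≃ t) := by
      rw [← htc]
      exact ⟨(Finite.equivFinOfCardEq rfl).symm⟩
    obtain ⟨e⟩ := e
    refine ⟨fun i => {(e i : V)}, ?_, ?_⟩
    · intro i j hij
      rw [Set.disjoint_singleton]
      exact fun h => hij (e.injective (Subtype.ext h))
    · intro i
      exact ⟨(isTree_singleton _).connected.preconnected, ⟨_, rfl, (ht (e i).2).1⟩,
        ⟨_, rfl, (ht (e i).2).2⟩⟩
  | succ n ih =>
    intro Γ A B hn h
    obtain ⟨e, he⟩ : Γ.edgeSet.Nonempty := Set.nonempty_of_ncard_ne_zero (by omega)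
    have hcard : (Γ.deleteEdges {e}).edgeSet.ncard = n := by
      rw [edgeSet_deleteEdges, Set.ncard_sdiff_singleton_of_mem he, hn]
      rfl
    by_cases hdel : ∀ S : Set V, S.ncard < k → ∃ b ∈ B, ReachAvoid (Γ.deleteEdges {e}) A S b
    · obtain ⟨C, hd, hC⟩ := ih _ A B hcard hdel
      refine ⟨C, hd, fun i => ⟨(hC i).1.mono ?_, (hC i).2⟩⟩
      exact fun u v huv => (show Γ.deleteEdges {e} ≤ Γ from deleteEdges_le _) huv
    push Not at hdel
    obtain ⟨S, hS, hsep⟩ := hdel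
    obtain ⟨b₀, hb₀, hr₀⟩ := h S hS
    obtain ⟨x, y, rfl, hxR, hyT⟩ : ∃ x y, e = s(x, y) ∧
        ReachAvoid (Γ.deleteEdges {e}) A S x ∧ ReachAvoid (Γ.deleteEdges {e}) B S y := by
      obtain ⟨u, hu, v, hv, huS, hvS, huv⟩ := hr₀.exists_boundary
        (D := {v | ReachAvoid (Γ.deleteEdges {e}) A S v})
        (fun a ha haZ => .base ha haZ) (fun hb' => hsep _ hb₀ hb')
      have he1 : s(u, v) = e := by
        by_contra hne
        exact hv (ReachAvoid.step hu (by rw [deleteEdges_adj]; exact ⟨huv, hne⟩) hvS)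
      obtain ⟨a₀, ha₀, hr₁⟩ := hr₀.symm hb₀
      obtain ⟨u', hu', v', hv', huS', hvS', huv'⟩ := hr₁.exists_boundary
        (D := {v | ReachAvoid (Γ.deleteEdges {e}) B S v})
        (fun a ha haZ => .base ha haZ) (fun hb' => by
          obtain ⟨b, hb, hr⟩ := hb'.symm ha₀
          exact hsep _ hb hr)
      have he2 : s(u', v') = e := by
        by_contra hne
        exact hv' (ReachAvoid.step hu' (by rw [deleteEdges_adj]; exact ⟨huv', hne⟩) hvS')
      refine ⟨u, v, he1.symm, hu, ?_⟩
      rw [← he1, Sym2.eq_iff] at he2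
      rcases he2 with ⟨rfl, rfl⟩ | ⟨rfl, rfl⟩
      · obtain ⟨b, hb, hr⟩ := ReachAvoid.meet hu hu'
        exact absurd hr (hsep b hb)
      · exact hu'
    set Γ' := Γ.deleteEdges {s(x, y)} with hΓ'
    have hxS := hxR.notMem
    have hyS := hyT.notMem
    have hxy : x ≠ y := Γ.ne_of_adj he
    have hsep' : ∀ v, ReachAvoid Γ' A S v → ¬ ReachAvoid Γ' B S v := by
      intro v h1 h2
      obtain ⟨b, hb, hr⟩ := h1.meet h2
      exact hsep b hb hr
    have hP : (insert x S).ncard ≤ k := (Set.ncard_insert_le x S).trans (by omega)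
    have hQ : (insert y S).ncard ≤ k := (Set.ncard_insert_le y S).trans (by omega)
    obtain ⟨C, hCd, hC⟩ := ih Γ' A (insert x S) hcard
      (fun Z hZ => reachAvoid_deleteEdge h hsep hyT Z hZ)
    have hsym : ∀ S : Set V, S.ncard < k → ∃ a ∈ A, ReachAvoid Γ B S a := by
      intro S hS
      obtain ⟨b, hb, hr⟩ := h S hS
      exact hr.symm hb
    have hswap : Γ.deleteEdges {s(y, x)} = Γ' := by rw [hΓ', Sym2.eq_swap]
    obtain ⟨D, hDd, hD⟩ := ih Γ' B (insert y S) hcard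
      (fun Z hZ => by
        have := reachAvoid_deleteEdge (x := y) (y := x) hsym (S := S)
          (by rw [hswap]; intro a ha hr
              obtain ⟨b, hb, hr'⟩ := hr.symm ha
              exact hsep b hb hr') (by rw [hswap]; exact hxR) Z hZ
        rwa [hswap] at this)
    obtain ⟨g, ginj, hg, gsurj, guniq⟩ := exists_transversal hCd hP fun i => (hC i).2.2
    obtain ⟨g', ginj', hg', gsurj', guniq'⟩ := exists_transversal hDd hQ fun i => (hD i).2.2
    choose F hFC hgF hFA hFpre hFr using fun i => exists_trimmed (hC i).1 (hC i).2.1 (hg i).1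
    choose F' hFC' hgF' hFA' hFpre' hFr' using fun i => exists_trimmed (hD i).1 (hD i).2.1 (hg' i).1
    have hFr : ∀ i, ∀ v ∈ F i, v ≠ g i → v ∉ insert x S ∧ ReachAvoid Γ' A S v := by
      intro i v hv hne
      refine ⟨fun hP => hne (guniq i v (hFC i hv) hP), (hFr i v hv hne).mono ?_ le_rfl⟩
      intro z hz hzS
      rw [Set.mem_insert_iff, Set.mem_compl_iff] at hz
      push Not at hz
      exact hz.1 (guniq i z (hFC i hz.2) (Or.inr hzS))
    have hFr' : ∀ i, ∀ v ∈ F' i, v ≠ g' i → v ∉ insert y S ∧ ReachAvoid Γ' B S v := by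
      intro i v hv hne
      refine ⟨fun hP => hne (guniq' i v (hFC' i hv) hP), (hFr' i v hv hne).mono ?_ le_rfl⟩
      intro z hz hzS
      rw [Set.mem_insert_iff, Set.mem_compl_iff] at hz
      push Not at hz
      exact hz.1 (guniq' i z (hFC' i hz.2) (Or.inr hzS))
    have hτ : ∀ i, ∃ j, (g i = x ∧ g' j = y) ∨ (g i ∈ S ∧ g' j = g i) := by
      intro i
      rcases (hg i).2 with hx | hS
      · obtain ⟨j, hj⟩ := gsurj' y (Or.inl rfl)
        exact ⟨j, Or.inl ⟨hx, hj⟩⟩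
      · obtain ⟨j, hj⟩ := gsurj' (g i) (Or.inr hS)
        exact ⟨j, Or.inr ⟨hS, hj⟩⟩
    choose τ hτ using hτ
    have hmeet : ∀ i j v, v ∈ F i → v ∈ F' j → v = g i ∧ v = g' j ∧ v ∈ S := by
      intro i j v hv hv'
      by_cases h1 : v = g i
      · by_cases h2 : v = g' j
        · refine ⟨h1, h2, ?_⟩
          rcases (hg i).2 with hx | hS
          · rcases (hg' j).2 with hy | hS
            · exact absurd (hx.symm.trans (h1.symm.trans (h2.trans hy))) hxy
            · rwa [h2]
          · rwa [h1]
        · obtain ⟨h3, h4⟩ := hFr' j v hv' h2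
          rcases (hg i).2 with hx | hS
          · rw [h1, hx] at h4
            exact absurd h4 (hsep' x hxR)
          · exact absurd (Or.inr (h1 ▸ hS)) h3
      · obtain ⟨h3, h4⟩ := hFr i v hv h1
        by_cases h2 : v = g' j
        · rcases (hg' j).2 with hy | hS
          · rw [h2, hy] at h4
            exact absurd hyT (hsep' y h4)
          · exact absurd (Or.inr (h2 ▸ hS)) h3
        · exact absurd (hFr' j v hv' h2).2 (hsep' v h4)
    have hτinj : Function.Injective τ := by
      intro i j hij
      apply ginj
      rcases hτ i with ⟨h1, h2⟩ | ⟨h1, h2⟩ <;> rcases hτ j with ⟨h3, h4⟩ | ⟨h3, h4⟩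
      · rw [h1, h3]
      · rw [hij, h4] at h2; exact absurd (h2 ▸ h3) hyS
      · rw [← hij, h2] at h4; exact absurd (h4 ▸ h1) hyS
      · rw [← h2, ← h4, hij]
    have hmeet' : ∀ i j v, v ∈ F i → v ∈ F' (τ j) → i = j := by
      intro i j v hv hv'
      obtain ⟨h1, h2, h3⟩ := hmeet _ _ _ hv hv'
      apply ginj
      rcases hτ j with ⟨h4, h5⟩ | ⟨h4, h5⟩
      · rw [h5] at h2; exact absurd (h2 ▸ h3) hyS
      · rw [← h1, h2, h5]
    have hle : ∀ s : Set V, Γ'.induce s ≤ Γ.induce s := fun s u v huv =>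
      (show Γ' ≤ Γ from deleteEdges_le _) huv
    refine ⟨fun i => F i ∪ F' (τ i), ?_, ?_⟩
    · intro i j hij
      rw [Set.disjoint_left]
      rintro v (hv | hv) (hv' | hv')
      · exact Set.disjoint_left.1 (hCd hij) (hFC _ hv) (hFC _ hv')
      · exact hij (hmeet' _ _ _ hv hv')
      · exact hij (hmeet' _ _ _ hv' hv).symm
      · exact Set.disjoint_left.1 (hDd (hτinj.ne hij)) (hFC' _ hv) (hFC' _ hv')
    · intro i
      refine ⟨?_, (hFA i).mono (by intro z hz; exact ⟨Or.inl hz.1, hz.2⟩),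
        (hFA' (τ i)).mono (by intro z hz; exact ⟨Or.inr hz.1, hz.2⟩)⟩
      have h1 := (hFpre i).mono (hle _)
      have h2 := (hFpre' (τ i)).mono (hle _)
      rcases hτ i with ⟨h3, h4⟩ | ⟨h3, h4⟩
      · exact (connected_induce_union h1 h2 (hgF i) (hgF' (τ i)) (by rw [h3, h4]; exact he)).preconnected
      · exact (induce_union_connected h1 h2 ⟨g i, hgF i, h4 ▸ hgF' (τ i)⟩).preconnected

end Menger

end ThreeInATree

namespace ThreeInATree

open SimpleGraph

section NetBasics

variable {V : Type*} {G : SimpleGraph V} {X : Set V} {H : Net V}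

theorem Net.graph_adj {U W : H.nodes} :
    H.graph.Adj U W ↔ U ≠ W ∧ ∃ E ∈ H.arcs, H.ends E = s((U : Set V), (W : Set V)) := by
  rw [Net.graph, fromRel_adj]
  constructor
  · rintro ⟨h, h' | ⟨E, hE, h'⟩⟩
    · exact ⟨h, h'⟩
    · exact ⟨h, E, hE, by rw [h', Sym2.eq_swap]⟩
  · rintro ⟨h, h'⟩
    exact ⟨h, Or.inl h'⟩

theorem Net.nabla_adj {U W : H.nodes} :
    H.nabla.Adj U W ↔ H.graph.Adj U W ∨ U ≠ W ∧ H.IsLeafNode U ∧ H.IsLeafNode W := by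
  rw [Net.nabla, sup_adj, fromRel_adj]
  tauto

theorem IsNet.arc_ends (hnet : IsNet G X H) {E : Set V} (hE : E ∈ H.arcs) :
    ∃ U W : H.nodes, H.graph.Adj U W ∧ H.ends E = s((U : Set V), (W : Set V)) := by
  have hd := hnet.loopless E hE
  have hm := hnet.ends_mem E hE
  induction h : H.ends E with
  | h A B =>
    rw [h] at hd hm
    refine ⟨⟨A, hm A (by simp)⟩, ⟨B, hm B (by simp)⟩, ?_, rfl⟩
    rw [Net.graph_adj]
    refine ⟨?_, E, hE, h⟩
    intro hAB
    exact hd (by simpa using congrArg Subtype.val hAB)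

theorem IsNet.eq_of_mem (hnet : IsNet G X H) {E F : Set V} (hE : E ∈ H.arcs) (hF : F ∈ H.arcs)
    {x : V} (hxE : x ∈ E) (hxF : x ∈ F) : E = F := by
  by_contra hne
  exact Set.disjoint_left.1 (hnet.arcs_disjoint E hE F hF hne) hxE hxF

/-- The nodes containing a vertex of an arc are end-nodes of the arc. -/
theorem IsNet.mem_ends_of_mem (hnet : IsNet G X H) {E : Set V} (hE : E ∈ H.arcs) {N : H.nodes}
    {x : V} (hxE : x ∈ E) (hxN : x ∈ (N : Set V)) : (N : Set V) ∈ H.ends E :=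
  (hnet.meets_iff E hE N N.2).1 ⟨x, hxE, hxN⟩

theorem IsNet.eq_or_eq_of_mem (hnet : IsNet G X H) {E : Set V} (hE : E ∈ H.arcs) {U W N : H.nodes}
    (hends : H.ends E = s((U : Set V), (W : Set V)))
    {x : V} (hxE : x ∈ E) (hxN : x ∈ (N : Set V)) : N = U ∨ N = W := by
  have := hnet.mem_ends_of_mem hE hxE hxN
  rw [hends, Sym2.mem_iff] at this
  exact this.imp Subtype.ext Subtype.ext

theorem IsNet.exists_arc_of_mem (hnet : IsNet G X H) {x : V} (hx : x ∈ X) :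
    ∃ E ∈ H.arcs, x ∈ E := by
  rw [← hnet.arcs_cover] at hx
  exact hx

theorem IsNet.arc_subset (hnet : IsNet G X H) {E : Set V} (hE : E ∈ H.arcs) : E ⊆ X := by
  rw [← hnet.arcs_cover]
  exact Set.subset_sUnion_of_mem hE

/-- A vertex of a node `a` lies in an arc joining `a` to a neighbour of `a`. -/
theorem IsNet.exists_arc_of_mem_node (hnet : IsNet G X H) {a : H.nodes} {x : V}
    (hx : x ∈ (a : Set V)) : ∃ E ∈ H.arcs, x ∈ E ∧ ∃ D : H.nodes, H.graph.Adj a D ∧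
      H.ends E = s((a : Set V), (D : Set V)) := by
  obtain ⟨E, hE, hxE⟩ := hnet.exists_arc_of_mem (hnet.nodes_sub a a.2 hx)
  obtain ⟨U, W, hadj, hends⟩ := hnet.arc_ends hE
  rcases hnet.eq_or_eq_of_mem hE hends hxE hx with rfl | rfl
  · exact ⟨E, hE, hxE, W, hadj, hends⟩
  · exact ⟨E, hE, hxE, U, hadj.symm, by rw [hends, Sym2.eq_swap]⟩

theorem IsNet.inter_nonempty (hnet : IsNet G X H) {E : Set V} (hE : E ∈ H.arcs) {U W : H.nodes}
    (hends : H.ends E = s((U : Set V), (W : Set V))) : (E ∩ (U : Set V)).Nonempty :=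
  (hnet.meets_iff E hE U U.2).2 (by rw [hends]; simp)

theorem ends_swap {E : Set V} {U W : H.nodes}
    (hends : H.ends E = s((U : Set V), (W : Set V))) : H.ends E = s((W : Set V), (U : Set V)) := by
  rw [hends, Sym2.eq_swap]

theorem ends_eq_iff {E : Set V} {U W U' W' : H.nodes}
    (hends : H.ends E = s((U : Set V), (W : Set V))) :
    H.ends E = s((U' : Set V), (W' : Set V)) ↔ (U = U' ∧ W = W') ∨ (U = W' ∧ W = U') := by
  rw [hends, Sym2.eq_iff]
  simp only [Subtype.coe_inj]

/-- A vertex of an arc is adjacent to the vertices of another arc in a common node. -/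
theorem IsNet.adj_of_mem (hnet : IsNet G X H) {E F : Set V} (hE : E ∈ H.arcs) (hF : F ∈ H.arcs)
    (hne : E ≠ F) {N : H.nodes} {u v : V} (hu : u ∈ E) (hv : v ∈ F) (huN : u ∈ (N : Set V))
    (hvN : v ∈ (N : Set V)) : G.Adj u v :=
  (hnet.adj_iff E hE F hF hne u hu v hv).2 ⟨N, N.2, hnet.mem_ends_of_mem hE hu huN,
    hnet.mem_ends_of_mem hF hv hvN, huN, hvN⟩

theorem IsNet.exists_node_of_adj (hnet : IsNet G X H) {E F : Set V} (hE : E ∈ H.arcs)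
    (hF : F ∈ H.arcs) (hne : E ≠ F) {u v : V} (hu : u ∈ E) (hv : v ∈ F) (huv : G.Adj u v) :
    ∃ N : H.nodes, u ∈ (N : Set V) ∧ v ∈ (N : Set V) := by
  obtain ⟨N, hN, -, -, h1, h2⟩ := (hnet.adj_iff E hE F hF hne u hu v hv).1 huv
  exact ⟨⟨N, hN⟩, h1, h2⟩

theorem IsNet.exists_rung (hnet : IsNet G X H) {E : Set V} (hE : E ∈ H.arcs) {U W : H.nodes}
    (hends : H.ends E = s((U : Set V), (W : Set V))) {x : V} (hx : x ∈ E) :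
    ∃ P, x ∈ P ∧ P ⊆ E ∧ IsRung G U W P :=
  hnet.rungs E hE U W hends x hx

theorem isChunk_arc {E : Set V} (hE : E ∈ H.arcs) {U W : H.nodes}
    (h : H.ends E = s((U : Set V), (W : Set V))) : IsChunk H U W E := by
  refine ⟨{{E}}, ⟨_, rfl⟩, ?_, by simp⟩
  rintro 𝒜 rfl
  exact Or.inl ⟨E, hE, h, rfl⟩

theorem IsNet.ncard_leafNodes (hnet : IsNet G X H) :
    {n : H.nodes | H.IsLeafNode n}.ncard = 3 := by
  rw [← hnet.leaf_count, ← Set.ncard_image_of_injective _ Subtype.val_injective]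
  congr 1
  ext N
  constructor
  · rintro ⟨n, hn, rfl⟩; exact hn
  · intro hN; exact ⟨⟨N, hN.1⟩, hN, rfl⟩

end NetBasics

section SelfAiding

variable {V : Type*} [Finite V] {G : SimpleGraph V} {X : Set V} {H : Net V}

/-- In a self-aiding net every chunk consists of a single arc. -/
theorem SelfAiding.eq_of_subset_chunk (hnet : IsNet G X H) (hself : SelfAiding H)
    {U W : H.nodes} {C : Set V} (hC : IsChunk H U W C) {E F : Set V} (hE : E ∈ H.arcs)
    (hF : F ∈ H.arcs) (hEC : E ⊆ C) (hFC : F ⊆ C) : E = F := by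
  obtain ⟨C', ⟨⟨hC', hle⟩, hmax⟩⟩ := (Set.toFinite {D : Set V | (∃ U W, IsChunk H U W D) ∧ C ⊆ D}
    ).exists_maximal ⟨C, ⟨U, W, hC⟩, subset_rfl⟩
  have hM : IsMaxChunk H C' := by
    refine ⟨hC', fun D U' W' hD hsub => ?_⟩
    exact Set.Subset.antisymm (hmax ⟨⟨U', W', hD⟩, hle.trans hsub⟩ hsub) hsub
  have harc : C' ∈ H.arcs := by
    have := hself.arcs
    rw [this]
    exact Or.inr hM
  have key : ∀ D ∈ H.arcs, D ⊆ C → D = C' := by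
    intro D hD hDC
    obtain ⟨x, hx⟩ := hnet.arc_nonempty D hD
    exact hnet.eq_of_mem hD harc hx (hle (hDC hx))
  rw [key E hE hEC, key F hF hFC]

theorem SelfAiding.arc_unique (hnet : IsNet G X H) (hself : SelfAiding H) {E F : Set V}
    (hE : E ∈ H.arcs) (hF : F ∈ H.arcs) {U W : H.nodes}
    (h₁ : H.ends E = s((U : Set V), (W : Set V)))
    (h₂ : H.ends F = s((U : Set V), (W : Set V))) : E = F := by
  refine hself.eq_of_subset_chunk hnet (U := U) (W := W) (C := E ∪ F) ?_ hE hF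
    Set.subset_union_left Set.subset_union_right
  refine ⟨{{E}, {F}}, ⟨_, Or.inl rfl⟩, ?_, ?_⟩
  · rintro 𝒜 (rfl | rfl)
    · exact Or.inl ⟨E, hE, h₁, rfl⟩
    · exact Or.inl ⟨F, hF, h₂, rfl⟩
  · ext x
    simp [or_comm]

/-- In a self-aiding net `∇(ℍ)` has no cutset of two nodes. -/
theorem SelfAiding.preconnected_pair (hnet : IsNet G X H) (hself : SelfAiding H)
    {U W : H.nodes} (hUW : U ≠ W) : (H.nabla.induce {U, W}ᶜ).Preconnected := by
  by_contra hcut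
  have hcut' := hcut
  rw [Preconnected] at hcut'
  push Not at hcut'
  obtain ⟨u₁, u₂, hu⟩ := hcut'
  obtain ⟨u, hleaf⟩ : ∃ u : ({U, W}ᶜ : Set H.nodes), ∀ v, (H.nabla.induce {U, W}ᶜ).Reachable u v →
      ¬ H.IsLeafNode (v : H.nodes) := by
    by_contra hcon
    push Not at hcon
    obtain ⟨v₁, h₁, hl₁⟩ := hcon u₁
    obtain ⟨v₂, h₂, hl₂⟩ := hcon u₂
    apply hu
    by_cases hv : v₁ = v₂
    · subst hv
      exact h₁.trans h₂.symm
    · refine h₁.trans (Reachable.trans (Adj.reachable ?_) h₂.symm)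
      change H.nabla.Adj v₁ v₂
      rw [Net.nabla_adj]
      exact Or.inr ⟨fun h => hv (Subtype.ext h), hl₁, hl₂⟩
  set K : Set H.nodes := {n | ∃ h : n ∈ ({U, W}ᶜ : Set H.nodes),
    (H.nabla.induce {U, W}ᶜ).Reachable u ⟨n, h⟩} with hK
  have hKU : U ∉ K := fun ⟨h, _⟩ => h (by simp)
  have hKW : W ∉ K := fun ⟨h, _⟩ => h (by simp)
  have huK : (u : H.nodes) ∈ K := ⟨u.2, Reachable.refl _⟩
  have hKcl : ∀ a ∈ K, ∀ b, H.nabla.Adj a b → b = U ∨ b = W ∨ b ∈ K := by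
    rintro a ⟨ha, hra⟩ b hab
    by_cases hb : b ∈ ({U, W} : Set H.nodes)
    · rcases hb with hb | hb
      · exact Or.inl hb
      · exact Or.inr (Or.inl hb)
    · exact Or.inr (Or.inr ⟨hb, hra.trans (Adj.reachable hab)⟩)
  have hKleaf : ∀ a ∈ K, ¬ H.IsLeafNode a := fun a ⟨ha, hr⟩ => hleaf _ hr
  let Γ' : H.nabla.Subgraph :=
    { verts := K ∪ {U, W}
      Adj := fun a b => H.nabla.Adj a b ∧ a ∈ K ∪ {U, W} ∧ b ∈ K ∪ {U, W} ∧ (a ∈ K ∨ b ∈ K)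
      adj_sub := fun h => h.1
      edge_vert := fun h => h.2.1
      symm := ⟨fun a b h => ⟨h.1.symm, h.2.2.1, h.2.1, h.2.2.2.symm⟩⟩ }
  have hgraph : ∀ A B, Γ'.Adj A B → H.graph.Adj A B := by
    rintro A B ⟨hadj, -, -, hAB⟩
    rw [Net.nabla_adj] at hadj
    rcases hadj with h | ⟨-, h1, h2⟩
    · exact h
    · rcases hAB with h | h
      · exact absurd h1 (hKleaf _ h)
      · exact absurd h2 (hKleaf _ h)
  have hunsplit : UnsplitBy Γ' U W := by
    refine ⟨Or.inr (Or.inl rfl), Or.inr (Or.inr rfl), ?_, ?_⟩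
    · rintro ⟨-, -, -, h | h⟩
      · exact hKU h
      · exact hKW h
    · have hv : ∀ n, n ∈ (Γ'.deleteVerts {U, W}).verts ↔ n ∈ K := by
        intro n
        rw [Subgraph.deleteVerts_verts]
        constructor
        · rintro ⟨h | h, h'⟩
          · exact h
          · exact absurd h h'
        · exact fun h => ⟨Or.inl h, h.1⟩
      have hreach : ∀ v w : ({U, W}ᶜ : Set H.nodes), (H.nabla.induce {U, W}ᶜ).Walk v w →
          ∀ hv' : (v : H.nodes) ∈ K, ∃ hw' : (w : H.nodes) ∈ K,
            (Γ'.deleteVerts {U, W}).coe.Reachable ⟨v, (hv _).2 hv'⟩ ⟨w, (hv _).2 hw'⟩ := by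
        intro v w p
        induction p with
        | nil => exact fun h => ⟨h, Reachable.refl _⟩
        | @cons a b c hab p ih =>
          intro ha
          have hb : (b : H.nodes) ∈ K := by
            rcases hKcl a ha b hab with h | h | h
            · exact absurd (by rw [h]; simp) b.2
            · exact absurd (by rw [h]; simp) b.2
            · exact h
          obtain ⟨hc, hr⟩ := ih hb
          refine ⟨hc, Reachable.trans (Adj.reachable ?_) hr⟩
          rw [Subgraph.coe_adj, Subgraph.deleteVerts_adj]
          exact ⟨Or.inl ha, a.2, Or.inl hb, b.2, hab, Or.inl ha, Or.inl hb, Or.inl ha⟩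
      rintro ⟨n, hn⟩ ⟨m, hm⟩
      obtain ⟨hn1, ⟨p⟩⟩ := (hv n).1 hn
      obtain ⟨hm1, ⟨q⟩⟩ := (hv m).1 hm
      obtain ⟨_, h1⟩ := hreach _ _ p huK
      obtain ⟨_, h2⟩ := hreach _ _ q huK
      exact h1.symm.trans h2
  have hmax : ∀ Γ'' : H.nabla.Subgraph, Γ' ≤ Γ'' → UnsplitBy Γ'' U W → Γ'' = Γ' := by
    rintro Γ'' hle ⟨hU, hW, hnadj, hpre⟩
    refine le_antisymm ?_ hle
    have hu'' : (u : H.nodes) ∈ (Γ''.deleteVerts {U, W}).verts :=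
      ⟨hle.1 (Or.inl huK), u.2⟩
    have hverts : Γ''.verts ⊆ Γ'.verts := by
      intro n hn
      by_cases hn' : n ∈ ({U, W} : Set H.nodes)
      · exact Or.inr hn'
      · have hr := hpre ⟨u, hu''⟩ ⟨n, hn, hn'⟩
        left
        let f : (Γ''.deleteVerts {U, W}).coe →g H.nabla.induce {U, W}ᶜ :=
          { toFun := fun n => ⟨n.1, n.2.2⟩
            map_rel' := fun {a b} hab => (Γ''.deleteVerts {U, W}).adj_sub hab }
        exact ⟨hn', hr.map f⟩
    refine ⟨hverts, ?_⟩
    intro a b hab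
    have ha := hverts hab.fst_mem
    have hb := hverts hab.snd_mem
    refine ⟨Γ''.adj_sub hab, ha, hb, ?_⟩
    rcases ha with ha | ha
    · exact Or.inl ha
    rcases hb with hb | hb
    · exact Or.inr hb
    rcases ha with rfl | rfl <;> rcases hb with rfl | rfl
    · exact absurd rfl hab.ne
    · exact absurd hab hnadj
    · exact absurd hab.symm hnadj
    · exact absurd rfl hab.ne
  have hcross : ∀ A B : H.nodes, A ≠ B → ({A, B} : Set H.nodes) = {U, W} →
      ∃ k ∈ K, H.nabla.Adj k A := by
    intro A B hAB hset
    have hA : A = U ∨ A = W := by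
      have : A ∈ ({A, B} : Set H.nodes) := Or.inl rfl
      rwa [hset] at this
    have huB : (u : H.nodes) ∈ ({B}ᶜ : Set H.nodes) := by
      intro h
      exact u.2 (hset.subset (Or.inr h))
    obtain ⟨p⟩ := (hnet.bicon.2 B).preconnected ⟨u, huB⟩ ⟨A, hAB⟩
    obtain ⟨d, -, h1, h2⟩ := p.exists_boundary_dart {n | (n : H.nodes) ∈ K} huK
      (by rcases hA with rfl | rfl
          · exact hKU
          · exact hKW)
    refine ⟨_, h1, ?_⟩
    have hadj : H.nabla.Adj d.fst d.snd := d.adj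
    have hmem : (d.snd : H.nodes) ∈ ({U, W} : Set H.nodes) := by
      rcases hKcl _ h1 _ hadj with h | h | h
      · exact Or.inl h
      · exact Or.inr h
      · exact absurd h h2
    rw [← hset] at hmem
    rcases hmem with h | h
    · rw [← h]; exact hadj
    · exact absurd h d.snd.2
  obtain ⟨k₁, hk₁, hadj₁⟩ := hcross U W hUW rfl
  obtain ⟨k₂, hk₂, hadj₂⟩ := hcross W U hUW.symm (Set.pair_comm _ _)
  have hΓ₁ : Γ'.Adj k₁ U := ⟨hadj₁, Or.inl hk₁, Or.inr (Or.inl rfl), Or.inl hk₁⟩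
  have hΓ₂ : Γ'.Adj k₂ W := ⟨hadj₂, Or.inl hk₂, Or.inr (Or.inr rfl), Or.inl hk₂⟩
  obtain ⟨-, E, hE, hends₁⟩ := Net.graph_adj.1 (hgraph _ _ hΓ₁)
  obtain ⟨-, F, hF, hends₂⟩ := Net.graph_adj.1 (hgraph _ _ hΓ₂)
  have hEF : E = F := by
    refine hself.eq_of_subset_chunk hnet (U := U) (W := W) ⟨{{E | E ∈ H.arcs ∧
      ∃ A B, Γ'.Adj A B ∧ H.ends E = s((A : Set V), (B : Set V))}}, ⟨_, rfl⟩, ?_, rfl⟩ hE hF ?_ ?_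
    · rintro 𝒜 rfl
      exact Or.inr ⟨hUW, hcut, Γ', hunsplit, hmax, hgraph, rfl⟩
    · rw [Set.sUnion_singleton]
      exact Set.subset_sUnion_of_mem ⟨hE, _, _, hΓ₁, hends₁⟩
    · rw [Set.sUnion_singleton]
      exact Set.subset_sUnion_of_mem ⟨hF, _, _, hΓ₂, hends₂⟩
  subst hEF
  rcases (ends_eq_iff hends₁).1 hends₂ with ⟨-, h⟩ | ⟨h, -⟩
  · exact hUW h
  · exact hKW (h ▸ hk₁)

/-- Deleting at most two other nodes leaves every node connected to a leaf node. -/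
theorem SelfAiding.exists_leaf_reachAvoid (hnet : IsNet G X H) (hself : SelfAiding H)
    {S : Set H.nodes} (hS : S.ncard ≤ 2) {v : H.nodes} (hv : v ∉ S) :
    ∃ l : H.nodes, H.IsLeafNode l ∧ ReachAvoid H.graph {v} S l := by
  have hpre : (H.nabla.induce Sᶜ).Preconnected := by
    have : S.ncard = 0 ∨ S.ncard = 1 ∨ S.ncard = 2 := by omega
    rcases this with h | h | h
    · rw [Set.ncard_eq_zero] at h
      subst h
      rw [Set.compl_empty]
      exact (induceUnivIso H.nabla).symm.preconnected_iff.1 hnet.bicon.1.preconnected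
    · obtain ⟨s, rfl⟩ := Set.ncard_eq_one.1 h
      exact (hnet.bicon.2 s).preconnected
    · obtain ⟨s, t, hst, rfl⟩ := Set.ncard_eq_two.1 h
      exact hself.preconnected_pair hnet hst
  obtain ⟨l, hl, hlS⟩ : ∃ l : H.nodes, H.IsLeafNode l ∧ l ∉ S := by
    by_contra hcon
    push Not at hcon
    have := Set.ncard_le_ncard (s := {n : H.nodes | H.IsLeafNode n}) (t := S) hcon
    rw [hnet.ncard_leafNodes] at this
    omega
  have hr : ReachAvoid H.nabla {v} S l := by
    obtain ⟨p, hp⟩ := exists_walk_of_induce_preconnected hpre (u := v) (v := l) hv hlS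
    exact ReachAvoid.append (.base rfl hv) p hp
  by_cases hlD : ReachAvoid H.graph {v} S l
  · exact ⟨l, hl, hlD⟩
  obtain ⟨u, hu, w, hw, -, hwS, huw⟩ := hr.exists_boundary
    (D := {n | ReachAvoid H.graph {v} S n}) (fun a ha haS => .base ha haS) hlD
  rw [Net.nabla_adj] at huw
  rcases huw with h | ⟨-, h, -⟩
  · exact absurd (ReachAvoid.step hu h hwS) hw
  · exact ⟨u, h, hu⟩

/-- A node that is not a leaf has a neighbour different from any two given nodes. -/
theorem SelfAiding.exists_adj_ne (hnet : IsNet G X H) (hself : SelfAiding H) {a : H.nodes}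
    (ha : ¬ H.IsLeafNode a) (c d : H.nodes) : ∃ A, H.graph.Adj a A ∧ A ≠ c ∧ A ≠ d := by
  have hS : ({c, d} \ {a} : Set H.nodes).ncard ≤ 2 :=
    (Set.ncard_le_ncard Set.sdiff_subset).trans
      ((Set.ncard_insert_le _ _).trans (by rw [Set.ncard_singleton]))
  obtain ⟨l, hl, hr⟩ := hself.exists_leaf_reachAvoid hnet hS (v := a) (by simp)
  obtain ⟨u, rfl, w, hw, -, hwS, huw⟩ := hr.exists_boundary (D := {a}) (fun b hb _ => hb)
    (by rintro rfl; exact ha hl)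
  refine ⟨w, huw, ?_, ?_⟩
  · rintro rfl; exact hwS ⟨Or.inl rfl, hw⟩
  · rintro rfl; exact hwS ⟨Or.inr rfl, hw⟩

theorem IsNet.isLeafNode_of_isLeaf (hnet : IsNet G X H)
    (hleaves : {v | IsLeaf G v}.ncard = 3) {v : V} (hv : IsLeaf G v) : H.IsLeafNode {v} := by
  have : Nonempty V := ⟨v⟩
  choose! f hf hf' using hnet.leaf_single
  have hsub : f '' {N | H.IsLeafNode N} ⊆ {v | IsLeaf G v} := by
    rintro _ ⟨N, hN, rfl⟩
    exact hf N hN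
  have hinj : Set.InjOn f {N | H.IsLeafNode N} := by
    intro N hN N' hN' h
    rw [hf' N hN, hf' N' hN', h]
  have heq : f '' {N | H.IsLeafNode N} = {v | IsLeaf G v} := by
    refine Set.eq_of_subset_of_ncard_le hsub ?_ (Set.toFinite _)
    rw [hinj.ncard_image, hnet.leaf_count, hleaves]
  have : v ∈ f '' {N | H.IsLeafNode N} := by rw [heq]; exact hv
  obtain ⟨N, hN, rfl⟩ := this
  rw [← hf' N hN]
  exact hN

theorem SelfAiding.leafNode_not_adj (hnet : IsNet G X H) {l l' : H.nodes}
    (hl : H.IsLeafNode l) (hl' : H.IsLeafNode l') : ¬ H.graph.Adj l l' := by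
  intro hadj
  obtain ⟨-, E, hE, hends⟩ := Net.graph_adj.1 hadj
  obtain ⟨m, hm, hml, hml'⟩ : ∃ m : H.nodes, H.IsLeafNode m ∧ m ≠ l ∧ m ≠ l' := by
    by_contra hcon
    push Not at hcon
    have hsub : {n : H.nodes | H.IsLeafNode n} ⊆ {l, l'} := by
      intro n hn
      by_cases h : n = l
      · exact Or.inl h
      · exact Or.inr (hcon n hn h)
    have := Set.ncard_le_ncard hsub
    rw [hnet.ncard_leafNodes] at this
    have := Set.ncard_insert_le l {l'}
    rw [Set.ncard_singleton] at this
    omega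
  obtain ⟨p⟩ := hnet.conn.preconnected l m
  obtain ⟨d, -, h1, h2⟩ := p.exists_boundary_dart {l, l'} (Or.inl rfl)
    (by rintro (h | h) <;> contradiction)
  obtain ⟨-, F, hF, hendsF⟩ := Net.graph_adj.1 d.adj
  have hFE : F = E := by
    have key : ∀ n : H.nodes, H.IsLeafNode n → (n : Set V) ∈ H.ends E → (n : Set V) ∈ H.ends F →
        F = E := fun n hn h1 h2 => hn.2.unique ⟨hF, h2⟩ ⟨hE, h1⟩
    rcases h1 with h | h
    · exact key l hl (by rw [hends]; simp) (by rw [hendsF, h]; simp)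
    · rw [Set.mem_singleton_iff] at h
      exact key l' hl' (by rw [hends]; simp) (by rw [hendsF, h]; simp)
  subst hFE
  apply h2
  rcases (ends_eq_iff hends).1 hendsF with ⟨-, h⟩ | ⟨h, -⟩
  · exact Or.inr h.symm
  · exact Or.inl h.symm

/-- A leaf of `G` in a leaf node has its neighbour in `X`, so it has no neighbour outside. -/
theorem SelfAiding.leaf_notMem_nbrIn (hnet : IsNet G X H) (hself : SelfAiding H) {Y : Set V}
    (hY : Disjoint Y X) {l : H.nodes} (hl : H.IsLeafNode l) {x : V} (hx : x ∈ (l : Set V)) :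
    x ∉ nbrIn G X Y := by
  obtain ⟨v, hv, hlv⟩ := hnet.leaf_single l hl
  rw [hlv, Set.mem_singleton_iff] at hx
  subst hx
  have hxl : x ∈ (l : Set V) := by rw [hlv]; rfl
  obtain ⟨E, hE, hxE, D, hadj, hends⟩ := hnet.exists_arc_of_mem_node hxl
  obtain ⟨w, hw, hxw⟩ : ∃ w ∈ X, G.Adj x w := by
    by_cases hxD : x ∈ (D : Set V)
    · have hD : ¬ H.IsLeafNode D := fun h => SelfAiding.leafNode_not_adj hnet hl h hadj
      obtain ⟨A, hDA, hAl, -⟩ := hself.exists_adj_ne hnet hD l l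
      obtain ⟨-, F, hF, hendsF⟩ := Net.graph_adj.1 hDA
      obtain ⟨w, hwF, hwD⟩ := hnet.inter_nonempty hF hendsF
      refine ⟨w, hnet.arc_subset hF hwF, hnet.adj_of_mem hE hF ?_ hxE hwF hxD hwD⟩
      rintro rfl
      rcases (ends_eq_iff hends).1 hendsF with ⟨h, -⟩ | ⟨h, -⟩
      · exact hadj.ne h
      · exact hAl h.symm
    · obtain ⟨P, hxP, hPE, hP⟩ := hnet.exists_rung hE hends hxE
      obtain ⟨ht, -, ⟨w, ⟨hwP, hwD⟩, -⟩⟩ := hP.tree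
      have hne : x ≠ w := by rintro rfl; exact hxD hwD
      obtain ⟨p⟩ := ht.connected.preconnected ⟨x, hxP⟩ ⟨w, hwP⟩
      cases p with
      | nil => exact absurd rfl hne
      | @cons _ b _ h p => exact ⟨b, hnet.arc_subset hE (hPE b.2), h⟩
  rintro ⟨-, y, hy, hyx⟩
  have := hv.unique hxw hyx.symm
  subst this
  exact Set.disjoint_left.1 hY hy hw

end SelfAiding

end ThreeInATree

namespace ThreeInATree

open SimpleGraph

section Routes

variable {α : Type*} {Γ : SimpleGraph α}

/-- `P` is the vertex set of a path of `Γ` from `c` to `l`. -/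
def Route (Γ : SimpleGraph α) (c l : α) (P : Set α) : Prop :=
  ∃ p : Γ.Walk c l, p.IsPath ∧ P = {v | v ∈ p.support}

theorem Route.start_mem {c l : α} {P : Set α} (h : Route Γ c l P) : c ∈ P := by
  obtain ⟨p, -, rfl⟩ := h
  exact p.start_mem_support

theorem exists_route_of_walk {c l : α} (p : Γ.Walk c l) :
    ∃ P ⊆ {v | v ∈ p.support}, Route Γ c l P := by
  classical
  exact ⟨_, fun x hx => p.support_bypass_subset_support hx, p.bypass, p.bypass_isPath, rfl⟩

theorem Route.suffix {c l D : α} {P : Set α} (h : Route Γ c l P) (hD : D ∈ P) :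
    ∃ P' ⊆ P, Route Γ D l P' ∧ (D ≠ c → c ∉ P') := by
  classical
  obtain ⟨p, hp, rfl⟩ := h
  refine ⟨_, fun x hx => p.support_dropUntil_subset_support hD hx, ⟨p.dropUntil D hD, hp.dropUntil hD, rfl⟩, ?_⟩
  intro hne hc
  have hspec := p.take_spec hD
  have hnd := hp.support_nodup
  rw [← hspec, Walk.support_append] at hnd
  have hc' : c ∈ (p.dropUntil D hD).support.tail := by
    have hc2 : c ∈ (p.dropUntil D hD).support := hc
    rw [← Walk.cons_tail_support, List.mem_cons] at hc2
    exact hc2.resolve_left (Ne.symm hne)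
  exact (List.nodup_append.1 hnd).2.2 c (Walk.start_mem_support _) c hc' rfl

theorem Route.step {c l : α} {P : Set α} (h : Route Γ c l P) (hne : c ≠ l) :
    ∃ A ∈ P, Γ.Adj c A ∧ ∃ P' ⊆ P, Route Γ A l P' ∧ c ∉ P' := by
  obtain ⟨p, hp, rfl⟩ := h
  cases p with
  | nil => exact absurd rfl hne
  | @cons _ A _ hadj p =>
    rw [Walk.cons_isPath_iff] at hp
    refine ⟨A, ?_, hadj, {v | v ∈ p.support}, ?_, ⟨p, hp.1, rfl⟩, hp.2⟩
    · simp
    · intro x hx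
      simp only [Walk.support_cons, List.mem_cons, Set.mem_ofPred_eq]
      exact Or.inr hx

theorem exists_three_routes [Finite α] {n₁ n₂ n₃ : α} (h₁₂ : n₁ ≠ n₂) (h₁₃ : n₁ ≠ n₃)
    (h₂₃ : n₂ ≠ n₃) {B : Set α}
    (h : ∀ S : Set α, S.ncard < 3 → ∃ b ∈ B, ReachAvoid Γ {n₁, n₂, n₃} S b) :
    ∃ l₁ ∈ B, ∃ l₂ ∈ B, ∃ l₃ ∈ B, ∃ P₁ P₂ P₃, Route Γ n₁ l₁ P₁ ∧ Route Γ n₂ l₂ P₂ ∧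
      Route Γ n₃ l₃ P₃ ∧ Disjoint P₁ P₂ ∧ Disjoint P₁ P₃ ∧ Disjoint P₂ P₃ := by
  obtain ⟨C, hd, hC⟩ := exists_disjoint_connected 3 _ Γ {n₁, n₂, n₃} B rfl h
  have hcard : ({n₁, n₂, n₃} : Set α).ncard ≤ 3 :=
    (Set.ncard_insert_le _ _).trans (Nat.succ_le_succ
      ((Set.ncard_insert_le _ _).trans (by rw [Set.ncard_singleton])))
  obtain ⟨g, ginj, hg, gsurj, -⟩ := exists_transversal hd hcard fun i => (hC i).2.1
  obtain ⟨i₁, e₁⟩ := gsurj n₁ (by simp)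
  obtain ⟨i₂, e₂⟩ := gsurj n₂ (by simp)
  obtain ⟨i₃, e₃⟩ := gsurj n₃ (by simp)
  have key : ∀ i n, g i = n → ∃ l ∈ B, ∃ P ⊆ C i, Route Γ n l P := by
    rintro i n rfl
    obtain ⟨l, hl, hlB⟩ := (hC i).2.2
    obtain ⟨p, hp⟩ := exists_walk_of_induce_preconnected (hC i).1 (hg i).1 hl
    obtain ⟨P, hP, hr⟩ := exists_route_of_walk p
    exact ⟨l, hlB, P, fun x hx => hp x (hP hx), hr⟩
  obtain ⟨l₁, hl₁, P₁, hP₁, hr₁⟩ := key i₁ n₁ e₁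
  obtain ⟨l₂, hl₂, P₂, hP₂, hr₂⟩ := key i₂ n₂ e₂
  obtain ⟨l₃, hl₃, P₃, hP₃, hr₃⟩ := key i₃ n₃ e₃
  have hdis : ∀ {i j n m} {P Q : Set α}, g i = n → g j = m → n ≠ m → P ⊆ C i → Q ⊆ C j →
      Disjoint P Q := by
    intro i j n m P Q hi hj hnm hP hQ
    refine (hd ?_).mono hP hQ
    rintro rfl
    exact hnm (hi.symm.trans hj)
  exact ⟨l₁, hl₁, l₂, hl₂, l₃, hl₃, P₁, P₂, P₃, hr₁, hr₂, hr₃, hdis e₁ e₂ h₁₂ hP₁ hP₂,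
    hdis e₁ e₃ h₁₃ hP₁ hP₃, hdis e₂ e₃ h₂₃ hP₂ hP₃⟩

/-- The graph obtained by splitting the vertex `a` into `some a`, joined to `𝒞`, and `none`,
joined to `𝒩`. -/
def splitGraph (Γ : SimpleGraph α) (a : α) (𝒞 𝒩 : Set α) : SimpleGraph (Option α) :=
  SimpleGraph.fromRel fun x y =>
    (∃ u v, x = some u ∧ y = some v ∧ Γ.Adj u v ∧ u ≠ a ∧ v ≠ a) ∨
    (x = some a ∧ ∃ v ∈ 𝒞, y = some v) ∨ (x = none ∧ ∃ v ∈ 𝒩, y = some v)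

theorem splitGraph_adj_some {a : α} {𝒞 𝒩 : Set α} {u v : α} (hu : u ≠ a) (hv : v ≠ a)
    (h : Γ.Adj u v) : (splitGraph Γ a 𝒞 𝒩).Adj (some u) (some v) := by
  rw [splitGraph, fromRel_adj]
  exact ⟨fun h' => h.ne (Option.some_injective _ h'), Or.inl (Or.inl ⟨u, v, rfl, rfl, h, hu, hv⟩)⟩

theorem splitGraph_adj_mem {a : α} {𝒞 𝒩 : Set α} {v : α} (hv : v ≠ a) (h : v ∈ 𝒞) :
    (splitGraph Γ a 𝒞 𝒩).Adj (some a) (some v) := by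
  rw [splitGraph, fromRel_adj]
  exact ⟨fun h' => hv (Option.some_injective _ h').symm, Or.inl (Or.inr (Or.inl ⟨rfl, v, h, rfl⟩))⟩

theorem splitGraph_adj_none {a : α} {𝒞 𝒩 : Set α} {v : α} (h : v ∈ 𝒩) :
    (splitGraph Γ a 𝒞 𝒩).Adj none (some v) := by
  rw [splitGraph, fromRel_adj]
  exact ⟨by simp, Or.inl (Or.inr (Or.inr ⟨rfl, v, h, rfl⟩))⟩

theorem adj_of_splitGraph {a : α} {𝒞 𝒩 : Set α} {u v : α} (hu : u ≠ a) (hv : v ≠ a)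
    (h : (splitGraph Γ a 𝒞 𝒩).Adj (some u) (some v)) : Γ.Adj u v := by
  rw [splitGraph, fromRel_adj] at h
  simp only [Option.some.injEq, reduceCtorEq, false_and, or_false, hu, hv] at h
  rcases h.2 with ⟨u', v', rfl, rfl, h, -⟩ | ⟨u', v', rfl, rfl, h, -⟩
  · exact h
  · exact h.symm

theorem mem_of_splitGraph_some {a : α} {𝒞 𝒩 : Set α} {x : Option α}
    (h : (splitGraph Γ a 𝒞 𝒩).Adj (some a) x) (hx : x ≠ none) : ∃ v ∈ 𝒞, x = some v := by
  rw [splitGraph, fromRel_adj] at h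
  rcases h with ⟨hne, (⟨u, v, h1, h2, h3, h4, h5⟩ | ⟨-, h⟩ | ⟨h, -⟩) |
    (⟨u, v, h1, h2, h3, h4, h5⟩ | ⟨h, -⟩ | ⟨h, -⟩)⟩
  · exact absurd (Option.some_injective _ h1).symm h4
  · exact h
  · simp at h
  · exact absurd (Option.some_injective _ h2).symm h5
  · exact absurd h.symm hne
  · exact absurd h hx

theorem mem_of_splitGraph_none {a : α} {𝒞 𝒩 : Set α} {x : Option α}
    (h : (splitGraph Γ a 𝒞 𝒩).Adj none x) : ∃ v ∈ 𝒩, x = some v := by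
  rw [splitGraph, fromRel_adj] at h
  rcases h with ⟨hne, (⟨u, v, h1, -⟩ | ⟨h, -⟩ | ⟨-, h⟩) |
    (⟨u, v, -, h2, -⟩ | ⟨-, v, -, h⟩ | ⟨-, v, -, h⟩)⟩
  · simp at h1
  · simp at h
  · exact h
  · simp at h2
  · simp at h
  · simp at h

theorem exists_walk_of_splitGraph {a : α} {𝒞 𝒩 : Set α} {x y : Option α}
    (p : (splitGraph Γ a 𝒞 𝒩).Walk x y) : none ∉ p.support → some a ∉ p.support →
    ∀ u v, x = some u → y = some v → ∃ q : Γ.Walk u v, ∀ n ∈ q.support, some n ∈ p.support := by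
  induction p with
  | nil =>
    intro _ _ u v hu hv
    obtain rfl : u = v := Option.some_injective _ (hu.symm.trans hv)
    exact ⟨Walk.nil, by simp [hu]⟩
  | @cons x z y h p ih =>
    intro h1 h2 u v hu hv
    rw [Walk.support_cons, List.mem_cons] at h1 h2
    push Not at h1 h2
    rcases Option.eq_none_or_eq_some z with hz | ⟨w, hz⟩
    · exact absurd (hz ▸ p.start_mem_support) h1.2
    · obtain ⟨q, hq⟩ := ih h1.2 h2.2 w v hz hv
      have hadj : Γ.Adj u w := by
        subst hu hz
        refine adj_of_splitGraph (fun h' => h2.1 (by rw [h'])) (fun h' => h2.2 ?_) h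
        have hs : ∀ o, o = some w → o ∈ p.support := by rintro o rfl; exact p.start_mem_support
        exact hs _ (by rw [h'])
      refine ⟨Walk.cons hadj q, ?_⟩
      intro n hn
      rw [Walk.support_cons, List.mem_cons] at hn ⊢
      rcases hn with rfl | hn
      · exact Or.inl hu.symm
      · exact Or.inr (hq n hn)

theorem Route.of_splitGraph {a : α} {𝒞 𝒩 : Set α} {u l : α} {P : Set (Option α)}
    (h : Route (splitGraph Γ a 𝒞 𝒩) (some u) (some l) P) (h₁ : none ∉ P) (h₂ : some a ∉ P) :
    ∃ Q, Route Γ u l Q ∧ (∀ n ∈ Q, some n ∈ P) ∧ a ∉ Q := by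
  obtain ⟨p, -, rfl⟩ := h
  obtain ⟨q, hq⟩ := exists_walk_of_splitGraph p h₁ h₂ u l rfl rfl
  obtain ⟨Q, hQ, hr⟩ := exists_route_of_walk q
  exact ⟨Q, hr, fun n hn => hq n (hQ hn), fun ha => h₂ (hq a (hQ ha))⟩

theorem ReachAvoid.splitGraph {a : α} {𝒞 𝒩 : Set α} {A S : Set (Option α)} {T : Set α}
    {v n : α} (hT : ∀ m, m ∉ T → m ≠ a ∧ some m ∉ S)
    (h : ReachAvoid Γ {v} T n) (hv : ReachAvoid (splitGraph Γ a 𝒞 𝒩) A S (some v)) :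
    ReachAvoid (splitGraph Γ a 𝒞 𝒩) A S (some n) := by
  induction h with
  | base ha _ => rw [ha]; exact hv
  | step hr hadj hw ih =>
    exact ih.step (splitGraph_adj_some (hT _ hr.notMem).1 (hT _ hw).1 hadj) (hT _ hw).2

end Routes

section Fans

variable {V : Type*} {G : SimpleGraph V} {X : Set V} {H : Net V}

/-- Three disjoint paths of `ℍ` from given nodes to the three leaf nodes. -/
def Fan (H : Net V) (c₁ c₂ c₃ : H.nodes) (P₁ P₂ P₃ : Set H.nodes) : Prop :=
  ∃ l₁ l₂ l₃ : H.nodes, H.IsLeafNode l₁ ∧ H.IsLeafNode l₂ ∧ H.IsLeafNode l₃ ∧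
    Route H.graph c₁ l₁ P₁ ∧ Route H.graph c₂ l₂ P₂ ∧ Route H.graph c₃ l₃ P₃ ∧
    Disjoint P₁ P₂ ∧ Disjoint P₁ P₃ ∧ Disjoint P₂ P₃

variable {c₁ c₂ c₃ : H.nodes} {P₁ P₂ P₃ : Set H.nodes}

theorem Fan.swap₁₂ (h : Fan H c₁ c₂ c₃ P₁ P₂ P₃) : Fan H c₂ c₁ c₃ P₂ P₁ P₃ := by
  obtain ⟨l₁, l₂, l₃, h1, h2, h3, r1, r2, r3, d12, d13, d23⟩ := h
  exact ⟨l₂, l₁, l₃, h2, h1, h3, r2, r1, r3, d12.symm, d23, d13⟩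

theorem Fan.swap₂₃ (h : Fan H c₁ c₂ c₃ P₁ P₂ P₃) : Fan H c₁ c₃ c₂ P₁ P₃ P₂ := by
  obtain ⟨l₁, l₂, l₃, h1, h2, h3, r1, r2, r3, d12, d13, d23⟩ := h
  exact ⟨l₁, l₃, l₂, h1, h3, h2, r1, r3, r2, d13, d12, d23.symm⟩

theorem Fan.mem₁ (h : Fan H c₁ c₂ c₃ P₁ P₂ P₃) : c₁ ∈ P₁ := by
  obtain ⟨l₁, l₂, l₃, h1, h2, h3, r1, -⟩ := h
  exact r1.start_mem

theorem Fan.mem₂ (h : Fan H c₁ c₂ c₃ P₁ P₂ P₃) : c₂ ∈ P₂ := h.swap₁₂.mem₁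

theorem Fan.mem₃ (h : Fan H c₁ c₂ c₃ P₁ P₂ P₃) : c₃ ∈ P₃ := h.swap₂₃.mem₂

theorem Fan.notMem₁₂ (h : Fan H c₁ c₂ c₃ P₁ P₂ P₃) {n : H.nodes} (hn : n ∈ P₁) : n ∉ P₂ := by
  obtain ⟨l₁, l₂, l₃, h1, h2, h3, r1, r2, r3, d12, d13, d23⟩ := h
  exact Set.disjoint_left.1 d12 hn

theorem Fan.notMem₁₃ (h : Fan H c₁ c₂ c₃ P₁ P₂ P₃) {n : H.nodes} (hn : n ∈ P₁) : n ∉ P₃ :=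
  h.swap₂₃.notMem₁₂ hn

theorem Fan.notMem₂₃ (h : Fan H c₁ c₂ c₃ P₁ P₂ P₃) {n : H.nodes} (hn : n ∈ P₂) : n ∉ P₃ :=
  h.swap₁₂.notMem₁₃ hn

theorem Fan.suffix₁ (h : Fan H c₁ c₂ c₃ P₁ P₂ P₃) {D : H.nodes} (hD : D ∈ P₁) :
    ∃ P ⊆ P₁, Fan H D c₂ c₃ P P₂ P₃ ∧ (D ≠ c₁ → c₁ ∉ P) := by
  obtain ⟨l₁, l₂, l₃, h1, h2, h3, r1, r2, r3, d12, d13, d23⟩ := h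
  obtain ⟨P, hP, hr, hne⟩ := r1.suffix hD
  exact ⟨P, hP, ⟨l₁, l₂, l₃, h1, h2, h3, hr, r2, r3, d12.mono_left hP, d13.mono_left hP, d23⟩, hne⟩

theorem Fan.suffix₂ (h : Fan H c₁ c₂ c₃ P₁ P₂ P₃) {D : H.nodes} (hD : D ∈ P₂) :
    ∃ P ⊆ P₂, Fan H c₁ D c₃ P₁ P P₃ ∧ (D ≠ c₂ → c₂ ∉ P) := by
  obtain ⟨P, hP, hf, hne⟩ := h.swap₁₂.suffix₁ hD
  exact ⟨P, hP, hf.swap₁₂, hne⟩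

theorem Fan.suffix₃ (h : Fan H c₁ c₂ c₃ P₁ P₂ P₃) {D : H.nodes} (hD : D ∈ P₃) :
    ∃ P ⊆ P₃, Fan H c₁ c₂ D P₁ P₂ P ∧ (D ≠ c₃ → c₃ ∉ P) := by
  obtain ⟨P, hP, hf, hne⟩ := h.swap₂₃.suffix₂ hD
  exact ⟨P, hP, hf.swap₂₃, hne⟩

theorem Fan.step₁ (h : Fan H c₁ c₂ c₃ P₁ P₂ P₃) (hc : ¬ H.IsLeafNode c₁) :
    ∃ A ∈ P₁, H.graph.Adj c₁ A ∧ ∃ P ⊆ P₁, Fan H A c₂ c₃ P P₂ P₃ ∧ c₁ ∉ P := by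
  obtain ⟨l₁, l₂, l₃, h1, h2, h3, r1, r2, r3, d12, d13, d23⟩ := h
  obtain ⟨A, hA, hadj, P, hP, hr, hne⟩ := r1.step (by rintro rfl; exact hc h1)
  exact ⟨A, hA, hadj, P, hP,
    ⟨l₁, l₂, l₃, h1, h2, h3, hr, r2, r3, d12.mono_left hP, d13.mono_left hP, d23⟩, hne⟩

theorem Fan.step₃ (h : Fan H c₁ c₂ c₃ P₁ P₂ P₃) (hc : ¬ H.IsLeafNode c₃) :
    ∃ A ∈ P₃, H.graph.Adj c₃ A ∧ ∃ P ⊆ P₃, Fan H c₁ c₂ A P₁ P₂ P ∧ c₃ ∉ P := by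
  obtain ⟨A, hA, hadj, P, hP, hf, hne⟩ := h.swap₂₃.swap₁₂.step₁ hc
  exact ⟨A, hA, hadj, P, hP, hf.swap₁₂.swap₂₃, hne⟩

variable [Finite V]

theorem SelfAiding.exists_fan (hnet : IsNet G X H) (hself : SelfAiding H)
    (h₁₂ : c₁ ≠ c₂) (h₁₃ : c₁ ≠ c₃) (h₂₃ : c₂ ≠ c₃) : ∃ P₁ P₂ P₃, Fan H c₁ c₂ c₃ P₁ P₂ P₃ := by
  obtain ⟨l₁, hl₁, l₂, hl₂, l₃, hl₃, P₁, P₂, P₃, h⟩ := exists_three_routes (Γ := H.graph)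
    h₁₂ h₁₃ h₂₃ (B := {n | H.IsLeafNode n}) (by
      intro S hS
      obtain ⟨v, hv, hvS⟩ : ∃ v ∈ ({c₁, c₂, c₃} : Set H.nodes), v ∉ S := by
        by_contra hcon
        push Not at hcon
        have := Set.ncard_le_ncard (s := ({c₁, c₂, c₃} : Set H.nodes)) (t := S) hcon
        rw [Set.ncard_eq_three.2 ⟨c₁, c₂, c₃, h₁₂, h₁₃, h₂₃, rfl⟩] at this
        omega
      obtain ⟨l, hl, hr⟩ := hself.exists_leaf_reachAvoid hnet (S := S) (by omega) hvS
      obtain ⟨a, rfl, p, hp⟩ := hr.exists_walk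
      exact ⟨l, hl, ReachAvoid.append (.base hv hvS) p hp⟩)
  exact ⟨P₁, P₂, P₃, l₁, l₂, l₃, hl₁, hl₂, hl₃, h⟩

/-- Three disjoint paths to the leaf nodes avoiding `a`, two of which start at neighbours of `a`
in prescribed classes, and the third at `b`. -/
theorem SelfAiding.exists_mixed_fan (hnet : IsNet G X H) (hself : SelfAiding H) {a b : H.nodes}
    (ha : ¬ H.IsLeafNode a) (hab : a ≠ b) {𝒞 𝒩 : Set H.nodes}
    (h𝒞 : ∀ A ∈ 𝒞, A ≠ a ∧ A ≠ b) (h𝒩 : ∀ A ∈ 𝒩, A ≠ a ∧ A ≠ b)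
    (h𝒞ne : 𝒞.Nonempty) (h𝒩ne : 𝒩.Nonempty)
    (hcov : ∀ A, H.graph.Adj a A → A ≠ b → A ∈ 𝒞 ∨ A ∈ 𝒩) :
    ∃ A ∈ 𝒞, ∃ B ∈ 𝒩, ∃ P₁ P₂ P₃, Fan H A B b P₁ P₂ P₃ ∧ a ∉ P₁ ∧ a ∉ P₂ ∧ a ∉ P₃ := by
  have hsep : ∀ S : Set (Option H.nodes), S.ncard < 3 →
      ∃ l ∈ some '' {n : H.nodes | H.IsLeafNode n},
        ReachAvoid (splitGraph H.graph a 𝒞 𝒩) {some a, none, some b} S l := by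
    intro S hS
    have hcard : ∀ T : Set H.nodes, (∀ n ∈ T, some n ∈ S) → T.ncard ≤ S.ncard := by
      intro T hT
      rw [← Set.ncard_image_of_injective T (Option.some_injective _)]
      refine Set.ncard_le_ncard ?_
      rintro _ ⟨n, hn, rfl⟩
      exact hT n hn
    by_cases hS' : some a ∈ S ∨ none ∈ S
    · have hins : (insert a {n | some n ∈ S}).ncard ≤ 2 := by
        rcases hS' with h | h
        · rw [Set.insert_eq_of_mem (show a ∈ {n | some n ∈ S} from h)]
          exact (hcard _ fun n hn => hn).trans (by omega)
        · refine (Set.ncard_insert_le _ _).trans ?_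
          have h1 : (some '' {n : H.nodes | some n ∈ S}).ncard < S.ncard := by
            refine Set.ncard_lt_ncard ⟨?_, fun hsub => ?_⟩
            · rintro _ ⟨n, hn, rfl⟩; exact hn
            · obtain ⟨n, -, hn⟩ := hsub h
              simp at hn
          rw [Set.ncard_image_of_injective _ (Option.some_injective _)] at h1
          omega
      by_cases hb : some b ∈ S
      · have key : ∀ (o : Option H.nodes) (B : H.nodes), o ∈ ({some a, none} : Set _) → o ∉ S →
            B ≠ a → B ≠ b → (splitGraph H.graph a 𝒞 𝒩).Adj o (some B) →
            ∃ l ∈ some '' {n : H.nodes | H.IsLeafNode n},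
              ReachAvoid (splitGraph H.graph a 𝒞 𝒩) {some a, none, some b} S l := by
          intro o B ho hoS hBa hBb hadj
          have hsub : ∀ n : H.nodes, some n ∈ S → n = a ∨ n = b := by
            intro n hn
            by_contra hcon
            push Not at hcon
            have h1 : insert a {n | some n ∈ S} = {a, b, n} := by
              symm
              apply Set.eq_of_subset_of_ncard_le
              · rintro m (rfl | rfl | rfl)
                · exact Or.inl rfl
                · exact Or.inr hb
                · exact Or.inr hn
              · rw [Set.ncard_eq_three.2 ⟨a, b, n, hab, hcon.1.symm, hcon.2.symm, rfl⟩]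
                omega
              · exact Set.toFinite _
            rw [h1, Set.ncard_eq_three.2 ⟨a, b, n, hab, hcon.1.symm, hcon.2.symm, rfl⟩] at hins
            omega
          have hBS : some B ∉ S := fun h => by
            rcases hsub B h with h | h
            · exact hBa h
            · exact hBb h
          obtain ⟨l, hl, hr⟩ := hself.exists_leaf_reachAvoid hnet hins (v := B)
            (by rintro (h | h)
                · exact hBa h
                · exact hBS h)
          refine ⟨some l, ⟨l, hl, rfl⟩, hr.splitGraph ?_ (.step (.base ?_ hoS) hadj hBS)⟩
          · intro m hm
            exact ⟨fun h => hm (Or.inl h), fun h => hm (Or.inr h)⟩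
          · rcases ho with rfl | rfl
            · simp
            · simp
        obtain ⟨A, hA⟩ := h𝒞ne
        obtain ⟨B, hB⟩ := h𝒩ne
        by_cases h1 : some a ∈ S
        · refine key none B (by simp) (fun h2 => ?_) (h𝒩 B hB).1 (h𝒩 B hB).2
            (splitGraph_adj_none hB)
          have : ({some a, none, some b} : Set (Option H.nodes)).ncard ≤ S.ncard := by
            refine Set.ncard_le_ncard ?_
            rintro o (rfl | rfl | rfl) <;> assumption
          rw [Set.ncard_eq_three.2 ⟨some a, none, some b, by simp,
            fun h => hab (Option.some_injective _ h), by simp, rfl⟩] at this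
          omega
        · exact key (some a) A (by simp) h1 (h𝒞 A hA).1 (h𝒞 A hA).2
            (splitGraph_adj_mem (h𝒞 A hA).1 hA)
      · obtain ⟨l, hl, hr⟩ := hself.exists_leaf_reachAvoid hnet hins (v := b)
          (by rintro (h | h)
              · exact hab h.symm
              · exact hb h)
        refine ⟨some l, ⟨l, hl, rfl⟩, hr.splitGraph ?_ (.base (by simp) hb)⟩
        intro m hm
        exact ⟨fun h => hm (Or.inl h), fun h => hm (Or.inr h)⟩
    · push Not at hS'
      obtain ⟨l, hl, hr⟩ := hself.exists_leaf_reachAvoid hnet (S := {n | some n ∈ S})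
        ((hcard _ fun n hn => hn).trans (by omega)) (v := a) hS'.1
      obtain ⟨a', rfl, p, hp⟩ := hr.exists_walk
      obtain ⟨P, hP, hroute⟩ := exists_route_of_walk p
      obtain ⟨A, hA, hadj, P', hP', ⟨q, hq, rfl⟩, haP⟩ := hroute.step (by rintro rfl; exact ha hl)
      have hAS : some A ∉ S := fun h => hp A (hP hA) h
      have hr' : ReachAvoid H.graph {A} (insert a' {n | some n ∈ S}) l := by
        have hq' : ∀ x ∈ q.support, x ∉ insert a' {n : H.nodes | some n ∈ S} := by
          rintro x hx (rfl | h)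
          · exact haP hx
          · exact hp x (hP (hP' hx)) h
        exact ReachAvoid.append (.base rfl (hq' _ q.start_mem_support)) q hq'
      refine ⟨some l, ⟨l, hl, rfl⟩, hr'.splitGraph ?_ ?_⟩
      · intro m hm
        exact ⟨fun h => hm (Or.inl h), fun h => hm (Or.inr h)⟩
      · by_cases hAb : A = b
        · subst hAb
          exact .base (by simp) hAS
        · rcases hcov A hadj hAb with h | h
          · exact .step (.base (by simp) hS'.1) (splitGraph_adj_mem hadj.ne' h) hAS
          · exact .step (.base (by simp) hS'.2) (splitGraph_adj_none h) hAS
  obtain ⟨_, ⟨l₁, hl₁, rfl⟩, _, ⟨l₂, hl₂, rfl⟩, _, ⟨l₃, hl₃, rfl⟩, P₁, P₂, P₃, r₁, r₂, r₃, d₁₂, d₁₃,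
    d₂₃⟩ := exists_three_routes (Γ := splitGraph H.graph a 𝒞 𝒩) (n₁ := some a) (n₂ := none)
      (n₃ := some b) (by simp) (fun h => hab (Option.some_injective _ h)) (by simp) hsep
  have ha₂ : some a ∉ P₂ := Set.disjoint_left.1 d₁₂ r₁.start_mem
  have ha₃ : some a ∉ P₃ := Set.disjoint_left.1 d₁₃ r₁.start_mem
  have hn₁ : none ∉ P₁ := Set.disjoint_right.1 d₁₂ r₂.start_mem
  have hn₃ : none ∉ P₃ := Set.disjoint_left.1 d₂₃ r₂.start_mem
  obtain ⟨x, hx, hadj₁, Q₁, hQ₁, s₁, haQ₁⟩ := r₁.step (by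
    intro h
    rw [Option.some_injective _ h] at ha
    exact ha hl₁)
  obtain ⟨A, hA, rfl⟩ := mem_of_splitGraph_some hadj₁ (by rintro rfl; exact hn₁ hx)
  obtain ⟨y, hy, hadj₂, Q₂, hQ₂, s₂, hnQ₂⟩ := r₂.step (by simp)
  obtain ⟨B, hB, rfl⟩ := mem_of_splitGraph_none hadj₂
  obtain ⟨R₁, t₁, hR₁, ha₁'⟩ := s₁.of_splitGraph (fun h => hn₁ (hQ₁ h)) haQ₁
  obtain ⟨R₂, t₂, hR₂, ha₂'⟩ := s₂.of_splitGraph hnQ₂ (fun h => ha₂ (hQ₂ h))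
  obtain ⟨R₃, t₃, hR₃, ha₃'⟩ := r₃.of_splitGraph hn₃ ha₃
  refine ⟨A, hA, B, hB, R₁, R₂, R₃, ⟨l₁, l₂, l₃, hl₁, hl₂, hl₃, t₁, t₂, t₃, ?_, ?_, ?_⟩,
    ha₁', ha₂', ha₃'⟩
  · rw [Set.disjoint_left]
    exact fun n h1 h2 => Set.disjoint_left.1 d₁₂ (hQ₁ (hR₁ n h1)) (hQ₂ (hR₂ n h2))
  · rw [Set.disjoint_left]
    exact fun n h1 h2 => Set.disjoint_left.1 d₁₃ (hQ₁ (hR₁ n h1)) (hR₃ n h2)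
  · rw [Set.disjoint_left]
    exact fun n h1 h2 => Set.disjoint_left.1 d₂₃ (hQ₂ (hR₂ n h1)) (hR₃ n h2)

end Fans

end ThreeInATree

namespace ThreeInATree

open SimpleGraph

section Wildness

variable {V : Type*} {G : SimpleGraph V} {X : Set V} {H : Net V} {Y : Set V}

theorem isPathSet_of_injective {n : ℕ} {P : Set V} (f : Fin (n + 1) → V)
    (hf : Function.Injective f) (hr : Set.range f = P)
    (hadj : ∀ i j, G.Adj (f i) (f j) ↔ i.val + 1 = j.val ∨ j.val + 1 = i.val) :
    IsPathSet G P := by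
  subst hr
  refine ⟨n, ⟨⟨Equiv.ofInjective f hf, ?_⟩⟩⟩
  intro i j
  rw [pathGraph_adj]
  exact hadj i j

theorem IsPathSet.ends {P : Set V} (h : IsPathSet G P) : (∃ y, P = {y}) ∨
    ∃ y₀ y₁, y₀ ≠ y₁ ∧ IsEndOf G P y₀ ∧ IsEndOf G P y₁ ∧ IsPathSet G (P \ {y₀}) ∧
      IsPathSet G (P \ {y₁}) := by
  obtain ⟨n, ⟨e⟩⟩ := h
  have hinj : Function.Injective fun i => (e i : V) :=
    Subtype.val_injective.comp e.injective
  have hadj : ∀ i j, G.Adj (e i : V) (e j) ↔ i.val + 1 = j.val ∨ j.val + 1 = i.val := by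
    intro i j
    rw [← pathGraph_adj, ← e.map_adj_iff]
    rfl
  have hsurj : ∀ x ∈ P, ∃ i, (e i : V) = x := fun x hx => by
    obtain ⟨i, hi⟩ := e.surjective ⟨x, hx⟩
    exact ⟨i, congrArg Subtype.val hi⟩
  rcases n with _ | m
  · left
    refine ⟨e 0, ?_⟩
    ext x
    constructor
    · intro hx
      obtain ⟨i, rfl⟩ := hsurj x hx
      obtain rfl : i = 0 := Fin.ext (by omega)
      rfl
    · rintro rfl; exact (e 0).2
  · right
    refine ⟨e 0, e (Fin.last _), ?_, ⟨(e 0).2, ?_⟩, ⟨(e _).2, ?_⟩, ?_, ?_⟩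
    · intro h
      have := congrArg Fin.val (hinj h)
      simp at this
    · intro a ha b hb h1 h2
      obtain ⟨i, rfl⟩ := hsurj a ha
      obtain ⟨j, rfl⟩ := hsurj b hb
      rw [hadj] at h1 h2
      simp only [Fin.val_zero] at h1 h2
      rw [Fin.ext (show i.val = j.val by omega)]
    · intro a ha b hb h1 h2
      obtain ⟨i, rfl⟩ := hsurj a ha
      obtain ⟨j, rfl⟩ := hsurj b hb
      rw [hadj] at h1 h2
      simp only [Fin.val_last] at h1 h2
      rw [Fin.ext (show i.val = j.val by omega)]
    · refine isPathSet_of_injective (n := m) (fun i => (e i.succ : V))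
        (fun i j hij => Fin.succ_injective _ (hinj hij)) ?_ ?_
      · ext x
        constructor
        · rintro ⟨i, rfl⟩
          exact ⟨(e _).2, fun h => Fin.succ_ne_zero i (hinj h)⟩
        · rintro ⟨hx, hne⟩
          obtain ⟨i, rfl⟩ := hsurj x hx
          obtain ⟨j, rfl⟩ := Fin.exists_succ_eq.2 (fun h : i = 0 => hne (by rw [h]; rfl))
          exact ⟨j, rfl⟩
      · intro i j
        rw [hadj]
        simp only [Fin.val_succ]
        omega
    · refine isPathSet_of_injective (n := m) (fun i => (e i.castSucc : V))
        (fun i j hij => Fin.castSucc_injective _ (hinj hij)) ?_ ?_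
      · ext x
        constructor
        · rintro ⟨i, rfl⟩
          exact ⟨(e _).2, fun h => (Fin.castSucc_lt_last i).ne (hinj h)⟩
        · rintro ⟨hx, hne⟩
          obtain ⟨i, rfl⟩ := hsurj x hx
          obtain ⟨j, rfl⟩ := Fin.exists_castSucc_eq.2
            (fun h : i = Fin.last _ => hne (by rw [h]; rfl))
          exact ⟨j, rfl⟩
      · intro i j
        rw [hadj]
        simp only [Fin.val_castSucc]

/-- Two vertices that lie in no common arc and no common node. -/
def Untamed (H : Net V) (u v : V) : Prop :=
  ¬ ((∃ E ∈ H.arcs, u ∈ E ∧ v ∈ E) ∨ (∃ N ∈ H.nodes, u ∈ N ∧ v ∈ N))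

theorem Untamed.symm {u v : V} (h : Untamed H u v) : Untamed H v u := by
  rintro (⟨E, hE, h1, h2⟩ | ⟨N, hN, h1, h2⟩)
  · exact h (Or.inl ⟨E, hE, h2, h1⟩)
  · exact h (Or.inr ⟨N, hN, h2, h1⟩)

theorem Untamed.notMem_arc {u v : V} (h : Untamed H u v) {E : Set V} (hE : E ∈ H.arcs)
    (hu : u ∈ E) : v ∉ E := fun hv => h (Or.inl ⟨E, hE, hu, hv⟩)

theorem Untamed.notMem_node {u v : V} (h : Untamed H u v) {N : H.nodes}
    (hu : u ∈ (N : Set V)) : v ∉ (N : Set V) := fun hv => h (Or.inr ⟨N, N.2, hu, hv⟩)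

theorem Wild.exists_untamed (hw : Wild G X H Y) :
    ∃ u ∈ nbrIn G X Y, ∃ v ∈ nbrIn G X Y, Untamed H u v := by
  have h := hw.2.2.1
  rw [Tamed] at h
  push Not at h
  obtain ⟨u, hu, v, hv, h1, h2⟩ := h
  refine ⟨u, hu, v, hv, ?_⟩
  rintro (⟨E, hE, h3, h4⟩ | ⟨N, hN, h3, h4⟩)
  · exact h1 E hE h3 h4
  · exact h2 N hN h3 h4

/-- The neighbours in a wild set of an untamed pair are two fixed end-vertices. -/
theorem Wild.exists_ends (hw : Wild G X H Y) : ∃ y₀ y₁, IsEndOf G Y y₀ ∧ IsEndOf G Y y₁ ∧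
    ∀ u ∈ nbrIn G X Y, ∀ v ∈ nbrIn G X Y, Untamed H u v →
      ((∀ y ∈ Y, G.Adj y u ↔ y = y₀) ∧ ∀ y ∈ Y, G.Adj y v ↔ y = y₁) ∨
      ((∀ y ∈ Y, G.Adj y u ↔ y = y₁) ∧ ∀ y ∈ Y, G.Adj y v ↔ y = y₀) := by
  obtain ⟨hd, hp, hu, hmin⟩ := hw
  rcases hp.ends with ⟨y, rfl⟩ | ⟨y₀, y₁, hne, he₀, he₁, hp₀, hp₁⟩
  · have hend : IsEndOf G ({y} : Set V) y :=
      ⟨rfl, fun a ha b hb _ _ => (ha : a = y).trans (hb : b = y).symm⟩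
    have key : ∀ u ∈ nbrIn G X ({y} : Set V), ∀ z ∈ ({y} : Set V), G.Adj z u ↔ z = y := by
      rintro u ⟨-, y', rfl, hy'⟩ z rfl
      exact ⟨fun _ => rfl, fun _ => hy'⟩
    exact ⟨y, y, hend, hend, fun u hu v hv _ => Or.inl ⟨key u hu, key v hv⟩⟩
  · refine ⟨y₀, y₁, he₀, he₁, ?_⟩
    have hss : ∀ y ∈ Y, Y \ {y} ⊂ Y := fun y hy =>
      ⟨Set.sdiff_subset, fun h => (h hy).2 rfl⟩
    have h0 := hmin _ (hss y₀ he₀.1) hp₀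
    have h1 := hmin _ (hss y₁ he₁.1) hp₁
    have only : ∀ y ∈ Y, ∀ u ∈ nbrIn G X Y, u ∉ nbrIn G X (Y \ {y}) →
        ∀ z ∈ Y, G.Adj z u ↔ z = y := by
      intro y hy u hu hnu z hz
      have key : ∀ z ∈ Y, G.Adj z u → z = y := by
        intro z hz hadj
        by_contra hzy
        exact hnu ⟨hu.1, z, ⟨hz, hzy⟩, hadj⟩
      refine ⟨key z hz, ?_⟩
      rintro rfl
      obtain ⟨-, y', hy', hadj⟩ := hu
      rwa [← key y' hy' hadj]
    intro u hu v hv huv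
    have notboth : ∀ y, Tamed H (nbrIn G X (Y \ {y})) →
        u ∉ nbrIn G X (Y \ {y}) ∨ v ∉ nbrIn G X (Y \ {y}) := by
      intro y ht
      by_contra hcon
      push Not at hcon
      exact huv (ht u hcon.1 v hcon.2)
    have hne' : ∀ w, ¬ ((∀ z ∈ Y, G.Adj z w ↔ z = y₀) ∧ ∀ z ∈ Y, G.Adj z w ↔ z = y₁) := by
      rintro w ⟨h2, h3⟩
      exact hne ((h3 y₀ he₀.1).1 ((h2 y₀ he₀.1).2 rfl))
    rcases notboth y₀ h0 with h2 | h2 <;> rcases notboth y₁ h1 with h3 | h3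
    · exact absurd ⟨only _ he₀.1 u hu h2, only _ he₁.1 u hu h3⟩ (hne' u)
    · exact Or.inl ⟨only _ he₀.1 u hu h2, only _ he₁.1 v hv h3⟩
    · exact Or.inr ⟨only _ he₁.1 u hu h3, only _ he₀.1 v hv h2⟩
    · exact absurd ⟨only _ he₀.1 v hv h2, only _ he₁.1 v hv h3⟩ (hne' v)

/-- A neighbour in an untamed pair is adjacent to no internal vertex of the path. -/
theorem Wild.nbrIn_internal (hw : Wild G X H Y)
    (h : ∀ u ∈ nbrIn G X Y, ∃ v ∈ nbrIn G X Y, Untamed H u v) :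
    ∀ y ∈ Y, ¬ IsEndOf G Y y → nbrIn G X {y} = ∅ := by
  intro y hy hend
  rw [Set.eq_empty_iff_forall_notMem]
  rintro u ⟨huX, y', rfl, hadj⟩
  have hu : u ∈ nbrIn G X Y := ⟨huX, y', hy, hadj⟩
  obtain ⟨v, hv, huv⟩ := h u hu
  obtain ⟨y₀, y₁, he₀, he₁, hall⟩ := hw.exists_ends
  rcases hall u hu v hv huv with ⟨h1, -⟩ | ⟨h1, -⟩
  · rw [(h1 y' hy).1 hadj] at hend; exact hend he₀
  · rw [(h1 y' hy).1 hadj] at hend; exact hend he₁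

/-- Two vertices untamed with the same third vertex have the same neighbours in a wild set. -/
theorem Wild.adj_iff_adj (hw : Wild G X H Y) {u u' v : V} (hu : u ∈ nbrIn G X Y)
    (hu' : u' ∈ nbrIn G X Y) (hv : v ∈ nbrIn G X Y) (h : Untamed H u v) (h' : Untamed H u' v)
    {y : V} (hy : y ∈ Y) : G.Adj y u ↔ G.Adj y u' := by
  obtain ⟨y₀, y₁, he₀, he₁, hall⟩ := hw.exists_ends
  rcases hall u hu v hv h with ⟨h1, h2⟩ | ⟨h1, h2⟩ <;>
    rcases hall u' hu' v hv h' with ⟨h3, h4⟩ | ⟨h3, h4⟩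
  · rw [h1 y hy, h3 y hy]
  · have : y₁ = y₀ := (h4 y₁ he₁.1).1 ((h2 y₁ he₁.1).2 rfl)
    rw [h1 y hy, h3 y hy, this]
  · have : y₁ = y₀ := (h2 y₁ he₁.1).1 ((h4 y₁ he₁.1).2 rfl)
    rw [h1 y hy, h3 y hy, this]
  · rw [h1 y hy, h3 y hy]

end Wildness

section Assembly

variable {V : Type*} {G : SimpleGraph V} {X : Set V} {H : Net V} {Y : Set V}

/-- The arc `E` has both end-nodes in `P`. -/
def Inside (H : Net V) (P : Set H.nodes) (E : Set V) : Prop :=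
  E ∈ H.arcs ∧ ∃ U ∈ P, ∃ W ∈ P, H.ends E = s((U : Set V), (W : Set V))

theorem Inside.mono {P P' : Set H.nodes} (hP : P' ⊆ P) {E : Set V} (h : Inside H P' E) :
    Inside H P E := by
  obtain ⟨hE, U, hU, W, hW, he⟩ := h
  exact ⟨hE, U, hP hU, W, hP hW, he⟩

theorem Inside.ends_mem {P : Set H.nodes} {E : Set V} (h : Inside H P E) {U W : H.nodes}
    (he : H.ends E = s((U : Set V), (W : Set V))) : U ∈ P ∧ W ∈ P := by
  obtain ⟨-, U', hU', W', hW', he'⟩ := h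
  rcases (ends_eq_iff he).1 he' with ⟨rfl, rfl⟩ | ⟨rfl, rfl⟩
  · exact ⟨hU', hW'⟩
  · exact ⟨hW', hU'⟩

theorem Inside.node_mem (hnet : IsNet G X H) {P : Set H.nodes} {E : Set V} (h : Inside H P E)
    {N : H.nodes} {x : V} (hxE : x ∈ E) (hxN : x ∈ (N : Set V)) : N ∈ P := by
  obtain ⟨hE, U, hU, W, hW, he⟩ := h
  rcases hnet.eq_or_eq_of_mem hE he hxE hxN with rfl | rfl
  · exact hU
  · exact hW

/-- Extending an induced tree along a path of `ℍ` to a leaf node. -/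
theorem exists_extension (hnet : IsNet G X H) {l : H.nodes} {c : H.nodes}
    (p : H.graph.Walk c l) : p.IsPath → H.IsLeafNode l → ∀ K : Set V, K ⊆ X ∪ Y →
    (G.induce K).IsTree → (∃! x, x ∈ K ∩ (c : Set V)) →
    (∀ N ∈ p.support, N ≠ c → Disjoint K (N : Set V)) →
    (∀ E, Inside H {n | n ∈ p.support} E → Disjoint K E ∧ Disjoint (nbrIn G X Y) E) →
    ∃ Z, (∀ x ∈ Z, ∃ E, Inside H {n | n ∈ p.support} E ∧ x ∈ E) ∧ (G.induce (K ∪ Z)).IsTree ∧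
      (l : Set V) ⊆ K ∪ Z := by
  induction p with
  | @nil c =>
    intro _ hl K hK ht hc _ _
    refine ⟨∅, by simp, by rwa [Set.union_empty], ?_⟩
    obtain ⟨v, -, hv⟩ := hnet.leaf_single c hl
    obtain ⟨x, ⟨hxK, hxc⟩, -⟩ := hc
    rw [hv] at hxc ⊢
    rw [Set.mem_singleton_iff] at hxc
    subst hxc
    rw [Set.union_empty, Set.singleton_subset_iff]
    exact hxK
  | @cons c d l hcd p ih =>
    intro hp hl K hK ht hc hmiss harc
    rw [Walk.cons_isPath_iff] at hp
    obtain ⟨-, E, hE, hends⟩ := Net.graph_adj.1 hcd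
    have hin : Inside H {n | n ∈ (Walk.cons hcd p).support} E :=
      ⟨hE, c, by simp, d, by simp, hends⟩
    have hsupp : {n | n ∈ p.support} ⊆ {n | n ∈ (Walk.cons hcd p).support} := by
      intro n hn
      simp only [Walk.support_cons, List.mem_cons, Set.mem_ofPred_eq]
      exact Or.inr hn
    obtain ⟨x₀, hx₀⟩ := hnet.arc_nonempty E hE
    obtain ⟨R, -, hRE, hR⟩ := hnet.exists_rung hE hends hx₀
    obtain ⟨htR, hRc, hRd⟩ := hR.tree
    obtain ⟨hKE, hME⟩ := harc E hin
    obtain ⟨z, ⟨hzK, hzc⟩, hzu⟩ := hc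
    obtain ⟨r, ⟨hrR, hrc⟩, hru⟩ := hRc
    have harcK : ∀ k ∈ K, k ∈ X → ∃ F ∈ H.arcs, k ∈ F ∧ E ≠ F := by
      intro k hk hkX
      obtain ⟨F, hF, hkF⟩ := hnet.exists_arc_of_mem hkX
      exact ⟨F, hF, hkF, by rintro rfl; exact Set.disjoint_left.1 hKE hk hkF⟩
    have htree : (G.induce (K ∪ R)).IsTree := by
      refine isTree_union ht htR (hKE.mono_right hRE) hzK hrR ?_ ?_
      · obtain ⟨F, hF, hzF, hne⟩ := harcK z hzK (hnet.nodes_sub c c.2 hzc)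
        exact (hnet.adj_of_mem hE hF hne (hRE hrR) hzF hrc hzc).symm
      · intro k hk s hs hadj
        rcases hK hk with hkX | hkY
        · obtain ⟨F, hF, hkF, hne⟩ := harcK k hk hkX
          obtain ⟨N, hsN, hkN⟩ := hnet.exists_node_of_adj hE hF hne (hRE hs) hkF hadj.symm
          rcases hnet.eq_or_eq_of_mem hE hends (hRE hs) hsN with rfl | rfl
          · exact ⟨hzu k ⟨hk, hkN⟩, hru s ⟨hs, hsN⟩⟩
          · exact absurd hkN (Set.disjoint_left.1 (hmiss N (by simp) hcd.ne') hk)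
        · exact absurd (hRE hs) (Set.disjoint_left.1 hME
            ⟨hnet.arc_subset hE (hRE hs), k, hkY, hadj⟩)
    obtain ⟨Z, hZ, htZ, hlZ⟩ := ih hp.1 hl (K ∪ R)
      (Set.union_subset hK ((hRE.trans (hnet.arc_subset hE)).trans Set.subset_union_left)) htree
      (by
        obtain ⟨s, ⟨hsR, hsd⟩, hsu⟩ := hRd
        refine ⟨s, ⟨Or.inr hsR, hsd⟩, ?_⟩
        rintro x ⟨hx | hx, hxd⟩
        · exact absurd hxd (Set.disjoint_left.1 (hmiss d (by simp) hcd.ne') hx)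
        · exact hsu x ⟨hx, hxd⟩)
      (by
        intro N hN hNd
        have hNc : N ≠ c := by rintro rfl; exact hp.2 hN
        rw [Set.disjoint_union_left]
        refine ⟨hmiss N (by simp [hN]) hNc, ?_⟩
        rw [Set.disjoint_left]
        intro x hx hxN
        rcases hnet.eq_or_eq_of_mem hE hends (hRE hx) hxN with h | h
        · exact hNc h
        · exact hNd h)
      (by
        intro F hF
        obtain ⟨h1, h2⟩ := harc F (hF.mono hsupp)
        refine ⟨?_, h2⟩
        rw [Set.disjoint_union_left]
        refine ⟨h1, ?_⟩
        have hEF : E ≠ F := by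
          rintro rfl
          exact hp.2 (hF.ends_mem hends).1
        exact (hnet.arcs_disjoint E hE F hF.1 hEF).mono_left hRE)
    refine ⟨R ∪ Z, ?_, by rwa [← Set.union_assoc], by rwa [← Set.union_assoc]⟩
    rintro x (hx | hx)
    · exact ⟨E, hin, hRE hx⟩
    · obtain ⟨F, hF, hxF⟩ := hZ x hx
      refine ⟨F, hF.mono hsupp, hxF⟩

/-- `K` meets the nodes of `T` in exactly one vertex, and no node outside `I ∪ T`; it lies in the
union of the arcs in `𝓕`. -/
structure Touch (H : Net V) (K : Set V) (I T : Set H.nodes) (𝓕 : Set (Set V)) : Prop where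
  arcs : 𝓕 ⊆ H.arcs
  sub : ∀ x ∈ K, ∃ E ∈ 𝓕, x ∈ E
  touch : ∀ N ∈ T, ∃! x, x ∈ K ∩ (N : Set V)
  miss : ∀ N : H.nodes, N ∉ I → N ∉ T → Disjoint K (N : Set V)

theorem Touch.subset (hnet : IsNet G X H) {K : Set V} {I T : Set H.nodes} {𝓕 : Set (Set V)}
    (h : Touch H K I T 𝓕) : K ⊆ X := by
  intro x hx
  obtain ⟨E, hE, hxE⟩ := h.sub x hx
  exact hnet.arc_subset (h.arcs hE) hxE

theorem Touch.mono {K : Set V} {I T I' T' : Set H.nodes} {𝓕 : Set (Set V)}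
    (h : Touch H K I T 𝓕) (hT : T' ⊆ T) (hI : ∀ N, N ∈ I ∨ N ∈ T → N ∈ I' ∨ N ∈ T') :
    Touch H K I' T' 𝓕 where
  arcs := h.arcs
  sub := h.sub
  touch := fun N hN => h.touch N (hT hN)
  miss := fun N hI' hT' => h.miss N (fun h' => (hI N (Or.inl h')).elim hI' hT')
    (fun h' => (hI N (Or.inr h')).elim hI' hT')

theorem Touch.union {K₁ K₂ : Set V} {I₁ T₁ I₂ T₂ : Set H.nodes} {𝓕₁ 𝓕₂ : Set (Set V)}
    (h₁ : Touch H K₁ I₁ T₁ 𝓕₁) (h₂ : Touch H K₂ I₂ T₂ 𝓕₂)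
    (h₁₂ : ∀ N ∈ T₁, N ∉ I₂ ∧ N ∉ T₂) (h₂₁ : ∀ N ∈ T₂, N ∉ I₁) :
    Touch H (K₁ ∪ K₂) (I₁ ∪ I₂) (T₁ ∪ T₂) (𝓕₁ ∪ 𝓕₂) where
  arcs := Set.union_subset h₁.arcs h₂.arcs
  sub := by
    rintro x (hx | hx)
    · obtain ⟨E, hE, hxE⟩ := h₁.sub x hx
      exact ⟨E, Or.inl hE, hxE⟩
    · obtain ⟨E, hE, hxE⟩ := h₂.sub x hx
      exact ⟨E, Or.inr hE, hxE⟩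
  touch := by
    rintro N (hN | hN)
    · obtain ⟨x, ⟨hx, hxN⟩, hu⟩ := h₁.touch N hN
      refine ⟨x, ⟨Or.inl hx, hxN⟩, ?_⟩
      rintro y ⟨hy | hy, hyN⟩
      · exact hu y ⟨hy, hyN⟩
      · exact absurd hyN (Set.disjoint_left.1 (h₂.miss N (h₁₂ N hN).1 (h₁₂ N hN).2) hy)
    · obtain ⟨x, ⟨hx, hxN⟩, hu⟩ := h₂.touch N hN
      refine ⟨x, ⟨Or.inr hx, hxN⟩, ?_⟩
      rintro y ⟨hy | hy, hyN⟩
      · exact absurd hyN (Set.disjoint_left.1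
          (h₁.miss N (h₂₁ N hN) (fun h => (h₁₂ N h).2 hN)) hy)
      · exact hu y ⟨hy, hyN⟩
  miss := by
    intro N hI hT
    rw [Set.disjoint_union_left]
    exact ⟨h₁.miss N (fun h => hI (Or.inl h)) (fun h => hT (Or.inl h)),
      h₂.miss N (fun h => hI (Or.inr h)) (fun h => hT (Or.inr h))⟩

theorem touch_rung (hnet : IsNet G X H) {E R : Set V} (hE : E ∈ H.arcs) {U W : H.nodes}
    (hends : H.ends E = s((U : Set V), (W : Set V))) (hRE : R ⊆ E) (hR : IsRung G U W R) :
    Touch H R ∅ {U, W} {E} where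
  arcs := by rintro _ rfl; exact hE
  sub := fun x hx => ⟨E, rfl, hRE hx⟩
  touch := by
    rintro N (rfl | rfl)
    · exact hR.tree.2.1
    · exact hR.tree.2.2
  miss := by
    intro N _ hN
    rw [Set.disjoint_left]
    intro x hx hxN
    exact hN (hnet.eq_or_eq_of_mem hE hends (hRE hx) hxN)

theorem touch_subset_arc (hnet : IsNet G X H) {E K : Set V} (hE : E ∈ H.arcs) {U W : H.nodes}
    (hends : H.ends E = s((U : Set V), (W : Set V))) (hKE : K ⊆ E)
    (hW : ∃! x, x ∈ K ∩ (W : Set V)) : Touch H K {U} {W} {E} where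
  arcs := by rintro _ rfl; exact hE
  sub := fun x hx => ⟨E, rfl, hKE hx⟩
  touch := by rintro N rfl; exact hW
  miss := by
    intro N hNU hNW
    rw [Set.disjoint_left]
    intro x hx hxN
    rcases hnet.eq_or_eq_of_mem hE hends (hKE hx) hxN with h | h
    · exact hNU h
    · exact hNW h

theorem Touch.of_disjoint {K : Set V} {I T : Set H.nodes} {𝓕 : Set (Set V)} {U : H.nodes}
    (h : Touch H K I T 𝓕) (hU : Disjoint K (U : Set V)) : Touch H K (I \ {U}) T 𝓕 where
  arcs := h.arcs
  sub := h.sub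
  touch := h.touch
  miss := by
    intro N hI hT
    by_cases hN : N = U
    · rw [hN]; exact hU
    · exact h.miss N (fun h' => hI ⟨h', hN⟩) hT

theorem touch_singleton (hnet : IsNet G X H) {E : Set V} (hE : E ∈ H.arcs) {U W : H.nodes}
    (hends : H.ends E = s((U : Set V), (W : Set V))) {z : V} (hz : z ∈ E) :
    Touch H {z} {U, W} ∅ {E} where
  arcs := by rintro _ rfl; exact hE
  sub := by rintro x rfl; exact ⟨E, rfl, hz⟩
  touch := by rintro N ⟨⟩
  miss := by
    intro N hI _
    rw [Set.disjoint_singleton_left]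
    exact fun hzN => hI (hnet.eq_or_eq_of_mem hE hends hz hzN)

theorem Touch.apart (hnet : IsNet G X H) {K₁ K₂ : Set V} {I₁ T₁ I₂ T₂ : Set H.nodes}
    {𝓕₁ 𝓕₂ : Set (Set V)} (h₁ : Touch H K₁ I₁ T₁ 𝓕₁) (h₂ : Touch H K₂ I₂ T₂ 𝓕₂)
    (h𝓕 : ∀ E ∈ 𝓕₁, E ∉ 𝓕₂) (hN : ∀ N, N ∈ I₁ ∨ N ∈ T₁ → N ∉ I₂ ∧ N ∉ T₂) : Apart G K₁ K₂ := by
  constructor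
  · rw [Set.disjoint_left]
    intro x hx hx'
    obtain ⟨E, hE, hxE⟩ := h₁.sub x hx
    obtain ⟨F, hF, hxF⟩ := h₂.sub x hx'
    obtain rfl := hnet.eq_of_mem (h₁.arcs hE) (h₂.arcs hF) hxE hxF
    exact h𝓕 E hE hF
  · intro u hu v hv hadj
    obtain ⟨E, hE, huE⟩ := h₁.sub u hu
    obtain ⟨F, hF, hvF⟩ := h₂.sub v hv
    obtain ⟨N, huN, hvN⟩ := hnet.exists_node_of_adj (h₁.arcs hE) (h₂.arcs hF)
      (by rintro rfl; exact h𝓕 E hE hF) huE hvF hadj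
    by_cases h : N ∈ I₁ ∨ N ∈ T₁
    · exact Set.disjoint_left.1 (h₂.miss N (hN N h).1 (hN N h).2) hv hvN
    · push Not at h
      exact Set.disjoint_left.1 (h₁.miss N h.1 h.2) hu huN

/-- No path of the family `P₁, P₂, P₃` contains both end-nodes of the arc `E`. -/
def NotInside (H : Net V) (P₁ P₂ P₃ : Set H.nodes) (E : Set V) : Prop :=
  ¬ Inside H P₁ E ∧ ¬ Inside H P₂ E ∧ ¬ Inside H P₃ E

theorem notInside_of_notMem {P₁ P₂ P₃ : Set H.nodes} {E : Set V} {U W : H.nodes}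
    (hends : H.ends E = s((U : Set V), (W : Set V))) (h₁ : U ∉ P₁) (h₂ : U ∉ P₂) (h₃ : U ∉ P₃) :
    NotInside H P₁ P₂ P₃ E :=
  ⟨fun h => h₁ (h.ends_mem hends).1, fun h => h₂ (h.ends_mem hends).1,
    fun h => h₃ (h.ends_mem hends).1⟩

theorem Fan.notInside {c₁ c₂ c₃ : H.nodes} {P₁ P₂ P₃ : Set H.nodes}
    (h : Fan H c₁ c₂ c₃ P₁ P₂ P₃) {E : Set V} {U W : H.nodes}
    (hends : H.ends E = s((U : Set V), (W : Set V))) (hU : U ∈ P₁) (hW : W ∉ P₁) :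
    NotInside H P₁ P₂ P₃ E :=
  ⟨fun h' => hW (h'.ends_mem hends).2, fun h' => h.notMem₁₂ hU (h'.ends_mem hends).1,
    fun h' => h.notMem₁₃ hU (h'.ends_mem hends).1⟩

theorem NotInside.swap₁₂ {P₁ P₂ P₃ : Set H.nodes} {E : Set V} (h : NotInside H P₁ P₂ P₃ E) :
    NotInside H P₂ P₁ P₃ E := ⟨h.2.1, h.1, h.2.2⟩

theorem NotInside.swap₂₃ {P₁ P₂ P₃ : Set H.nodes} {E : Set V} (h : NotInside H P₁ P₂ P₃ E) :
    NotInside H P₁ P₃ P₂ E := ⟨h.1, h.2.2, h.2.1⟩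

theorem NotInside.mono {P₁ P₂ P₃ Q₁ Q₂ Q₃ : Set H.nodes} {E : Set V}
    (h : NotInside H P₁ P₂ P₃ E) (h₁ : Q₁ ⊆ P₁) (h₂ : Q₂ ⊆ P₂) (h₃ : Q₃ ⊆ P₃) :
    NotInside H Q₁ Q₂ Q₃ E :=
  ⟨fun h' => h.1 (h'.mono h₁), fun h' => h.2.1 (h'.mono h₂), fun h' => h.2.2 (h'.mono h₃)⟩

variable [Finite V]

/-- The common hypotheses: a self-aiding net, with the leaves of `G`, and a wild set. -/
structure Setting (G : SimpleGraph V) (X : Set V) (H : Net V) (Y : Set V) : Prop where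
  net : IsNet G X H
  self : SelfAiding H
  leaves : {v | IsLeaf G v}.ncard = 3
  wild : Wild G X H Y

/-- A core tree with three exits, extended along three disjoint paths of `ℍ` to the leaves. -/
theorem Setting.sapling_of_core (S : Setting G X H Y) {c₁ c₂ c₃ : H.nodes}
    {P₁ P₂ P₃ : Set H.nodes} (hfan : Fan H c₁ c₂ c₃ P₁ P₂ P₃) {K F : Set V} {I : Set H.nodes}
    {𝓕 : Set (Set V)} (hK : Touch H K I {c₁, c₂, c₃} 𝓕) (hF : F ⊆ Y)
    (ht : (G.induce (K ∪ F)).IsTree) (hI : ∀ N ∈ I, N ∉ P₁ ∧ N ∉ P₂ ∧ N ∉ P₃)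
    (h𝓕 : ∀ E ∈ 𝓕, NotInside H P₁ P₂ P₃ E)
    (hM : ∀ x ∈ nbrIn G X Y, ∀ E ∈ H.arcs, x ∈ E → NotInside H P₁ P₂ P₃ E) :
    ∃ T, T ⊆ X ∪ Y ∧ IsSapling G T := by
  have hYX := S.wild.1
  have hnet := S.net
  obtain ⟨l₁, l₂, l₃, hl₁, hl₂, hl₃, ⟨p₁, hp₁, rfl⟩, ⟨p₂, hp₂, rfl⟩, ⟨p₃, hp₃, rfl⟩, d₁₂, d₁₃, d₂₃⟩ :=
    hfan
  have hFN : ∀ N : H.nodes, Disjoint F (N : Set V) := fun N =>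
    (hYX.mono hF (hnet.nodes_sub N N.2))
  have hFE : ∀ E ∈ H.arcs, Disjoint F E := fun E hE => hYX.mono hF (hnet.arc_subset hE)
  have hmissK : ∀ N : H.nodes, N ∉ I → N ≠ c₁ → N ≠ c₂ → N ≠ c₃ →
      Disjoint (K ∪ F) (N : Set V) := by
    intro N h0 h1 h2 h3
    rw [Set.disjoint_union_left]
    refine ⟨hK.miss N h0 ?_, hFN N⟩
    rintro (h | h | h) <;> contradiction
  have hKE : ∀ E ∈ H.arcs, E ∉ 𝓕 → Disjoint (K ∪ F) E := by
    intro E hE hEF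
    rw [Set.disjoint_union_left]
    refine ⟨?_, hFE E hE⟩
    rw [Set.disjoint_left]
    intro x hx hxE
    obtain ⟨E', hE', hxE'⟩ := hK.sub x hx
    exact hEF (hnet.eq_of_mem hE (hK.arcs hE') hxE hxE' ▸ hE')
  have htouch : ∀ N ∈ ({c₁, c₂, c₃} : Set H.nodes), ∃! x, x ∈ (K ∪ F) ∩ (N : Set V) := by
    intro N hN
    obtain ⟨x, ⟨hx, hxN⟩, hu⟩ := hK.touch N hN
    refine ⟨x, ⟨Or.inl hx, hxN⟩, ?_⟩
    rintro y ⟨hy | hy, hyN⟩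
    · exact hu y ⟨hy, hyN⟩
    · exact absurd hyN (Set.disjoint_left.1 (hFN N) hy)
  have hME : ∀ E, (Inside H {n | n ∈ p₁.support} E ∨ Inside H {n | n ∈ p₂.support} E ∨
      Inside H {n | n ∈ p₃.support} E) → E ∈ H.arcs ∧ E ∉ 𝓕 ∧ Disjoint (nbrIn G X Y) E := by
    intro E hE
    have hni : ¬ NotInside H {n | n ∈ p₁.support} {n | n ∈ p₂.support} {n | n ∈ p₃.support} E := by
      rintro ⟨h1, h2, h3⟩
      rcases hE with h | h | h <;> contradiction
    have harc : E ∈ H.arcs := by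
      rcases hE with h | h | h <;> exact h.1
    refine ⟨harc, fun h => hni (h𝓕 E h), ?_⟩
    rw [Set.disjoint_left]
    exact fun x hx hxE => hni (hM x hx E harc hxE)
  have hdis : ∀ {P Q : Set H.nodes}, Disjoint P Q → ∀ n ∈ P, n ∉ Q :=
    fun h n hn => Set.disjoint_left.1 h hn
  obtain ⟨Z₁, hZ₁, ht₁, hlZ₁⟩ := exists_extension hnet p₁ hp₁ hl₁ (K ∪ F)
    (Set.union_subset ((hK.subset hnet).trans Set.subset_union_left)
      (hF.trans Set.subset_union_right)) ht (htouch c₁ (by simp))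
    (by
      intro N hN hNc
      refine hmissK N (fun h => (hI N h).1 hN) hNc ?_ ?_
      · rintro rfl; exact hdis d₁₂ _ hN p₂.start_mem_support
      · rintro rfl; exact hdis d₁₃ _ hN p₃.start_mem_support)
    (by
      intro E hE
      obtain ⟨h1, h2, h3⟩ := hME E (Or.inl hE)
      exact ⟨hKE E h1 h2, h3⟩)
  have hZN₁ : ∀ N : H.nodes, N ∉ p₁.support → Disjoint Z₁ (N : Set V) := by
    intro N hN
    rw [Set.disjoint_left]
    intro x hx hxN
    obtain ⟨E, hE, hxE⟩ := hZ₁ x hx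
    exact hN (hE.node_mem hnet hxE hxN)
  have hZX : ∀ {Z : Set V} {P : Set H.nodes}, (∀ x ∈ Z, ∃ E, Inside H P E ∧ x ∈ E) → Z ⊆ X := by
    intro Z P hZ x hx
    obtain ⟨E, hE, hxE⟩ := hZ x hx
    exact hnet.arc_subset hE.1 hxE
  have hZE : ∀ {Z : Set V} {P Q : Set H.nodes}, (∀ x ∈ Z, ∃ E, Inside H P E ∧ x ∈ E) →
      Disjoint P Q → ∀ E, Inside H Q E → Disjoint Z E := by
    intro Z P Q hZ hPQ E hE
    rw [Set.disjoint_left]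
    intro x hx hxE
    obtain ⟨E', hE', hxE'⟩ := hZ x hx
    obtain rfl := hnet.eq_of_mem hE.1 hE'.1 hxE hxE'
    obtain ⟨-, U, hU, W, hW, hends⟩ := hE
    exact hdis hPQ U (hE'.ends_mem hends).1 hU
  have hsub₁ : K ∪ F ∪ Z₁ ⊆ X ∪ Y := Set.union_subset
    (Set.union_subset ((hK.subset hnet).trans Set.subset_union_left)
      (hF.trans Set.subset_union_right)) ((hZX hZ₁).trans Set.subset_union_left)
  have huniq : ∀ {A Z N : Set V}, (∃! x, x ∈ A ∩ N) → Disjoint Z N → ∃! x, x ∈ (A ∪ Z) ∩ N := by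
    rintro A Z N ⟨x, ⟨hx, hxN⟩, hu⟩ hd
    refine ⟨x, ⟨Or.inl hx, hxN⟩, ?_⟩
    rintro y ⟨hy | hy, hyN⟩
    · exact hu y ⟨hy, hyN⟩
    · exact absurd hyN (Set.disjoint_left.1 hd hy)
  obtain ⟨Z₂, hZ₂, ht₂, hlZ₂⟩ := exists_extension hnet p₂ hp₂ hl₂ (K ∪ F ∪ Z₁) hsub₁ ht₁
    (huniq (htouch c₂ (by simp)) (hZN₁ c₂ (Set.disjoint_right.1 d₁₂ p₂.start_mem_support)))
    (by
      intro N hN hNc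
      rw [Set.disjoint_union_left]
      refine ⟨hmissK N (fun h => (hI N h).2.1 hN) ?_ hNc ?_,
        hZN₁ N (Set.disjoint_right.1 d₁₂ hN)⟩
      · rintro rfl; exact hdis d₁₂ _ p₁.start_mem_support hN
      · rintro rfl; exact hdis d₂₃ _ hN p₃.start_mem_support)
    (by
      intro E hE
      obtain ⟨h1, h2, h3⟩ := hME E (Or.inr (Or.inl hE))
      rw [Set.disjoint_union_left]
      exact ⟨⟨hKE E h1 h2, hZE hZ₁ d₁₂ E hE⟩, h3⟩)
  have hZN₂ : ∀ N : H.nodes, N ∉ p₂.support → Disjoint Z₂ (N : Set V) := by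
    intro N hN
    rw [Set.disjoint_left]
    intro x hx hxN
    obtain ⟨E, hE, hxE⟩ := hZ₂ x hx
    exact hN (hE.node_mem hnet hxE hxN)
  have hsub₂ : K ∪ F ∪ Z₁ ∪ Z₂ ⊆ X ∪ Y :=
    Set.union_subset hsub₁ ((hZX hZ₂).trans Set.subset_union_left)
  obtain ⟨Z₃, hZ₃, ht₃, hlZ₃⟩ := exists_extension hnet p₃ hp₃ hl₃ (K ∪ F ∪ Z₁ ∪ Z₂) hsub₂ ht₂
    (huniq (huniq (htouch c₃ (by simp))
      (hZN₁ c₃ (Set.disjoint_right.1 d₁₃ p₃.start_mem_support)))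
      (hZN₂ c₃ (Set.disjoint_right.1 d₂₃ p₃.start_mem_support)))
    (by
      intro N hN hNc
      rw [Set.disjoint_union_left, Set.disjoint_union_left]
      refine ⟨⟨hmissK N (fun h => (hI N h).2.2 hN) ?_ ?_ hNc,
        hZN₁ N (Set.disjoint_right.1 d₁₃ hN)⟩, hZN₂ N (Set.disjoint_right.1 d₂₃ hN)⟩
      · rintro rfl; exact hdis d₁₃ _ p₁.start_mem_support hN
      · rintro rfl; exact hdis d₂₃ _ p₂.start_mem_support hN)
    (by
      intro E hE
      obtain ⟨h1, h2, h3⟩ := hME E (Or.inr (Or.inr hE))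
      rw [Set.disjoint_union_left, Set.disjoint_union_left]
      exact ⟨⟨⟨hKE E h1 h2, hZE hZ₁ d₁₃ E hE⟩, hZE hZ₂ d₂₃ E hE⟩, h3⟩)
  refine ⟨_, Set.union_subset hsub₂ ((hZX hZ₃).trans Set.subset_union_left), ht₃, ?_⟩
  intro v hv
  have hleaf := hnet.isLeafNode_of_isLeaf S.leaves hv
  have hall : ({l₁, l₂, l₃} : Set H.nodes) = {n : H.nodes | H.IsLeafNode n} := by
    refine Set.eq_of_subset_of_ncard_le ?_ ?_ (Set.toFinite _)
    · rintro n (rfl | rfl | rfl) <;> assumption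
    · rw [hnet.ncard_leafNodes, Set.ncard_eq_three.2 ⟨l₁, l₂, l₃, ?_, ?_, ?_, rfl⟩]
      · rintro rfl; exact hdis d₁₂ _ p₁.end_mem_support p₂.end_mem_support
      · rintro rfl; exact hdis d₁₃ _ p₁.end_mem_support p₃.end_mem_support
      · rintro rfl; exact hdis d₂₃ _ p₂.end_mem_support p₃.end_mem_support
  have hmem : (⟨{v}, hleaf.1⟩ : H.nodes) ∈ ({l₁, l₂, l₃} : Set H.nodes) := by
    rw [hall]; exact hleaf
  rcases hmem with h | h | h
  · have : ({v} : Set V) = l₁ := congrArg Subtype.val h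
    exact Or.inl (Or.inl (hlZ₁ (this ▸ rfl)))
  · have : ({v} : Set V) = l₂ := congrArg Subtype.val h
    exact Or.inl (hlZ₂ (this ▸ rfl))
  · have : ({v} : Set V) = l₃ := congrArg Subtype.val h
    exact hlZ₃ (this ▸ rfl)

end Assembly

end ThreeInATree

namespace ThreeInATree

open SimpleGraph

section Pieces

variable {V : Type*} {G : SimpleGraph V} {X : Set V} {H : Net V} {Y : Set V}

theorem IsNet.ne_of_ends (hnet : IsNet G X H) {E : Set V} (hE : E ∈ H.arcs) {U W : H.nodes}
    (hends : H.ends E = s((U : Set V), (W : Set V))) : U ≠ W := by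
  rintro rfl
  apply hnet.loopless E hE
  rw [hends]
  rfl

/-- An arc with a vertex in a node off the paths has not both end-nodes on a path. -/
theorem IsNet.notInside_of_mem (hnet : IsNet G X H) {P₁ P₂ P₃ : Set H.nodes} {E : Set V}
    {x : V} (hxE : x ∈ E) {N : H.nodes} (hxN : x ∈ (N : Set V)) (h₁ : N ∉ P₁)
    (h₂ : N ∉ P₂) (h₃ : N ∉ P₃) : NotInside H P₁ P₂ P₃ E :=
  ⟨fun h => h₁ (h.node_mem hnet hxE hxN), fun h => h₂ (h.node_mem hnet hxE hxN),
    fun h => h₃ (h.node_mem hnet hxE hxN)⟩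

/-- Two trees in different arcs that have exactly one common node are joined by one edge. -/
theorem isTree_join (hnet : IsNet G X H) {K₁ K₂ : Set V} {I₁ T₁ I₂ T₂ : Set H.nodes}
    {𝓕₁ 𝓕₂ : Set (Set V)} (t₁ : (G.induce K₁).IsTree) (t₂ : (G.induce K₂).IsTree)
    (h₁ : Touch H K₁ I₁ T₁ 𝓕₁) (h₂ : Touch H K₂ I₂ T₂ 𝓕₂)
    (h𝓕 : ∀ E ∈ 𝓕₁, E ∉ 𝓕₂) {N : H.nodes} (hN₁ : ∃! x, x ∈ K₁ ∩ (N : Set V))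
    (hN₂ : ∃! x, x ∈ K₂ ∩ (N : Set V))
    (hN : ∀ N', N' ≠ N → N' ∈ I₁ ∨ N' ∈ T₁ → N' ∉ I₂ ∧ N' ∉ T₂) :
    (G.induce (K₁ ∪ K₂)).IsTree := by
  obtain ⟨x, ⟨hx, hxN⟩, hxu⟩ := hN₁
  obtain ⟨y, ⟨hy, hyN⟩, hyu⟩ := hN₂
  have hne : ∀ E ∈ 𝓕₁, ∀ F ∈ 𝓕₂, E ≠ F := by
    rintro E hE F hF rfl
    exact h𝓕 E hE hF
  refine isTree_union t₁ t₂ ?_ hx hy ?_ ?_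
  · rw [Set.disjoint_left]
    intro z hz hz'
    obtain ⟨E, hE, hzE⟩ := h₁.sub z hz
    obtain ⟨F, hF, hzF⟩ := h₂.sub z hz'
    exact hne E hE F hF (hnet.eq_of_mem (h₁.arcs hE) (h₂.arcs hF) hzE hzF)
  · obtain ⟨E, hE, hxE⟩ := h₁.sub x hx
    obtain ⟨F, hF, hyF⟩ := h₂.sub y hy
    exact hnet.adj_of_mem (h₁.arcs hE) (h₂.arcs hF) (hne E hE F hF) hxE hyF hxN hyN
  · intro u hu v hv hadj
    obtain ⟨E, hE, huE⟩ := h₁.sub u hu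
    obtain ⟨F, hF, hvF⟩ := h₂.sub v hv
    obtain ⟨N', huN, hvN⟩ := hnet.exists_node_of_adj (h₁.arcs hE) (h₂.arcs hF)
      (hne E hE F hF) huE hvF hadj
    by_cases hNN : N' = N
    · subst hNN
      exact ⟨hxu u ⟨hu, huN⟩, hyu v ⟨hv, hvN⟩⟩
    · exfalso
      by_cases h : N' ∈ I₁ ∨ N' ∈ T₁
      · exact Set.disjoint_left.1 (h₂.miss N' (hN N' hNN h).1 (hN N' hNN h).2) hv hvN
      · push Not at h
        exact Set.disjoint_left.1 (h₁.miss N' h.1 h.2) hu huN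

/-- An induced tree in the arcs of `𝓕` with one neighbour of `Y` and exits at the nodes in `T`. -/
structure Piece (G : SimpleGraph V) (X : Set V) (H : Net V) (Y K : Set V) (I T : Set H.nodes)
    (𝓕 : Set (Set V)) : Prop extends Touch H K I T 𝓕 where
  tree : (G.induce K).IsTree
  contact : ∃! x, x ∈ K ∩ nbrIn G X Y

theorem Piece.mono {K : Set V} {I T I' T' : Set H.nodes} {𝓕 : Set (Set V)}
    (h : Piece G X H Y K I T 𝓕) (hT : T' ⊆ T) (hI : ∀ N, N ∈ I ∨ N ∈ T → N ∈ I' ∨ N ∈ T') :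
    Piece G X H Y K I' T' 𝓕 := ⟨h.toTouch.mono hT hI, h.tree, h.contact⟩

theorem exists_unique_union {A B N : Set V} (hA : ∃! x, x ∈ A ∩ N) (hB : Disjoint B N) :
    ∃! x, x ∈ (A ∪ B) ∩ N := by
  obtain ⟨x, ⟨hx, hxN⟩, hu⟩ := hA
  refine ⟨x, ⟨Or.inl hx, hxN⟩, ?_⟩
  rintro y ⟨hy | hy, hyN⟩
  · exact hu y ⟨hy, hyN⟩
  · exact absurd hyN (Set.disjoint_left.1 hB hy)

/-- Attaching a tree of `G[X]` with one neighbour `p` of `Y` to a tree with one neighbour of `p`. -/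
theorem isTree_attach {K L : Set V} (hKX : K ⊆ X) (tK : (G.induce K).IsTree)
    (tL : (G.induce L).IsTree) {p : V} (hp : p ∈ K) (hu : ∀ x ∈ K, x ∈ nbrIn G X Y → x = p)
    (hLK : ∀ z ∈ L, z ∉ Y → z ∉ K ∧ ∀ x ∈ K, ¬ G.Adj z x) (hYX : Disjoint Y X)
    (hL : ∃! y, y ∈ L ∩ {y | y ∈ Y ∧ G.Adj y p}) : (G.induce (L ∪ K)).IsTree := by
  obtain ⟨y, ⟨hyL, hyY, hyp⟩, hyu⟩ := hL
  refine isTree_union tL tK ?_ hyL hp hyp ?_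
  · rw [Set.disjoint_left]
    intro z hz hzK
    by_cases hzY : z ∈ Y
    · exact Set.disjoint_left.1 hYX hzY (hKX hzK)
    · exact (hLK z hz hzY).1 hzK
  · intro z hz x hx hadj
    by_cases hzY : z ∈ Y
    · obtain rfl := hu x hx ⟨hKX hx, z, hzY, hadj⟩
      exact ⟨hyu z ⟨hz, hzY, hadj⟩, rfl⟩
    · exact absurd hadj ((hLK z hz hzY).2 x hx)

/-- A single rung through a neighbour of `Y` in a node. -/
theorem exists_piece_of_mem_node (hnet : IsNet G X H) {E : Set V} (hE : E ∈ H.arcs)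
    {a D : H.nodes} (hends : H.ends E = s((a : Set V), (D : Set V))) {z : V} (hzE : z ∈ E)
    (hza : z ∈ (a : Set V)) (hzM : z ∈ nbrIn G X Y)
    (hM : ∀ x ∈ nbrIn G X Y, x ∈ E → x ∈ (a : Set V)) :
    ∃ K, Piece G X H Y K ∅ {a, D} {E} := by
  obtain ⟨R, hzR, hRE, hR⟩ := hnet.exists_rung hE hends hzE
  refine ⟨R, touch_rung hnet hE hends hRE hR, hR.tree.1, z, ⟨hzR, hzM⟩, ?_⟩
  rintro x ⟨hxR, hxM⟩
  exact hR.tree.2.1.unique ⟨hxR, hM x hxM (hRE hxR)⟩ ⟨hzR, hza⟩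

/-- Two rungs through a node, one of them through a neighbour of `Y`. -/
theorem exists_piece_of_mixed (hnet : IsNet G X H) {E F : Set V} (hE : E ∈ H.arcs)
    (hF : F ∈ H.arcs) {a A B : H.nodes} (hEe : H.ends E = s((a : Set V), (A : Set V)))
    (hFe : H.ends F = s((a : Set V), (B : Set V))) (hAB : A ≠ B) {w w' : V} (hwE : w ∈ E)
    (hwa : w ∈ (a : Set V)) (hwM : w ∈ nbrIn G X Y) (hwF : w' ∈ F) (hwa' : w' ∈ (a : Set V))
    (hwM' : w' ∉ nbrIn G X Y) (hME : ∀ x ∈ nbrIn G X Y, x ∈ E → x ∈ (a : Set V))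
    (hMF : ∀ x ∈ nbrIn G X Y, x ∈ F → x ∈ (a : Set V)) :
    ∃ K, Piece G X H Y K {a} {A, B} {E, F} := by
  have haA := hnet.ne_of_ends hE hEe
  have haB := hnet.ne_of_ends hF hFe
  have hEF : E ≠ F := by
    rintro rfl
    rcases (ends_eq_iff hEe).1 hFe with ⟨-, h⟩ | ⟨h, -⟩
    · exact hAB h
    · exact haB h
  obtain ⟨R, hR, hRE, hRr⟩ := hnet.exists_rung hE hEe hwE
  obtain ⟨R', hR', hRF, hRr'⟩ := hnet.exists_rung hF hFe hwF
  have t := touch_rung hnet hE hEe hRE hRr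
  have t' := touch_rung hnet hF hFe hRF hRr'
  refine ⟨R ∪ R', ?_, ?_, w, ⟨Or.inl hR, hwM⟩, ?_⟩
  · have h1 : Touch H R {a} {A} {E} := t.mono (by simp) (by
      rintro N (⟨⟨⟩⟩ | rfl | rfl)
      · simp
      · simp)
    have h2 : Touch H R' {a} {B} {F} := t'.mono (by simp) (by
      rintro N (⟨⟨⟩⟩ | rfl | rfl)
      · simp
      · simp)
    have h3 := h1.union h2 (by rintro N rfl; exact ⟨haA.symm, hAB⟩)
      (by rintro N rfl; exact haB.symm)
    rw [Set.union_self] at h3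
    exact h3
  · refine isTree_join hnet hRr.tree.1 hRr'.tree.1 t t' ?_ hRr.tree.2.1 hRr'.tree.2.1 ?_
    · rintro _ rfl; exact hEF
    · rintro N hNa (⟨⟨⟩⟩ | rfl | rfl)
      · exact absurd rfl hNa
      · refine ⟨by simp, ?_⟩
        rintro (h | h)
        · exact hNa h
        · exact hAB h
  · rintro x ⟨hx | hx, hxM⟩
    · exact hRr.tree.2.1.unique ⟨hx, hME x hxM (hRE hx)⟩ ⟨hR, hwa⟩
    · have := hRr'.tree.2.1.unique ⟨hx, hMF x hxM (hRF hx)⟩ ⟨hR', hwa'⟩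
      exact absurd (this ▸ hxM) hwM'

/-- A neighbour of `Y` in a node with a rung of another arc at that node. -/
theorem exists_piece_of_vertex (hnet : IsNet G X H) {E F : Set V} (hE : E ∈ H.arcs)
    (hF : F ∈ H.arcs) {a A B : H.nodes} (hEe : H.ends E = s((a : Set V), (A : Set V)))
    (hFe : H.ends F = s((a : Set V), (B : Set V))) (hAB : A ≠ B) {w w' : V} (hwE : w ∈ E)
    (hwa : w ∈ (a : Set V)) (hwM : w ∈ nbrIn G X Y) (hwF : w' ∈ F) (hwa' : w' ∈ (a : Set V))
    (hwM' : w' ∉ nbrIn G X Y) (hMF : ∀ x ∈ nbrIn G X Y, x ∈ F → x ∈ (a : Set V)) :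
    ∃ K, Piece G X H Y K {N | N = a ∨ N = A ∧ w ∈ (A : Set V)} {B} {E, F} := by
  have haA := hnet.ne_of_ends hE hEe
  have haB := hnet.ne_of_ends hF hFe
  have hEF : E ≠ F := by
    rintro rfl
    rcases (ends_eq_iff hEe).1 hFe with ⟨-, h⟩ | ⟨h, -⟩
    · exact hAB h
    · exact haB h
  obtain ⟨R', hR', hRF, hRr'⟩ := hnet.exists_rung hF hFe hwF
  have t : Touch H {w} {a, A} ∅ {E} := touch_singleton hnet hE hEe hwE
  have t' := touch_rung hnet hF hFe hRF hRr'
  refine ⟨{w} ∪ R', ⟨?_, ?_, ?_, ?_⟩, ?_, w, ⟨Or.inl rfl, hwM⟩, ?_⟩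
  · rintro _ (rfl | rfl)
    · exact hE
    · exact hF
  · rintro x (rfl | hx)
    · exact ⟨E, by simp, hwE⟩
    · exact ⟨F, by simp, hRF hx⟩
  · rintro N rfl
    rw [Set.union_comm]
    refine exists_unique_union hRr'.tree.2.2 ?_
    rw [Set.disjoint_singleton_left]
    intro h
    rcases hnet.eq_or_eq_of_mem hE hEe hwE h with h | h
    · exact haB h.symm
    · exact hAB h.symm
  · intro N hI hT
    rw [Set.disjoint_union_left, Set.disjoint_singleton_left]
    constructor
    · intro h
      rcases hnet.eq_or_eq_of_mem hE hEe hwE h with rfl | rfl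
      · exact hI (Or.inl rfl)
      · exact hI (Or.inr ⟨rfl, h⟩)
    · refine t'.miss N (by simp) ?_
      rintro (h | h)
      · exact hI (Or.inl h)
      · exact hT h
  · refine isTree_join hnet (isTree_singleton w) hRr'.tree.1 t t' ?_ (N := a) ?_ hRr'.tree.2.1 ?_
    · rintro _ rfl; exact hEF
    · exact ⟨w, ⟨rfl, hwa⟩, fun y hy => hy.1⟩
    · rintro N hNa ((rfl | rfl) | ⟨⟨⟩⟩)
      · exact absurd rfl hNa
      · refine ⟨by simp, ?_⟩
        rintro (h | h)
        · exact hNa h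
        · exact hAB h
  · rintro x ⟨rfl | hx, hxM⟩
    · rfl
    · have := hRr'.tree.2.1.unique ⟨hx, hMF x hxM (hRF hx)⟩ ⟨hR', hwa'⟩
      exact absurd (this ▸ hxM) hwM'

/-- From a neighbour of `Y` in an arc to an end-node of the arc. -/
theorem exists_piece_of_mem_arc (hnet : IsNet G X H) {E : Set V} (hE : E ∈ H.arcs)
    {a b : H.nodes} (hends : H.ends E = s((a : Set V), (b : Set V))) {x : V} (hxE : x ∈ E)
    (hxM : x ∈ nbrIn G X Y) : ∃ K, Piece G X H Y K {a} {b} {E} := by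
  obtain ⟨R, hxR, hRE, hR⟩ := hnet.exists_rung hE hends hxE
  obtain ⟨F, hFR, ht, hM, hb, -⟩ := exists_bridge (A := nbrIn G X Y) (B := (b : Set V))
    hR.tree.1.connected.preconnected ⟨x, hxR, hxM⟩ hR.tree.2.2.exists
  exact ⟨F, touch_subset_arc hnet hE hends (hFR.trans hRE) hb, ht, hM⟩

/-- From a neighbour of `Y` in an arc to an end-node of the arc, avoiding the other end-node. -/
theorem exists_piece_of_notMem (hnet : IsNet G X H) {E : Set V} (hE : E ∈ H.arcs)
    {a b : H.nodes} (hends : H.ends E = s((a : Set V), (b : Set V))) {x : V} (hxE : x ∈ E)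
    (hxM : x ∈ nbrIn G X Y) (hxa : x ∉ (a : Set V)) : ∃ K, Piece G X H Y K ∅ {b} {E} := by
  obtain ⟨R, hxR, hRE, hR⟩ := hnet.exists_rung hE hends hxE
  obtain ⟨htR, ⟨r, ⟨hrR, hra⟩, hru⟩, ⟨s, ⟨hsR, hsb⟩, -⟩⟩ := hR.tree
  have hxr : x ≠ r := by rintro rfl; exact hxa hra
  have hrb : r ∉ (b : Set V) := by
    intro h
    have := hR.2 {r} (Set.singleton_subset_iff.2 hrR) (Or.inl ⟨r, hra, h, rfl⟩)
    rw [← this] at hxR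
    exact hxr hxR
  have hend : IsEndOf G R r := by
    rcases hR.1 with ⟨y, hya, hyb, rfl⟩ | ⟨-, u, w, -, hu, -, hue, -⟩
    · exact absurd (hrR ▸ hyb) hrb
    · rw [← hru u ⟨hue.1, hu⟩]; exact hue
  obtain ⟨F, hFR, ht, hM, hb, -⟩ := exists_bridge (A := nbrIn G X Y) (B := (b : Set V))
    (preconnected_diff_of_isEndOf htR.connected.preconnected hend) ⟨x, ⟨hxR, hxr⟩, hxM⟩
    ⟨s, ⟨hsR, by rintro rfl; exact hrb hsb⟩, hsb⟩
  have h1 := touch_subset_arc hnet hE hends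
    ((hFR.trans Set.sdiff_subset).trans hRE) hb
  have h2 := h1.of_disjoint (U := a) (by
    rw [Set.disjoint_left]
    intro z hz hza
    exact (hFR hz).2 (hru z ⟨(hFR hz).1, hza⟩))
  rw [Set.sdiff_self] at h2
  exact ⟨F, h2, ht, hM⟩

theorem Wild.exists_unique_nbr (hw : Wild G X H Y) {u v : V} (hu : u ∈ nbrIn G X Y)
    (hv : v ∈ nbrIn G X Y) (h : Untamed H u v) :
    ∃ y z, y ∈ Y ∧ z ∈ Y ∧ (∀ w ∈ Y, G.Adj w u ↔ w = y) ∧ ∀ w ∈ Y, G.Adj w v ↔ w = z := by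
  obtain ⟨y₀, y₁, he₀, he₁, hall⟩ := hw.exists_ends
  rcases hall u hu v hv h with ⟨h1, h2⟩ | ⟨h1, h2⟩
  · exact ⟨y₀, y₁, he₀.1, he₁.1, h1, h2⟩
  · exact ⟨y₁, y₀, he₁.1, he₀.1, h1, h2⟩

variable [Finite V]

/-- Two pieces with three exits in total. -/
theorem Setting.sapling_of_pieces (S : Setting G X H Y) {c₁ c₂ c₃ : H.nodes}
    {P₁ P₂ P₃ : Set H.nodes} (hfan : Fan H c₁ c₂ c₃ P₁ P₂ P₃) {K₁ K₂ : Set V}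
    {I₁ I₂ : Set H.nodes} {𝓕₁ 𝓕₂ : Set (Set V)} (h₁ : Piece G X H Y K₁ I₁ {c₁, c₂} 𝓕₁)
    (h₂ : Piece G X H Y K₂ I₂ {c₃} 𝓕₂) (hI : ∀ N ∈ I₁, N ∉ I₂)
    (hI₁ : ∀ N ∈ I₁, N ∉ P₁ ∧ N ∉ P₂ ∧ N ∉ P₃) (hI₂ : ∀ N ∈ I₂, N ∉ P₁ ∧ N ∉ P₂ ∧ N ∉ P₃)
    (h𝓕 : ∀ E ∈ 𝓕₁, E ∉ 𝓕₂)
    (h𝓕₁ : ∀ E ∈ 𝓕₁, NotInside H P₁ P₂ P₃ E) (h𝓕₂ : ∀ E ∈ 𝓕₂, NotInside H P₁ P₂ P₃ E)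
    (hM : ∀ x ∈ nbrIn G X Y, ∀ E ∈ H.arcs, x ∈ E → NotInside H P₁ P₂ P₃ E) :
    ∃ T, T ⊆ X ∪ Y ∧ IsSapling G T := by
  have hYX := S.wild.1
  have h13 : c₁ ≠ c₃ := by rintro rfl; exact hfan.notMem₁₃ hfan.mem₁ hfan.mem₃
  have h23 : c₂ ≠ c₃ := by rintro rfl; exact hfan.notMem₂₃ hfan.mem₂ hfan.mem₃
  have hX₁ := h₁.toTouch.subset S.net
  have hX₂ := h₂.toTouch.subset S.net
  have hT₁ : ∀ N ∈ ({c₁, c₂} : Set H.nodes), N ∉ I₂ ∧ N ∉ ({c₃} : Set H.nodes) := by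
    rintro N (rfl | rfl)
    · exact ⟨fun h => (hI₂ _ h).1 hfan.mem₁, h13⟩
    · exact ⟨fun h => (hI₂ _ h).2.1 hfan.mem₂, h23⟩
  have hT₂ : ∀ N ∈ ({c₃} : Set H.nodes), N ∉ I₁ := by
    rintro N rfl h
    exact (hI₁ _ h).2.2 hfan.mem₃
  have hap := h₁.toTouch.apart S.net h₂.toTouch h𝓕 (by
    rintro N (h | h)
    · exact ⟨hI N h, fun h' => hT₂ N h' h⟩
    · exact hT₁ N h)
  obtain ⟨p, ⟨hpK, hpM⟩, hpu⟩ := h₁.contact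
  obtain ⟨q, ⟨hqK, hqM⟩, hqu⟩ := h₂.contact
  obtain ⟨yp, hyp, hap'⟩ := hpM.2
  obtain ⟨yq, hyq, haq'⟩ := hqM.2
  obtain ⟨F, hFY, htF, ⟨y, ⟨hyF, hy⟩, hyu⟩, ⟨z, ⟨hzF, hz⟩, hzu⟩, -⟩ :=
    exists_bridge (A := {y | G.Adj y p}) (B := {y | G.Adj y q})
      (isTree_induce_of_isPathSet S.wild.2.1).connected.preconnected ⟨yp, hyp, hap'⟩ ⟨yq, hyq, haq'⟩
  have t1 : (G.induce (F ∪ K₁)).IsTree := by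
    refine isTree_attach hX₁ h₁.tree htF hpK (fun x hx hxM => hpu x ⟨hx, hxM⟩)
      (fun z hz hzY => absurd (hFY hz) hzY) hYX ⟨y, ⟨hyF, hFY hyF, hy⟩, ?_⟩
    rintro w ⟨hw, -, hwp⟩
    exact hyu w ⟨hw, hwp⟩
  have t2 : (G.induce (F ∪ K₁ ∪ K₂)).IsTree := by
    refine isTree_attach hX₂ h₂.tree t1 hqK (fun x hx hxM => hqu x ⟨hx, hxM⟩)
      ?_ hYX ⟨z, ⟨Or.inl hzF, hFY hzF, hz⟩, ?_⟩
    · rintro w (hw | hw) hwY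
      · exact absurd (hFY hw) hwY
      · exact ⟨Set.disjoint_left.1 hap.1 hw, hap.2 w hw⟩
    · rintro w ⟨hw | hw, hwY, hwp⟩
      · exact hzu w ⟨hw, hwp⟩
      · exact absurd (hX₁ hw) (Set.disjoint_left.1 hYX hwY)
  have hT : ({c₁, c₂} ∪ {c₃} : Set H.nodes) = {c₁, c₂, c₃} := by
    ext N
    simp only [Set.mem_union, Set.mem_insert_iff, Set.mem_singleton_iff]
    tauto
  have htouch := h₁.toTouch.union h₂.toTouch hT₁ hT₂
  rw [hT] at htouch
  refine S.sapling_of_core hfan htouch hFY ?_ ?_ ?_ hM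
  · rwa [Set.union_comm, ← Set.union_assoc]
  · rintro N (h | h)
    · exact hI₁ N h
    · exact hI₂ N h
  · rintro E (h | h)
    · exact h𝓕₁ E h
    · exact h𝓕₂ E h

/-- A sprout of the third type, extended by a rung at the node `a` met by both of its rungs. -/
theorem Setting.sapling_of_detour (S : Setting G X H Y) {a b c : H.nodes}
    {P₁ P₂ P₃ : Set H.nodes} (hfan : Fan H a b c P₁ P₂ P₃) {E : Set V} (hE : E ∈ H.arcs)
    (hends : H.ends E = s((a : Set V), (b : Set V))) {P Q K₂ : Set V} (hPE : P ⊆ E) (hQE : Q ⊆ E)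
    (hPQ : Apart G P Q) (tP : (G.induce P).IsTree) (tQ : (G.induce Q).IsTree)
    (hPM : Disjoint P (nbrIn G X Y)) (hQM : ∃! x, x ∈ Q ∩ nbrIn G X Y)
    (hPa : ∃! x, x ∈ P ∩ (a : Set V)) (hPb : ∃! x, x ∈ P ∩ (b : Set V))
    (hQa : ∃! x, x ∈ Q ∩ (a : Set V)) (hQb : Disjoint Q (b : Set V))
    {I₂ : Set H.nodes} {𝓕₂ : Set (Set V)} (h₂ : Piece G X H Y K₂ I₂ {c} 𝓕₂)
    (hI₂ : ∀ N ∈ I₂, N ∉ P₁ ∧ N ∉ P₂ ∧ N ∉ P₃) (hE₂ : E ∉ 𝓕₂)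
    (h𝓕₂ : ∀ E ∈ 𝓕₂, NotInside H P₁ P₂ P₃ E)
    (hM : ∀ x ∈ nbrIn G X Y, ∀ E ∈ H.arcs, x ∈ E → NotInside H P₁ P₂ P₃ E) :
    ∃ T, T ⊆ X ∪ Y ∧ IsSapling G T := by
  have hnet := S.net
  have hab := hnet.ne_of_ends hE hends
  have haleaf : ¬ H.IsLeafNode a := by
    intro hl
    obtain ⟨v, -, hv⟩ := hnet.leaf_single a hl
    obtain ⟨p, ⟨hp, hpa⟩, -⟩ := hPa
    obtain ⟨q, ⟨hq, hqa⟩, -⟩ := hQa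
    rw [hv, Set.mem_singleton_iff] at hpa hqa
    exact Set.disjoint_left.1 hPQ.1 hp (hpa.trans hqa.symm ▸ hq)
  obtain ⟨A, hA, hadj, P', hP', hfan', haP'⟩ := hfan.step₁ haleaf
  obtain ⟨haA, F, hF, hFends⟩ := Net.graph_adj.1 hadj
  have hAb : A ≠ b := by rintro rfl; exact hfan.notMem₁₂ hA hfan.mem₂
  have hFin : Inside H P₁ F := ⟨hF, a, hfan.mem₁, A, hA, hFends⟩
  have hFE : F ≠ E := by
    rintro rfl
    exact hfan.notMem₁₂ (hFin.ends_mem hends).2 hfan.mem₂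
  obtain ⟨x₀, hx₀⟩ := hnet.arc_nonempty F hF
  obtain ⟨R, -, hRF, hR⟩ := hnet.exists_rung hF hFends hx₀
  have hRM : Disjoint R (nbrIn G X Y) := by
    rw [Set.disjoint_left]
    exact fun x hx hxM => (hM x hxM F hF (hRF hx)).1 hFin
  have tR := touch_rung hnet hF hFends hRF hR
  have hTP : Touch H P {a} {b} {E} := touch_subset_arc hnet hE hends hPE hPb
  have hTQ : Touch H Q {a} ∅ {E} := by
    refine ⟨by rintro _ rfl; exact hE, fun x hx => ⟨E, rfl, hQE hx⟩, by rintro N ⟨⟩, ?_⟩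
    intro N hN _
    rw [Set.disjoint_left]
    intro x hx hxN
    rcases hnet.eq_or_eq_of_mem hE hends (hQE hx) hxN with rfl | rfl
    · exact hN rfl
    · exact Set.disjoint_left.1 hQb hx hxN
  have t1 : (G.induce (R ∪ P)).IsTree := by
    refine isTree_join hnet hR.tree.1 tP tR hTP (by rintro _ rfl; exact hFE) hR.tree.2.1 hPa ?_
    rintro N hN (⟨⟨⟩⟩ | rfl | rfl)
    · exact absurd rfl hN
    · exact ⟨hN, hAb⟩
  have t2 : (G.induce (R ∪ P ∪ Q)).IsTree := by
    obtain ⟨r, ⟨hr, hra⟩, hru⟩ := hR.tree.2.1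
    obtain ⟨q, ⟨hq, hqa⟩, hqu⟩ := hQa
    refine isTree_union t1 tQ ?_ (Or.inl hr) hq ?_ ?_
    · rw [Set.disjoint_union_left]
      exact ⟨(hnet.arcs_disjoint F hF E hE hFE).mono hRF hQE, hPQ.1⟩
    · exact hnet.adj_of_mem hF hE hFE (hRF hr) (hQE hq) hra hqa
    · rintro x (hx | hx) y hy hxy
      · obtain ⟨N, hxN, hyN⟩ := hnet.exists_node_of_adj hF hE hFE (hRF hx) (hQE hy) hxy
        have hNa : N = a := by
          by_contra hne
          exact Set.disjoint_left.1 (hTQ.miss N hne (by simp)) hy hyN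
        subst hNa
        exact ⟨hru x ⟨hx, hxN⟩, hqu y ⟨hy, hyN⟩⟩
      · exact absurd hxy (hPQ.2 x hx y hy)
  have hTK : Touch H (R ∪ P ∪ Q) {a} {A, b} {F, E} := by
    have hR' : Touch H R {a} {A} {F} := tR.mono (by simp) (by
      rintro N (⟨⟨⟩⟩ | rfl | rfl)
      · simp
      · simp)
    have h1 := (hR'.union hTP (by rintro N rfl; exact ⟨haA.symm, hAb⟩)
      (by rintro N rfl; exact hab.symm)).union hTQ (by
        rintro N (rfl | rfl)
        · exact ⟨haA.symm, by simp⟩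
        · exact ⟨hab.symm, by simp⟩) (by rintro N ⟨⟩)
    rw [Set.union_self, Set.union_self, Set.union_empty, Set.union_assoc {F}, Set.union_self] at h1
    exact h1
  have hEin : NotInside H P₁ P₂ P₃ E :=
    hfan.notInside hends hfan.mem₁ (fun h => hfan.notMem₁₂ h hfan.mem₂)
  have hIa : a ∉ P' ∧ a ∉ P₂ ∧ a ∉ P₃ := ⟨haP', hfan.notMem₁₂ hfan.mem₁, hfan.notMem₁₃ hfan.mem₁⟩
  refine S.sapling_of_pieces hfan' ⟨hTK, t2, ?_⟩ h₂ ?_ ?_ ?_ ?_ ?_ ?_ ?_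
  · rw [Set.union_comm]
    refine exists_unique_union hQM ?_
    rw [Set.disjoint_union_left]
    exact ⟨hRM, hPM⟩
  · rintro N rfl h
    exact (hI₂ _ h).1 hfan.mem₁
  · rintro N rfl
    exact hIa
  · exact fun N hN => ⟨fun h => (hI₂ N hN).1 (hP' h), (hI₂ N hN).2⟩
  · rintro _ (rfl | rfl)
    · exact fun h => (h𝓕₂ _ h).1 hFin
    · exact hE₂
  · rintro _ (rfl | rfl)
    · exact notInside_of_notMem hFends hIa.1 hIa.2.1 hIa.2.2
    · exact hEin.mono hP' subset_rfl subset_rfl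
  · exact fun E hE => (h𝓕₂ E hE).mono hP' subset_rfl subset_rfl
  · exact fun x hx E hE hxE => (hM x hx E hE hxE).mono hP' subset_rfl subset_rfl

/-- A sprout in an arc `E` and a piece away from `E`. -/
theorem Setting.sapling_of_sprout (S : Setting G X H Y) {a b c : H.nodes}
    {P₁ P₂ P₃ : Set H.nodes} (hfan : Fan H a b c P₁ P₂ P₃) {E : Set V} (hE : E ∈ H.arcs)
    (hends : H.ends E = s((a : Set V), (b : Set V))) {T K₂ : Set V} (hTE : T ⊆ E)
    (hT : IsSprout G (nbrIn G X Y ∩ E) a b T)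
    {I₂ : Set H.nodes} {𝓕₂ : Set (Set V)} (h₂ : Piece G X H Y K₂ I₂ {c} 𝓕₂)
    (hI₂ : ∀ N ∈ I₂, N ∉ P₁ ∧ N ∉ P₂ ∧ N ∉ P₃) (hE₂ : E ∉ 𝓕₂)
    (h𝓕₂ : ∀ E ∈ 𝓕₂, NotInside H P₁ P₂ P₃ E)
    (hM : ∀ x ∈ nbrIn G X Y, ∀ E ∈ H.arcs, x ∈ E → NotInside H P₁ P₂ P₃ E) :
    ∃ T, T ⊆ X ∪ Y ∧ IsSapling G T := by
  have hnet := S.net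
  have hab := hnet.ne_of_ends hE hends
  have hac : a ≠ c := by rintro rfl; exact hfan.notMem₁₃ hfan.mem₁ hfan.mem₃
  have hbc : b ≠ c := by rintro rfl; exact hfan.notMem₂₃ hfan.mem₂ hfan.mem₃
  have haI : a ∉ I₂ := fun h => (hI₂ a h).1 hfan.mem₁
  have hbI : b ∉ I₂ := fun h => (hI₂ b h).2.1 hfan.mem₂
  have hEin : NotInside H P₁ P₂ P₃ E :=
    hfan.notInside hends hfan.mem₁ (fun h => hfan.notMem₁₂ h hfan.mem₂)
  have hMu : ∀ {K : Set V}, K ⊆ E → (∃! x, x ∈ K ∩ (nbrIn G X Y ∩ E)) →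
      ∃! x, x ∈ K ∩ nbrIn G X Y := by
    rintro K hK ⟨x, ⟨hx, hxM, -⟩, hu⟩
    exact ⟨x, ⟨hx, hxM⟩, fun y hy => hu y ⟨hy.1, hy.2, hK hy.1⟩⟩
  have hab_touch : ∀ {K : Set V}, K ⊆ E → (∃! x, x ∈ K ∩ (a : Set V)) →
      (∃! x, x ∈ K ∩ (b : Set V)) → Touch H K ∅ {a, b} {E} := by
    intro K hK ha hb
    refine ⟨by rintro _ rfl; exact hE, fun x hx => ⟨E, rfl, hK hx⟩, ?_, ?_⟩
    · rintro N (rfl | rfl) <;> assumption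
    · intro N _ hN
      rw [Set.disjoint_left]
      exact fun x hx hxN => hN (hnet.eq_or_eq_of_mem hE hends (hK hx) hxN)
  have tree_case : ∀ {K : Set V}, K ⊆ E → (G.induce K).IsTree →
      (∃! x, x ∈ K ∩ (nbrIn G X Y ∩ E)) → (∃! x, x ∈ K ∩ (a : Set V)) →
      (∃! x, x ∈ K ∩ (b : Set V)) → ∃ T, T ⊆ X ∪ Y ∧ IsSapling G T := by
    intro K hK ht hx ha hb
    refine S.sapling_of_pieces hfan (K₁ := K) (I₁ := ∅) (𝓕₁ := {E})
      ⟨hab_touch hK ha hb, ht, hMu hK hx⟩ h₂ (by simp) (by simp) hI₂ ?_ ?_ h𝓕₂ hM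
    · rintro _ rfl; exact hE₂
    · rintro _ rfl; exact hEin
  rcases hT with ⟨ht, hx, ha, hb⟩ | ⟨P, Q, rfl, hPQ, hP, hPb, hQ, hQa⟩ |
    ⟨P, Q, rfl, hPQ, hP, hPS, hQ⟩
  · exact tree_case hTE ht hx ha hb
  · have hPE := Set.subset_union_left.trans hTE
    have hQE := Set.subset_union_right.trans hTE
    obtain ⟨tP, hP₁, hP₂⟩ := hP.tree
    obtain ⟨tQ, hQ₁, hQ₂⟩ := hQ.tree
    obtain ⟨p, ⟨hpP, hpM⟩, hpu⟩ := hMu hPE hP₁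
    obtain ⟨q, ⟨hqQ, hqM⟩, hqu⟩ := hMu hQE hQ₁
    obtain ⟨r, ⟨hrK, hrM⟩, hru⟩ := h₂.contact
    have hT₁ : ∀ N ∈ ({a, b} : Set H.nodes), N ∉ I₂ ∧ N ∉ ({c} : Set H.nodes) := by
      rintro N (rfl | rfl)
      · exact ⟨haI, hac⟩
      · exact ⟨hbI, hbc⟩
    have hunt : ∀ x ∈ E, Untamed H x r := by
      rintro x hx (⟨F, hF, hxF, hrF⟩ | ⟨N, hN, hxN, hrN⟩)
      · obtain ⟨F', hF', hrF'⟩ := h₂.sub r hrK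
        obtain rfl := hnet.eq_of_mem hE hF hx hxF
        obtain rfl := hnet.eq_of_mem hE (h₂.arcs hF') hrF hrF'
        exact hE₂ hF'
      · have h := hT₁ _ (hnet.eq_or_eq_of_mem hE hends (N := ⟨N, hN⟩) hx hxN)
        exact Set.disjoint_left.1 (h₂.miss ⟨N, hN⟩ h.1 h.2) hrK hrN
    obtain ⟨y, z, hy, hz, hyp, hzr⟩ := S.wild.exists_unique_nbr hpM hrM (hunt p (hPE hpP))
    have hyq : ∀ w ∈ Y, G.Adj w q ↔ w = y := fun w hw => by
      rw [← hyp w hw]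
      exact S.wild.adj_iff_adj hqM hpM hrM (hunt q (hQE hqQ)) (hunt p (hPE hpP)) hw
    obtain ⟨F, hFY, htF, ⟨y', ⟨hyF, hy'⟩, hyu⟩, ⟨z', ⟨hzF, hz'⟩, hzu⟩, -⟩ :=
      exists_bridge (A := {y}) (B := {z})
        (isTree_induce_of_isPathSet S.wild.2.1).connected.preconnected ⟨y, hy, rfl⟩ ⟨z, hz, rfl⟩
    obtain rfl : y' = y := hy'
    obtain rfl : z' = z := hz'
    have hYX := S.wild.1
    have hPX := hPE.trans (hnet.arc_subset hE)
    have hQX := hQE.trans (hnet.arc_subset hE)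
    have htouch : Touch H (P ∪ Q) ∅ {a, b} {E} := by
      refine hab_touch hTE (exists_unique_union hP₂ hQa) ?_
      rw [Set.union_comm]
      exact exists_unique_union hQ₂ hPb
    have hap := htouch.apart hnet h₂.toTouch (by rintro _ rfl; exact hE₂)
      (by
        rintro N (⟨⟨⟩⟩ | h)
        exact hT₁ N h)
    have t1 : (G.induce (F ∪ P)).IsTree := by
      refine isTree_attach hPX tP htF hpP (fun x hx hxM => hpu x ⟨hx, hxM⟩)
        (fun z hz hzY => absurd (hFY hz) hzY) hYX ⟨y', ⟨hyF, hy, (hyp y' hy).2 rfl⟩, ?_⟩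
      rintro w ⟨-, hw, hwp⟩
      exact (hyp w hw).1 hwp
    have t2 : (G.induce (F ∪ P ∪ Q)).IsTree := by
      refine isTree_attach hQX tQ t1 hqQ (fun x hx hxM => hqu x ⟨hx, hxM⟩)
        ?_ hYX ⟨y', ⟨Or.inl hyF, hy, (hyq y' hy).2 rfl⟩, ?_⟩
      · rintro w (hw | hw) hwY
        · exact absurd (hFY hw) hwY
        · exact ⟨Set.disjoint_left.1 hPQ.1 hw, hPQ.2 w hw⟩
      · rintro w ⟨-, hw, hwp⟩
        exact (hyq w hw).1 hwp
    have t3 : (G.induce (F ∪ P ∪ Q ∪ K₂)).IsTree := by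
      refine isTree_attach (h₂.toTouch.subset hnet) h₂.tree t2 hrK
        (fun x hx hxM => hru x ⟨hx, hxM⟩) ?_ hYX
        ⟨z', ⟨Or.inl (Or.inl hzF), hz, (hzr z' hz).2 rfl⟩, ?_⟩
      · rw [Set.union_assoc]
        rintro w (hw | hw) hwY
        · exact absurd (hFY hw) hwY
        · exact ⟨Set.disjoint_left.1 hap.1 hw, hap.2 w hw⟩
      · rintro w ⟨-, hw, hwp⟩
        exact (hzr w hw).1 hwp
    have hT : ({a, b} ∪ {c} : Set H.nodes) = {a, b, c} := by
      ext N
      simp only [Set.mem_union, Set.mem_insert_iff, Set.mem_singleton_iff]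
      tauto
    have htouch' := htouch.union h₂.toTouch hT₁ (by simp)
    rw [hT] at htouch'
    refine S.sapling_of_core hfan htouch' hFY ?_ ?_ ?_ hM
    · rwa [Set.union_comm, ← Set.union_assoc, ← Set.union_assoc]
    · rintro N (⟨⟨⟩⟩ | h)
      exact hI₂ N h
    · rintro F (rfl | h)
      · exact hEin
      · exact h𝓕₂ F h
  · have hPE := Set.subset_union_left.trans hTE
    have hQE := Set.subset_union_right.trans hTE
    obtain ⟨tP, hPa, hPb⟩ := hP.tree
    obtain ⟨tQ, hQS, ⟨w, ⟨hwQ, hw⟩, hwu⟩⟩ := hQ.tree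
    have hPM : Disjoint P (nbrIn G X Y) := by
      rw [Set.disjoint_left]
      exact fun x hx hxM => Set.disjoint_left.1 hPS hx ⟨hxM, hPE hx⟩
    by_cases hwa : w ∈ (a : Set V)
    · have hQa : ∃! x, x ∈ Q ∩ (a : Set V) :=
        ⟨w, ⟨hwQ, hwa⟩, fun x hx => hwu x ⟨hx.1, Or.inl hx.2⟩⟩
      by_cases hwb : w ∈ (b : Set V)
      · exact tree_case hQE tQ hQS hQa
          ⟨w, ⟨hwQ, hwb⟩, fun x hx => hwu x ⟨hx.1, Or.inr hx.2⟩⟩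
      · refine S.sapling_of_detour hfan hE hends hPE hQE hPQ tP tQ hPM (hMu hQE hQS) hPa hPb hQa ?_
          h₂ hI₂ hE₂ h𝓕₂ hM
        rw [Set.disjoint_left]
        intro x hx hxb
        exact hwb (hwu x ⟨hx, Or.inr hxb⟩ ▸ hxb)
    · have hwb := hw.resolve_left hwa
      refine S.sapling_of_detour hfan.swap₁₂ hE (ends_swap hends) hPE hQE hPQ tP tQ hPM (hMu hQE hQS)
        hPb hPa ⟨w, ⟨hwQ, hwb⟩, fun x hx => hwu x ⟨hx.1, Or.inr hx.2⟩⟩ ?_ h₂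
        (fun N hN => ⟨(hI₂ N hN).2.1, (hI₂ N hN).1, (hI₂ N hN).2.2⟩) hE₂
        (fun E hE => (h𝓕₂ E hE).swap₁₂) (fun x hx E hE hxE => (hM x hx E hE hxE).swap₁₂)
      rw [Set.disjoint_left]
      intro x hx hxa
      exact hwa (hwu x ⟨hx, Or.inl hxa⟩ ▸ hxa)

end Pieces

end ThreeInATree

namespace ThreeInATree

open SimpleGraph

section ArcCases

variable {V : Type*} {G : SimpleGraph V} {X : Set V} {H : Net V} {Y : Set V}

theorem Apart.symm {P Q : Set V} (h : Apart G P Q) : Apart G Q P :=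
  ⟨h.1.symm, fun u hu v hv hadj => h.2 v hv u hu hadj.symm⟩

theorem IsUWPath.symm {U W P : Set V} (h : IsUWPath G U W P) : IsUWPath G W U P := by
  rcases h with ⟨x, hU, hW, rfl⟩ | ⟨hP, u, w, hne, hu, hw, heu, hew⟩
  · exact Or.inl ⟨x, hW, hU, rfl⟩
  · exact Or.inr ⟨hP, w, u, hne.symm, hw, hu, hew, heu⟩

theorem IsRung.symm {U W P : Set V} (h : IsRung G U W P) : IsRung G W U P :=
  ⟨h.1.symm, fun Q hQ hQ' => h.2 Q hQ hQ'.symm⟩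

theorem IsSprout.symm {S V₁ V₂ T : Set V} (h : IsSprout G S V₁ V₂ T) : IsSprout G S V₂ V₁ T := by
  rcases h with ⟨h1, h2, h3, h4⟩ | ⟨P, Q, rfl, hPQ, hP, hP', hQ, hQ'⟩ |
    ⟨P, Q, rfl, hPQ, hP, hPS, hQ⟩
  · exact Or.inl ⟨h1, h2, h4, h3⟩
  · exact Or.inr (Or.inl ⟨Q, P, Set.union_comm _ _, hPQ.symm, hQ, hQ', hP, hP'⟩)
  · exact Or.inr (Or.inr ⟨P, Q, rfl, hPQ, hP.symm, hPS, by rwa [Set.union_comm]⟩)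

/-- Neighbours of `Y` that all lie in one end-node of an arc form no solid set. -/
theorem exists_sprout_of_subset_node (hnet : IsNet G X H) {E : Set V} (hE : E ∈ H.arcs)
    {a b : H.nodes} (hends : H.ends E = s((a : Set V), (b : Set V))) {x : V} (hxE : x ∈ E)
    (hxM : x ∈ nbrIn G X Y) (hM : ∀ x ∈ nbrIn G X Y, x ∈ E → x ∈ (b : Set V)) :
    ∃ T ⊆ E, IsSprout G (nbrIn G X Y ∩ E) a b T := by
  obtain ⟨R, hxR, hRE, hR⟩ := hnet.exists_rung hE hends hxE
  refine ⟨R, hRE, Or.inl ⟨hR.tree.1, ⟨x, ⟨hxR, hxM, hxE⟩, ?_⟩, hR.tree.2⟩⟩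
  rintro y ⟨hyR, hyM, hyE⟩
  exact hR.tree.2.2.unique ⟨hyR, hM y hyM hyE⟩ ⟨hxR, hM x hxM hxE⟩

theorem Wild.exists_untamed_of_cover (hw : Wild G X H Y) {A B : Set V}
    (hM : ∀ x ∈ nbrIn G X Y, x ∈ A ∨ x ∈ B) (hA : A ∈ H.arcs ∨ A ∈ H.nodes)
    (hB : B ∈ H.arcs ∨ B ∈ H.nodes) :
    ∃ u ∈ nbrIn G X Y, ∃ v ∈ nbrIn G X Y, u ∈ A ∧ v ∈ B ∧ Untamed H u v := by
  obtain ⟨u, hu, v, hv, huv⟩ := hw.exists_untamed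
  have key : ∀ {C : Set V}, C ∈ H.arcs ∨ C ∈ H.nodes → u ∈ C → v ∉ C := by
    rintro C (hC | hC) h1 h2
    · exact huv (Or.inl ⟨C, hC, h1, h2⟩)
    · exact huv (Or.inr ⟨C, hC, h1, h2⟩)
  rcases hM u hu with hA' | hB' <;> rcases hM v hv with hA'' | hB''
  · exact absurd hA'' (key hA hA')
  · exact ⟨u, hu, v, hv, hA', hB'', huv⟩
  · exact ⟨v, hv, u, hu, hA'', hB', huv.symm⟩
  · exact absurd hB'' (key hB hB')

/-- Vertices of two arcs without a common node through both of them. -/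
theorem IsNet.untamed (hnet : IsNet G X H) {E F : Set V} (hE : E ∈ H.arcs) (hF : F ∈ H.arcs)
    (hEF : E ≠ F) {u v : V} (hu : u ∈ E) (hv : v ∈ F)
    (h : ∀ N : H.nodes, u ∈ (N : Set V) → v ∉ (N : Set V)) : Untamed H u v := by
  rintro (⟨D, hD, huD, hvD⟩ | ⟨N, hN, huN, hvN⟩)
  · exact hEF ((hnet.eq_of_mem hE hD hu huD).trans (hnet.eq_of_mem hF hD hv hvD).symm)
  · exact h ⟨N, hN⟩ huN hvN

theorem solidSet_of_not_exists_sprout {E : Set V} (hE : E ∈ H.arcs) {a b : H.nodes}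
    (hends : H.ends E = s((a : Set V), (b : Set V)))
    (h : ¬ ∃ T ⊆ E, IsSprout G (nbrIn G X Y ∩ E) a b T) : SolidSet G H (nbrIn G X Y ∩ E) :=
  Or.inr ⟨E, hE, a, b, hends, Set.inter_subset_right, h⟩

/-- The neighbours of a node `a` through arcs that have a neighbour of `Y` in `a`. -/
def contactNodes (G : SimpleGraph V) (X : Set V) (H : Net V) (Y : Set V) (a : H.nodes) :
    Set H.nodes :=
  {A | ∃ E ∈ H.arcs, H.ends E = s((a : Set V), (A : Set V)) ∧
    ∃ w ∈ E, w ∈ (a : Set V) ∧ w ∈ nbrIn G X Y}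

/-- The neighbours of a node `a` through arcs that have in `a` a vertex without neighbour in `Y`. -/
def missNodes (G : SimpleGraph V) (X : Set V) (H : Net V) (Y : Set V) (a : H.nodes) :
    Set H.nodes :=
  {A | ∃ E ∈ H.arcs, H.ends E = s((a : Set V), (A : Set V)) ∧
    ∃ w ∈ E, w ∈ (a : Set V) ∧ w ∉ nbrIn G X Y}

theorem mem_contactNodes_or_mem_missNodes (hnet : IsNet G X H) {a A : H.nodes}
    (h : H.graph.Adj a A) : A ∈ contactNodes G X H Y a ∨ A ∈ missNodes G X H Y a := by
  obtain ⟨-, E, hE, hends⟩ := Net.graph_adj.1 h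
  obtain ⟨w, hwE, hwa⟩ := hnet.inter_nonempty hE hends
  by_cases hw : w ∈ nbrIn G X Y
  · exact Or.inl ⟨E, hE, hends, w, hwE, hwa, hw⟩
  · exact Or.inr ⟨E, hE, hends, w, hwE, hwa, hw⟩

/-- A vertex of both end-nodes of the arc `E` lies in `E`. -/
theorem SelfAiding.mem_arc_of_mem_of_mem [Finite V] (hnet : IsNet G X H) (hself : SelfAiding H)
    {E : Set V} (hE : E ∈ H.arcs) {a b : H.nodes}
    (hends : H.ends E = s((a : Set V), (b : Set V))) {z : V} (ha : z ∈ (a : Set V))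
    (hb : z ∈ (b : Set V)) : z ∈ E := by
  obtain ⟨F, hF, hzF, D, hD, hFe⟩ := hnet.exists_arc_of_mem_node ha
  rcases hnet.eq_or_eq_of_mem hF hFe hzF hb with rfl | rfl
  · exact absurd rfl (hnet.ne_of_ends hE hends)
  · rwa [hself.arc_unique hnet hE hF hends hFe]

variable [Finite V]

theorem Setting.not_isLeafNode (S : Setting G X H Y) {a : H.nodes} {x : V}
    (hx : x ∈ nbrIn G X Y) (hxa : x ∈ (a : Set V)) : ¬ H.IsLeafNode a :=
  fun h => S.self.leaf_notMem_nbrIn S.net S.wild.1 h hxa hx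

/-- A node `a` with mixed neighbourhood away from `b`. -/
theorem Setting.exists_mixed (S : Setting G X H Y) {a b : H.nodes} (ha : ¬ H.IsLeafNode a)
    (hab : a ≠ b) (hC : ∃ A ∈ contactNodes G X H Y a, A ≠ b)
    (hN : ∃ A ∈ missNodes G X H Y a, A ≠ b) :
    ∃ A B P₁ P₂ P₃, Fan H A B b P₁ P₂ P₃ ∧ (a ∉ P₁ ∧ a ∉ P₂ ∧ a ∉ P₃) ∧
      (∃ E ∈ H.arcs, H.ends E = s((a : Set V), (A : Set V)) ∧
        ∃ w ∈ E, w ∈ (a : Set V) ∧ w ∈ nbrIn G X Y) ∧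
      ∃ F ∈ H.arcs, H.ends F = s((a : Set V), (B : Set V)) ∧
        ∃ w ∈ F, w ∈ (a : Set V) ∧ w ∉ nbrIn G X Y := by
  obtain ⟨A, hA, B, hB, P₁, P₂, P₃, hfan, h1, h2, h3⟩ := S.self.exists_mixed_fan S.net ha hab
    (𝒞 := contactNodes G X H Y a \ {b}) (𝒩 := missNodes G X H Y a \ {b})
    (by
      rintro A ⟨⟨E, hE, hends, -⟩, hAb⟩
      exact ⟨(S.net.ne_of_ends hE hends).symm, hAb⟩)
    (by
      rintro A ⟨⟨E, hE, hends, -⟩, hAb⟩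
      exact ⟨(S.net.ne_of_ends hE hends).symm, hAb⟩)
    hC hN
    (by
      intro A hadj hAb
      exact (mem_contactNodes_or_mem_missNodes S.net hadj).imp (⟨·, hAb⟩) (⟨·, hAb⟩))
  exact ⟨A, B, P₁, P₂, P₃, hfan, ⟨h1, h2, h3⟩, hA.1, hB.1⟩

/-- The neighbours of `Y` lie in an arc `E` and an end-node of `E`. -/
theorem Setting.sapling_of_arc_end (S : Setting G X H Y) (hns : ¬ Sticky G X H Y) {E : Set V}
    (hE : E ∈ H.arcs) {a b : H.nodes} (hends : H.ends E = s((a : Set V), (b : Set V)))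
    (hM : ∀ x ∈ nbrIn G X Y, x ∈ E ∨ x ∈ (a : Set V)) : ∃ T, T ⊆ X ∪ Y ∧ IsSapling G T := by
  have hnet := S.net
  have hab := hnet.ne_of_ends hE hends
  obtain ⟨u, hu, v, hv, huE, hva, huv⟩ :=
    S.wild.exists_untamed_of_cover hM (Or.inl hE) (Or.inr a.2)
  have hua : u ∉ (a : Set V) := huv.symm.notMem_node hva
  have hvE : v ∉ E := huv.notMem_arc hE huE
  by_cases hmix : ∃ A ∈ missNodes G X H Y a, A ≠ b
  · obtain ⟨A, B, P₁, P₂, P₃, hfan, haP, ⟨E₁, hE₁, he₁, w, hw, hwa, hwM⟩,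
      E₂, hE₂, he₂, w', hw', hwa', hwM'⟩ := S.exists_mixed (S.not_isLeafNode hv hva) hab
        (by
          obtain ⟨F, hF, hvF, D, -, hFe⟩ := hnet.exists_arc_of_mem_node hva
          refine ⟨D, ⟨F, hF, hFe, v, hvF, hva, hv⟩, ?_⟩
          rintro rfl
          exact hvE (S.self.arc_unique hnet hE hF hends hFe ▸ hvF)) hmix
    have hne : ∀ {F : Set V} {A : H.nodes}, A ≠ b → H.ends F = s((a : Set V), (A : Set V)) →
        F ≠ E := by
      rintro F A hA hF rfl
      rcases (ends_eq_iff hends).1 hF with ⟨-, h⟩ | ⟨-, h⟩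
      · exact hA h.symm
      · exact hab h.symm
    have hAb : A ≠ b := by rintro rfl; exact hfan.notMem₁₃ hfan.mem₁ hfan.mem₃
    have hBb : B ≠ b := by rintro rfl; exact hfan.notMem₂₃ hfan.mem₂ hfan.mem₃
    have hAB : A ≠ B := by rintro rfl; exact hfan.notMem₁₂ hfan.mem₁ hfan.mem₂
    have hMa : ∀ {F : Set V}, F ∈ H.arcs → F ≠ E → ∀ x ∈ nbrIn G X Y, x ∈ F → x ∈ (a : Set V) :=
      fun hF hFE x hx hxF => (hM x hx).resolve_left fun h => hFE (hnet.eq_of_mem hF hE hxF h)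
    obtain ⟨K₁, hK₁⟩ := exists_piece_of_mixed hnet hE₁ hE₂ he₁ he₂ hAB hw hwa hwM hw' hwa' hwM'
      (hMa hE₁ (hne hAb he₁)) (hMa hE₂ (hne hBb he₂))
    obtain ⟨K₂, hK₂⟩ := exists_piece_of_notMem hnet hE hends huE hu hua
    have hEin := notInside_of_notMem hends haP.1 haP.2.1 haP.2.2
    refine S.sapling_of_pieces hfan hK₁ hK₂ (by simp) ?_ (by simp) ?_ ?_ ?_ ?_
    · rintro N rfl; exact haP
    · rintro F (rfl | rfl)
      · exact hne hAb he₁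
      · exact hne hBb he₂
    · rintro F (rfl | rfl)
      · exact notInside_of_notMem he₁ haP.1 haP.2.1 haP.2.2
      · exact notInside_of_notMem he₂ haP.1 haP.2.1 haP.2.2
    · rintro F rfl
      exact hEin
    · intro x hx F hF hxF
      rcases hM x hx with h | h
      · obtain rfl := hnet.eq_of_mem hE hF h hxF
        exact hEin
      · exact hnet.notInside_of_mem hxF h haP.1 haP.2.1 haP.2.2
  · exfalso
    push Not at hmix
    have hall : ∀ z ∈ (a : Set V), z ∉ E → z ∈ nbrIn G X Y ∧ Untamed H z u := by
      intro z hz hzE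
      obtain ⟨F, hF, hzF, D, hD, hFe⟩ := hnet.exists_arc_of_mem_node hz
      have hDb : D ≠ b := by
        rintro rfl
        exact hzE (S.self.arc_unique hnet hE hF hends hFe ▸ hzF)
      refine ⟨?_, hnet.untamed hF hE (by rintro rfl; exact hzE hzF) hzF huE ?_⟩
      · by_contra hzM
        exact hDb (hmix D ⟨F, hF, hFe, z, hzF, hz, hzM⟩)
      · intro N hzN huN
        rcases hnet.eq_or_eq_of_mem hE hends huE huN with rfl | rfl
        · exact hua huN
        · exact hzE (S.self.mem_arc_of_mem_of_mem hnet hE hends hz hzN)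
    refine hns (Or.inr ⟨E, a, b, isChunk_arc hE hends, ?_, ?_⟩)
    · intro x hx
      rcases hM x hx with h | h
      · exact Or.inl (Or.inr h)
      · exact Or.inl (Or.inl h)
    · rintro W (rfl | rfl) y hy
      · by_cases hvy : G.Adj y v
        · right
          intro z hz
          by_cases hzE : z ∈ E
          · exact Or.inl hzE
          · obtain ⟨h1, h2⟩ := hall z hz hzE
            exact Or.inr ((S.wild.adj_iff_adj h1 hv hu h2 huv.symm hy.1).2 hvy)
        · left
          rintro z ⟨hyz, hz⟩
          by_contra hzE
          obtain ⟨h1, h2⟩ := hall z hz hzE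
          exact hvy ((S.wild.adj_iff_adj h1 hv hu h2 huv.symm hy.1).1 hyz)
      · left
        rintro z ⟨hyz, hz⟩
        rcases hM z ⟨hnet.nodes_sub W W.2 hz, y, hy.1, hyz⟩ with h | h
        · exact h
        · exact S.self.mem_arc_of_mem_of_mem hnet hE hends h hz

/-- The neighbours of `Y` lie in two arcs with a common end-node. -/
theorem Setting.sapling_of_arcs_common (S : Setting G X H Y) (hns : ¬ Sticky G X H Y) {E F : Set V}
    (hE : E ∈ H.arcs) (hF : F ∈ H.arcs) {a b c : H.nodes}
    (hEe : H.ends E = s((a : Set V), (b : Set V))) (hFe : H.ends F = s((a : Set V), (c : Set V)))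
    (hbc : b ≠ c) (hM : ∀ x ∈ nbrIn G X Y, x ∈ E ∨ x ∈ F) :
    ∃ T, T ⊆ X ∪ Y ∧ IsSapling G T := by
  have hnet := S.net
  have hab := hnet.ne_of_ends hE hEe
  have hac := hnet.ne_of_ends hF hFe
  have hEF : E ≠ F := by
    rintro rfl
    rcases (ends_eq_iff hEe).1 hFe with ⟨-, h⟩ | ⟨-, h⟩
    · exact hbc h
    · exact hab h.symm
  by_cases hF' : ∀ x ∈ nbrIn G X Y, x ∈ F → x ∈ (a : Set V)
  · exact S.sapling_of_arc_end hns hE hEe fun x hx => (hM x hx).imp_right (hF' x hx)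
  by_cases hE' : ∀ x ∈ nbrIn G X Y, x ∈ E → x ∈ (a : Set V)
  · exact S.sapling_of_arc_end hns hF hFe fun x hx => (hM x hx).symm.imp_right (hE' x hx)
  push Not at hF' hE'
  obtain ⟨x, hxM, hxF, hxa⟩ := hF'
  obtain ⟨x', hxM', hxE, hxa'⟩ := hE'
  have key : ∀ {E F : Set V} {b c : H.nodes}, E ∈ H.arcs → F ∈ H.arcs →
      H.ends E = s((a : Set V), (b : Set V)) → H.ends F = s((a : Set V), (c : Set V)) →
      b ≠ c → E ≠ F → (∀ x ∈ nbrIn G X Y, x ∈ E ∨ x ∈ F) →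
      (∃ x ∈ nbrIn G X Y, x ∈ F ∧ x ∉ (a : Set V)) →
      (∃ T ⊆ E, IsSprout G (nbrIn G X Y ∩ E) a b T) → ∃ T, T ⊆ X ∪ Y ∧ IsSapling G T := by
    rintro E F b c hE hF hEe hFe hbc hEF hM ⟨x, hxM, hxF, hxa⟩ ⟨T, hTE, hT⟩
    obtain ⟨P₁, P₂, P₃, hfan⟩ := S.self.exists_fan hnet (hnet.ne_of_ends hE hEe)
      (hnet.ne_of_ends hF hFe) hbc
    obtain ⟨K, hK⟩ := exists_piece_of_notMem hnet hF hFe hxF hxM hxa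
    have hFin := hfan.notInside hFe hfan.mem₁ (fun h => hfan.notMem₁₃ h hfan.mem₃)
    refine S.sapling_of_sprout hfan hE hEe hTE hT hK (by simp) hEF ?_ ?_
    · rintro _ rfl; exact hFin
    · intro z hz D hD hzD
      rcases hM z hz with h | h
      · obtain rfl := hnet.eq_of_mem hE hD h hzD
        exact hfan.notInside hEe hfan.mem₁ (fun h => hfan.notMem₁₂ h hfan.mem₂)
      · obtain rfl := hnet.eq_of_mem hF hD h hzD
        exact hFin
  by_cases hsE : ∃ T ⊆ E, IsSprout G (nbrIn G X Y ∩ E) a b T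
  · exact key hE hF hEe hFe hbc hEF hM ⟨x, hxM, hxF, hxa⟩ hsE
  by_cases hsF : ∃ T ⊆ F, IsSprout G (nbrIn G X Y ∩ F) a c T
  · exact key hF hE hFe hEe hbc.symm hEF.symm (fun x hx => (hM x hx).symm)
      ⟨x', hxM', hxE, hxa'⟩ hsF
  exfalso
  have hcommon : ∀ u ∈ E, ∀ v ∈ F, (u ∉ (a : Set V) ∨ v ∉ (a : Set V)) → Untamed H u v := by
    intro u hu v hv h
    refine hnet.untamed hE hF hEF hu hv fun N huN hvN => ?_
    rcases hnet.eq_or_eq_of_mem hE hEe hu huN with rfl | rfl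
    · rcases h with h | h <;> contradiction
    · rcases hnet.eq_or_eq_of_mem hF hFe hv hvN with rfl | rfl
      · exact hab rfl
      · exact hbc rfl
  refine hns (Or.inl ⟨⟨_, _, solidSet_of_not_exists_sprout hE hEe hsE,
    solidSet_of_not_exists_sprout hF hFe hsF, ?_⟩, S.wild.nbrIn_internal ?_⟩)
  · rw [← Set.inter_union_distrib_left, Set.inter_eq_left.2]
    exact hM
  · intro u hu
    rcases hM u hu with h | h
    · exact ⟨x, hxM, hcommon u h x hxF (Or.inr hxa)⟩
    · exact ⟨x', hxM', (hcommon x' hxE u h (Or.inl hxa')).symm⟩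

/-- A sprout in the arc `E`, and neighbours of `Y` in an arc `F` disjoint from `E`. -/
theorem Setting.sapling_of_arcs_sprout (S : Setting G X H Y) {E F : Set V}
    (hE : E ∈ H.arcs) (hF : F ∈ H.arcs) {a b c d : H.nodes}
    (hEe : H.ends E = s((a : Set V), (b : Set V))) (hFe : H.ends F = s((c : Set V), (d : Set V)))
    (hac : a ≠ c) (had : a ≠ d) (hbc : b ≠ c) (hbd : b ≠ d)
    (hM : ∀ x ∈ nbrIn G X Y, x ∈ E ∨ x ∈ F) {e f : V} (he : e ∈ nbrIn G X Y) (heE : e ∈ E)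
    (hf : f ∈ nbrIn G X Y) (hfF : f ∈ F)
    (hs : ∃ T ⊆ E, IsSprout G (nbrIn G X Y ∩ E) a b T) : ∃ T, T ⊆ X ∪ Y ∧ IsSapling G T := by
  have hnet := S.net
  have hab := hnet.ne_of_ends hE hEe
  have hcd := hnet.ne_of_ends hF hFe
  have hEF : E ≠ F := by
    rintro rfl
    rcases (ends_eq_iff hEe).1 hFe with ⟨h, -⟩ | ⟨h, -⟩
    · exact hac h
    · exact had h
  obtain ⟨P₁, P₂, P₃, hfan⟩ := S.self.exists_fan hnet hab hac hbc
  have hMin : ∀ {Q₁ Q₂ Q₃ : Set H.nodes}, NotInside H Q₁ Q₂ Q₃ E → NotInside H Q₁ Q₂ Q₃ F →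
      ∀ x ∈ nbrIn G X Y, ∀ D ∈ H.arcs, x ∈ D → NotInside H Q₁ Q₂ Q₃ D := by
    intro Q₁ Q₂ Q₃ h1 h2 x hx D hD hxD
    rcases hM x hx with h | h
    · rwa [← hnet.eq_of_mem hE hD h hxD]
    · rwa [← hnet.eq_of_mem hF hD h hxD]
  have crossing : ∀ {a b : H.nodes} {P₁ P₂ : Set H.nodes}, Fan H a b c P₁ P₂ P₃ →
      H.ends E = s((a : Set V), (b : Set V)) → a ≠ d →
      (∃ T ⊆ E, IsSprout G (nbrIn G X Y ∩ E) a b T) → d ∈ P₁ →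
      ∃ T, T ⊆ X ∪ Y ∧ IsSapling G T := by
    rintro a b P₁ P₂ hfan hEe had ⟨T, hTE, hT⟩ hd
    have hEin := hfan.notInside hEe hfan.mem₁ (fun h => hfan.notMem₁₂ h hfan.mem₂)
    have hFin := hfan.notInside (ends_swap hFe) hd (fun h => hfan.notMem₁₃ h hfan.mem₃)
    by_cases hF' : ∀ x ∈ nbrIn G X Y, x ∈ F → x ∈ (d : Set V)
    · obtain ⟨T', hTF, hT'⟩ := exists_sprout_of_subset_node hnet hF hFe hfF hf hF'
      obtain ⟨P₁', hP₁', hfan', haP⟩ := hfan.suffix₁ hd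
      have haP' := haP had.symm
      obtain ⟨K, hK⟩ := exists_piece_of_mem_arc hnet hE hEe heE he
      have haP₂ := hfan.notMem₁₂ hfan.mem₁
      have haP₃ := hfan.notMem₁₃ hfan.mem₁
      have hEin' : NotInside H P₃ P₁' P₂ E := notInside_of_notMem hEe haP₃ haP' haP₂
      refine S.sapling_of_sprout hfan'.swap₂₃.swap₁₂ hF hFe hTF hT' hK ?_ hEF.symm ?_ ?_
      · rintro N rfl
        exact ⟨haP₃, haP', haP₂⟩
      · rintro _ rfl; exact hEin'
      · exact hMin hEin' ((hFin.mono hP₁' subset_rfl subset_rfl).swap₂₃.swap₁₂)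
    · push Not at hF'
      obtain ⟨x, hxM, hxF, hxd⟩ := hF'
      obtain ⟨K, hK⟩ := exists_piece_of_notMem hnet hF (ends_swap hFe) hxF hxM hxd
      refine S.sapling_of_sprout hfan hE hEe hTE hT hK (by simp) hEF ?_ (hMin hEin hFin)
      rintro _ rfl; exact hFin
  by_cases hd₁ : d ∈ P₁
  · exact crossing hfan hEe had hs hd₁
  by_cases hd₂ : d ∈ P₂
  · obtain ⟨T, hTE, hT⟩ := hs
    exact crossing hfan.swap₁₂ (ends_swap hEe) hbd ⟨T, hTE, hT.symm⟩ hd₂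
  obtain ⟨T, hTE, hT⟩ := hs
  have hEin := hfan.notInside hEe hfan.mem₁ (fun h => hfan.notMem₁₂ h hfan.mem₂)
  by_cases hd₃ : d ∈ P₃
  · obtain ⟨P₃', hP₃', hfan', hcP⟩ := hfan.suffix₃ hd₃
    have hc₁ : c ∉ P₁ := fun h => hfan.notMem₁₃ h hfan.mem₃
    have hc₂ : c ∉ P₂ := fun h => hfan.notMem₂₃ h hfan.mem₃
    have hFin : NotInside H P₁ P₂ P₃' F := notInside_of_notMem hFe hc₁ hc₂ (hcP hcd.symm)
    obtain ⟨K, hK⟩ := exists_piece_of_mem_arc hnet hF hFe hfF hf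
    refine S.sapling_of_sprout hfan' hE hEe hTE hT hK ?_ hEF ?_
      (hMin (hEin.mono subset_rfl subset_rfl hP₃') hFin)
    · rintro N rfl
      exact ⟨hc₁, hc₂, hcP hcd.symm⟩
    · rintro _ rfl; exact hFin
  · have hFin : NotInside H P₁ P₂ P₃ F := notInside_of_notMem (ends_swap hFe) hd₁ hd₂ hd₃
    obtain ⟨K, hK⟩ := exists_piece_of_mem_arc hnet hF (ends_swap hFe) hfF hf
    refine S.sapling_of_sprout hfan hE hEe hTE hT hK ?_ hEF ?_ (hMin hEin hFin)
    · rintro N rfl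
      exact ⟨hd₁, hd₂, hd₃⟩
    · rintro _ rfl; exact hFin

/-- The neighbours of `Y` lie in two arcs without a common end-node. -/
theorem Setting.sapling_of_arcs_disjoint (S : Setting G X H Y) (hns : ¬ Sticky G X H Y)
    {E F : Set V} (hE : E ∈ H.arcs) (hF : F ∈ H.arcs) {a b c d : H.nodes}
    (hEe : H.ends E = s((a : Set V), (b : Set V))) (hFe : H.ends F = s((c : Set V), (d : Set V)))
    (hac : a ≠ c) (had : a ≠ d) (hbc : b ≠ c) (hbd : b ≠ d)
    (hM : ∀ x ∈ nbrIn G X Y, x ∈ E ∨ x ∈ F) : ∃ T, T ⊆ X ∪ Y ∧ IsSapling G T := by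
  have hnet := S.net
  obtain ⟨e, he, f, hf, heE, hfF, -⟩ :=
    S.wild.exists_untamed_of_cover hM (Or.inl hE) (Or.inl hF)
  by_cases hsE : ∃ T ⊆ E, IsSprout G (nbrIn G X Y ∩ E) a b T
  · exact S.sapling_of_arcs_sprout hE hF hEe hFe hac had hbc hbd hM he heE hf hfF hsE
  by_cases hsF : ∃ T ⊆ F, IsSprout G (nbrIn G X Y ∩ F) c d T
  · exact S.sapling_of_arcs_sprout hF hE hFe hEe hac.symm hbc.symm had.symm hbd.symm
      (fun x hx => (hM x hx).symm) hf hfF he heE hsF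
  exfalso
  have hEF : E ≠ F := by
    rintro rfl
    rcases (ends_eq_iff hEe).1 hFe with ⟨h, -⟩ | ⟨h, -⟩
    · exact hac h
    · exact had h
  have hunt : ∀ u ∈ E, ∀ v ∈ F, Untamed H u v := by
    intro u hu v hv
    refine hnet.untamed hE hF hEF hu hv fun N huN hvN => ?_
    rcases hnet.eq_or_eq_of_mem hE hEe hu huN with rfl | rfl <;>
      rcases hnet.eq_or_eq_of_mem hF hFe hv hvN with rfl | rfl <;> contradiction
  refine hns (Or.inl ⟨⟨_, _, solidSet_of_not_exists_sprout hE hEe hsE,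
    solidSet_of_not_exists_sprout hF hFe hsF, ?_⟩, S.wild.nbrIn_internal ?_⟩)
  · rw [← Set.inter_union_distrib_left, Set.inter_eq_left.2]
    exact hM
  · intro u hu
    rcases hM u hu with h | h
    · exact ⟨f, hf, hunt u h f hfF⟩
    · exact ⟨e, he, (hunt e heE u h).symm⟩

end ArcCases

end ThreeInATree

namespace ThreeInATree

open SimpleGraph

section NodeCases

variable {V : Type*} [Finite V] {G : SimpleGraph V} {X : Set V} {H : Net V} {Y : Set V}

/-- A sprout in the arc `E`, and neighbours of `Y` in a node `a` that is no end-node of `E`. -/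
theorem Setting.sapling_of_arc_node_sprout (S : Setting G X H Y) {E : Set V}
    (hE : E ∈ H.arcs) {a c d : H.nodes} (hEe : H.ends E = s((c : Set V), (d : Set V)))
    (hac : a ≠ c) (had : a ≠ d) (hM : ∀ x ∈ nbrIn G X Y, x ∈ E ∨ x ∈ (a : Set V)) {u v : V}
    (hu : u ∈ nbrIn G X Y) (hv : v ∈ nbrIn G X Y) (hvE : v ∈ E) (hua : u ∈ (a : Set V))
    (huv : Untamed H u v) (hs : ∃ T ⊆ E, IsSprout G (nbrIn G X Y ∩ E) c d T) :
    ∃ T, T ⊆ X ∪ Y ∧ IsSapling G T := by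
  have hnet := S.net
  have hcd := hnet.ne_of_ends hE hEe
  obtain ⟨P₁, P₂, Q₀, hfan₀⟩ := S.self.exists_fan hnet hcd hac.symm had.symm
  obtain ⟨A, hA, hadj, Q, hQ, hfan, haQ⟩ := hfan₀.step₃ (S.not_isLeafNode hu hua)
  have ha₁ : a ∉ P₁ := fun h => hfan₀.notMem₁₃ h hfan₀.mem₃
  have ha₂ : a ∉ P₂ := fun h => hfan₀.notMem₂₃ h hfan₀.mem₃
  clear hfan₀ hQ hA
  obtain ⟨haA, F, hF, hFe⟩ := Net.graph_adj.1 hadj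
  have hne : ∀ {D : Set V} {B : H.nodes}, H.ends D = s((a : Set V), (B : Set V)) → E ≠ D := by
    rintro D B hD rfl
    rcases (ends_eq_iff hEe).1 hD with ⟨h, -⟩ | ⟨-, h⟩
    · exact hac h.symm
    · exact had h.symm
  have hMa : ∀ {D : Set V} {B : H.nodes}, D ∈ H.arcs → H.ends D = s((a : Set V), (B : Set V)) →
      ∀ x ∈ nbrIn G X Y, x ∈ D → x ∈ (a : Set V) := fun hD hDe x hx hxD =>
    (hM x hx).resolve_left fun h => hne hDe (hnet.eq_of_mem hE hD h hxD)
  have hMin : ∀ {Q₁ Q₂ Q₃ : Set H.nodes}, NotInside H Q₁ Q₂ Q₃ E → a ∉ Q₁ → a ∉ Q₂ → a ∉ Q₃ →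
      ∀ x ∈ nbrIn G X Y, ∀ D ∈ H.arcs, x ∈ D → NotInside H Q₁ Q₂ Q₃ D := by
    intro Q₁ Q₂ Q₃ h1 h2 h3 h4 x hx D hD hxD
    rcases hM x hx with h | h
    · rwa [← hnet.eq_of_mem hE hD h hxD]
    · exact hnet.notInside_of_mem hxD h h2 h3 h4
  have hEin := hfan.notInside hEe hfan.mem₁ (fun h => hfan.notMem₁₂ h hfan.mem₂)
  have hin : ∀ {D : Set V} {B : H.nodes}, H.ends D = s((a : Set V), (B : Set V)) →
      NotInside H P₁ P₂ Q D := fun h => notInside_of_notMem h ha₁ ha₂ haQ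
  have direct : ∀ {Q' : Set H.nodes} {B : H.nodes} {D : Set V} {z : V}, Q' ⊆ Q →
      Fan H c d B P₁ P₂ Q' → D ∈ H.arcs → H.ends D = s((a : Set V), (B : Set V)) → z ∈ D →
      z ∈ (a : Set V) → z ∈ nbrIn G X Y → ∃ T, T ⊆ X ∪ Y ∧ IsSapling G T := by
    intro Q' B D z hQ' hfan' hD hDe hzD hza hzM
    obtain ⟨T, hTE, hT⟩ := hs
    obtain ⟨K, hK⟩ := exists_piece_of_mem_node hnet hD hDe hzD hza hzM (hMa hD hDe)
    refine S.sapling_of_sprout hfan' hE hEe hTE hT (I₂ := {a}) (𝓕₂ := {D})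
      (hK.mono (by simp) ?_) ?_ (hne hDe) ?_
      (hMin (hEin.mono subset_rfl subset_rfl hQ') ha₁ ha₂ fun h => haQ (hQ' h))
    · rintro N (⟨⟨⟩⟩ | rfl | rfl)
      · simp
      · simp
    · rintro N rfl
      exact ⟨ha₁, ha₂, fun h => haQ (hQ' h)⟩
    · rintro _ rfl
      exact (hin hDe).mono subset_rfl subset_rfl hQ'
  by_cases hz : ∃ z ∈ F, z ∈ (a : Set V) ∧ z ∈ nbrIn G X Y
  · obtain ⟨z, hzF, hza, hzM⟩ := hz
    exact direct subset_rfl hfan hF hFe hzF hza hzM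
  push Not at hz
  obtain ⟨w, hwF, hwa⟩ := hnet.inter_nonempty hF hFe
  have hwM := hz w hwF hwa
  obtain ⟨D, hD, huD, B, -, hDe⟩ := hnet.exists_arc_of_mem_node hua
  have hBA : B ≠ A := by
    rintro rfl
    exact hz u (S.self.arc_unique hnet hD hF hDe hFe ▸ huD) hua hu
  have crossing : ∀ {c d : H.nodes} {P₁ P₂ : Set H.nodes}, Fan H c d A P₁ P₂ Q →
      H.ends E = s((c : Set V), (d : Set V)) → a ∉ P₁ → a ∉ P₂ → a ≠ c → u ∈ (B : Set V) →
      B ∈ P₁ → ∃ T, T ⊆ X ∪ Y ∧ IsSapling G T := by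
    intro c d P₁ P₂ hfan hEe ha₁ ha₂ hac huB hB
    obtain ⟨K₁, hK₁⟩ := exists_piece_of_mixed hnet hD hF hDe hFe hBA huD hua hu hwF hwa hwM
      (hMa hD hDe) (hMa hF hFe)
    obtain ⟨P₁', hP₁', hfan', hcP⟩ := hfan.suffix₁ hB
    have hEin : NotInside H P₁ Q P₂ E := (hfan.notInside hEe hfan.mem₁
      (fun h => hfan.notMem₁₂ h hfan.mem₂)).swap₂₃
    have haP₁ : a ∉ P₁' := fun h => ha₁ (hP₁' h)
    have hEin' := hEin.mono hP₁' subset_rfl subset_rfl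
    obtain ⟨I, hI, K₂, hK₂⟩ : ∃ I : Set H.nodes, (∀ N ∈ I, N = c ∧ N ∉ P₁') ∧
        ∃ K, Piece G X H Y K I {d} {E} := by
      by_cases hBc : B = c
      · subst hBc
        exact ⟨∅, by simp, exists_piece_of_notMem hnet hE hEe hvE hv (huv.notMem_node huB)⟩
      · refine ⟨{c}, ?_, exists_piece_of_mem_arc hnet hE hEe hvE hv⟩
        rintro N rfl
        exact ⟨rfl, hcP hBc⟩
    refine S.sapling_of_pieces hfan'.swap₂₃ hK₁ hK₂ ?_ ?_ ?_ ?_ ?_ ?_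
      (hMin hEin' haP₁ haQ ha₂)
    · rintro N rfl h
      exact hac (hI _ h).1
    · rintro N rfl
      exact ⟨haP₁, haQ, ha₂⟩
    · intro N hN
      obtain ⟨rfl, h⟩ := hI N hN
      exact ⟨h, hfan.notMem₁₃ hfan.mem₁, hfan.notMem₁₂ hfan.mem₁⟩
    · rintro _ (rfl | rfl)
      · exact (hne hDe).symm
      · exact (hne hFe).symm
    · rintro _ (rfl | rfl)
      · exact notInside_of_notMem hDe haP₁ haQ ha₂
      · exact notInside_of_notMem hFe haP₁ haQ ha₂
    · rintro _ rfl
      exact hEin'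
  by_cases huB : u ∈ (B : Set V) ∧ (B ∈ P₁ ∨ B ∈ P₂ ∨ B ∈ Q)
  · obtain ⟨huB, hB | hB | hB⟩ := huB
    · exact crossing hfan hEe ha₁ ha₂ hac huB hB
    · exact crossing hfan.swap₁₂ (ends_swap hEe) ha₂ ha₁ had huB hB
    · obtain ⟨Q', hQ', hfan', -⟩ := hfan.suffix₃ hB
      exact direct hQ' hfan' hD hDe huD hua hu
  · obtain ⟨T, hTE, hT⟩ := hs
    obtain ⟨K, hK⟩ := exists_piece_of_vertex hnet hD hF hDe hFe hBA huD hua hu hwF hwa hwM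
      (hMa hF hFe)
    refine S.sapling_of_sprout hfan hE hEe hTE hT hK ?_ ?_ ?_ (hMin hEin ha₁ ha₂ haQ)
    · rintro N (rfl | ⟨rfl, h⟩)
      · exact ⟨ha₁, ha₂, haQ⟩
      · refine ⟨fun h' => huB ⟨h, ?_⟩, fun h' => huB ⟨h, ?_⟩, fun h' => huB ⟨h, ?_⟩⟩ <;> simp [h']
    · rintro (h | h)
      · exact hne hDe h
      · exact hne hFe h
    · rintro _ (rfl | rfl)
      · exact hin hDe
      · exact hin hFe

/-- The neighbours of `Y` lie in an arc `E` and a node `a` that is no end-node of `E`. -/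
theorem Setting.sapling_of_arc_node (S : Setting G X H Y) (hns : ¬ Sticky G X H Y) {E : Set V}
    (hE : E ∈ H.arcs) {a c d : H.nodes} (hEe : H.ends E = s((c : Set V), (d : Set V)))
    (hac : a ≠ c) (had : a ≠ d) (hM : ∀ x ∈ nbrIn G X Y, x ∈ E ∨ x ∈ (a : Set V)) :
    ∃ T, T ⊆ X ∪ Y ∧ IsSapling G T := by
  have hnet := S.net
  have hcd := hnet.ne_of_ends hE hEe
  obtain ⟨v, hv, u, hu, hvE, hua, hvu⟩ :=
    S.wild.exists_untamed_of_cover hM (Or.inl hE) (Or.inr a.2)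
  by_cases hs : ∃ T ⊆ E, IsSprout G (nbrIn G X Y ∩ E) c d T
  · exact S.sapling_of_arc_node_sprout hE hEe hac had hM hu hv hvE hua hvu.symm hs
  have hMc : ∃ x ∈ nbrIn G X Y, x ∈ E ∧ x ∉ (c : Set V) := by
    by_contra hcon
    push Not at hcon
    obtain ⟨T, hT, hT'⟩ := exists_sprout_of_subset_node hnet hE (ends_swap hEe) hvE hv hcon
    exact hs ⟨T, hT, hT'.symm⟩
  have hMd : ∃ x ∈ nbrIn G X Y, x ∈ E ∧ x ∉ (d : Set V) := by
    by_contra hcon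
    push Not at hcon
    exact hs (exists_sprout_of_subset_node hnet hE hEe hvE hv hcon)
  have haleaf := S.not_isLeafNode hu hua
  obtain ⟨A₀, hA₀, hA₀c, hA₀d⟩ := S.self.exists_adj_ne hnet haleaf c d
  have hne : ∀ {D : Set V} {B : H.nodes}, H.ends D = s((a : Set V), (B : Set V)) → D ≠ E := by
    rintro D B hD rfl
    rcases (ends_eq_iff hEe).1 hD with ⟨h, -⟩ | ⟨-, h⟩
    · exact hac h.symm
    · exact had h.symm
  by_cases hmiss : ∃ w ∈ (a : Set V), w ∉ nbrIn G X Y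
  · have key : ∀ {t s : H.nodes}, H.ends E = s((t : Set V), (s : Set V)) → a ≠ t → t ≠ s →
        (∃ x ∈ nbrIn G X Y, x ∈ E ∧ x ∉ (s : Set V)) →
        (∃ A ∈ contactNodes G X H Y a, A ≠ t) → (∃ A ∈ missNodes G X H Y a, A ≠ t) →
        ∃ T, T ⊆ X ∪ Y ∧ IsSapling G T := by
      rintro t s hEe hat hts ⟨x, hxM, hxE, hxs⟩ hC hN
      obtain ⟨A, B, P₁, P₂, P₃, hfan, haP, ⟨E₁, hE₁, he₁, w, hw, hwa, hwM⟩,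
        E₂, hE₂, he₂, w', hw', hwa', hwM'⟩ := S.exists_mixed haleaf hat hC hN
      have hAB : A ≠ B := by rintro rfl; exact hfan.notMem₁₂ hfan.mem₁ hfan.mem₂
      have hMa : ∀ {D : Set V} {B : H.nodes}, D ∈ H.arcs →
          H.ends D = s((a : Set V), (B : Set V)) →
          ∀ x ∈ nbrIn G X Y, x ∈ D → x ∈ (a : Set V) := fun hD hDe x hx hxD =>
        (hM x hx).resolve_left fun h => hne hDe (hnet.eq_of_mem hD hE hxD h)
      obtain ⟨K₁, hK₁⟩ := exists_piece_of_mixed hnet hE₁ hE₂ he₁ he₂ hAB hw hwa hwM hw' hwa' hwM'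
        (hMa hE₁ he₁) (hMa hE₂ he₂)
      have ht₁ : t ∉ P₁ := fun h => hfan.notMem₁₃ h hfan.mem₃
      have ht₂ : t ∉ P₂ := fun h => hfan.notMem₂₃ h hfan.mem₃
      have finish : ∀ {P : Set H.nodes} {r : H.nodes} {I : Set H.nodes} {K : Set V},
          Fan H A B r P₁ P₂ P → P ⊆ P₃ → Piece G X H Y K I {r} {E} → (∀ N ∈ I, N = t ∧ N ∉ P) →
          NotInside H P₁ P₂ P E → ∃ T, T ⊆ X ∪ Y ∧ IsSapling G T := by
        intro P r I K hfan' hP hK hI hEin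
        have haP' : a ∉ P := fun h => haP.2.2 (hP h)
        refine S.sapling_of_pieces hfan' hK₁ hK ?_ ?_ ?_ ?_ ?_ ?_ ?_
        · rintro N rfl h
          exact hat (hI _ h).1
        · rintro N rfl
          exact ⟨haP.1, haP.2.1, haP'⟩
        · intro N hN
          obtain ⟨rfl, h⟩ := hI N hN
          exact ⟨ht₁, ht₂, h⟩
        · rintro _ (rfl | rfl)
          · exact hne he₁
          · exact hne he₂
        · rintro _ (rfl | rfl)
          · exact notInside_of_notMem he₁ haP.1 haP.2.1 haP'
          · exact notInside_of_notMem he₂ haP.1 haP.2.1 haP'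
        · rintro _ rfl
          exact hEin
        · intro z hz D hD hzD
          rcases hM z hz with h | h
          · rwa [← hnet.eq_of_mem hE hD h hzD]
          · exact hnet.notInside_of_mem hzD h haP.1 haP.2.1 haP'
      by_cases hsP : s ∈ P₃
      · obtain ⟨P, hP, hfan', htP⟩ := hfan.suffix₃ hsP
        have htP' := htP hts.symm
        obtain ⟨K, hK⟩ := exists_piece_of_mem_arc hnet hE hEe hxE hxM
        refine finish hfan' hP hK ?_ (notInside_of_notMem hEe ht₁ ht₂ htP')
        rintro N rfl
        exact ⟨rfl, htP'⟩
      · obtain ⟨K, hK⟩ := exists_piece_of_notMem hnet hE (ends_swap hEe) hxE hxM hxs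
        exact finish hfan subset_rfl hK (by simp)
          ((hfan.swap₂₃.swap₁₂.notInside hEe hfan.mem₃ hsP).swap₁₂.swap₂₃)
    obtain ⟨w, hwa, hwM⟩ := hmiss
    obtain ⟨D, hD, huD, B, -, hDe⟩ := hnet.exists_arc_of_mem_node hua
    obtain ⟨D', hD', hwD, B', -, hDe'⟩ := hnet.exists_arc_of_mem_node hwa
    have hBC : B ∈ contactNodes G X H Y a := ⟨D, hD, hDe, u, huD, hua, hu⟩
    have hBN : B' ∈ missNodes G X H Y a := ⟨D', hD', hDe', w, hwD, hwa, hwM⟩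
    rcases mem_contactNodes_or_mem_missNodes (Y := Y) hnet hA₀ with h | h
    · by_cases hB : B' = c
      · exact key (ends_swap hEe) had hcd.symm hMc ⟨A₀, h, hA₀d⟩ ⟨B', hBN, by rw [hB]; exact hcd⟩
      · exact key hEe hac hcd hMd ⟨A₀, h, hA₀c⟩ ⟨B', hBN, hB⟩
    · by_cases hB : B = c
      · exact key (ends_swap hEe) had hcd.symm hMc ⟨B, hBC, by rw [hB]; exact hcd⟩ ⟨A₀, h, hA₀d⟩
      · exact key hEe hac hcd hMd ⟨B, hBC, hB⟩ ⟨A₀, h, hA₀c⟩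
  · exfalso
    push Not at hmiss
    refine hns (Or.inl ⟨⟨_, a, solidSet_of_not_exists_sprout hE hEe hs, Or.inl a.2, ?_⟩,
      S.wild.nbrIn_internal ?_⟩)
    · ext x
      refine ⟨fun hx => (hM x hx).imp (⟨hx, ·⟩) id, ?_⟩
      rintro (h | h)
      · exact h.1
      · exact hmiss x h
    · intro z hz
      rcases hM z hz with h | h
      · obtain ⟨haA, F, hF, hFe⟩ := Net.graph_adj.1 hA₀
        obtain ⟨w, hwF, hwa⟩ := hnet.inter_nonempty hF hFe
        refine ⟨w, hmiss w hwa, hnet.untamed hE hF (hne hFe).symm h hwF fun N hzN hwN => ?_⟩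
        rcases hnet.eq_or_eq_of_mem hE hEe h hzN with rfl | rfl <;>
          rcases hnet.eq_or_eq_of_mem hF hFe hwF hwN with h' | h'
        · exact hac h'.symm
        · exact hA₀c h'.symm
        · exact had h'.symm
        · exact hA₀d h'.symm
      · obtain ⟨D, hD, hzD, B, -, hDe⟩ := hnet.exists_arc_of_mem_node h
        by_cases hBc : B = c
        · obtain ⟨x, hxM, hxE, hxc⟩ := hMc
          refine ⟨x, hxM, hnet.untamed hD hE (hne hDe) hzD hxE fun N hzN hxN => ?_⟩
          rcases hnet.eq_or_eq_of_mem hE hEe hxE hxN with rfl | rfl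
          · exact hxc hxN
          · rcases hnet.eq_or_eq_of_mem hD hDe hzD hzN with h' | h'
            · exact had h'.symm
            · exact hcd (hBc.symm.trans h'.symm)
        · obtain ⟨x, hxM, hxE, hxd⟩ := hMd
          refine ⟨x, hxM, hnet.untamed hD hE (hne hDe) hzD hxE fun N hzN hxN => ?_⟩
          rcases hnet.eq_or_eq_of_mem hE hEe hxE hxN with rfl | rfl
          · rcases hnet.eq_or_eq_of_mem hD hDe hzD hzN with h' | h'
            · exact hac h'.symm
            · exact hBc h'.symm
          · exact hxd hxN

end NodeCases

end ThreeInATree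

namespace ThreeInATree

open SimpleGraph

section TwoNodes

variable {V : Type*} [Finite V] {G : SimpleGraph V} {X : Set V} {H : Net V} {Y : Set V}

/-- The neighbours of `Y` lie in two nodes, one of which is mixed away from the other. -/
theorem Setting.sapling_of_mixed_node (S : Setting G X H Y) {a b : H.nodes} (hab : a ≠ b)
    (hM : ∀ x ∈ nbrIn G X Y, x ∈ (a : Set V) ∨ x ∈ (b : Set V)) {u v : V}
    (hu : u ∈ nbrIn G X Y) (hv : v ∈ nbrIn G X Y) (hua : u ∈ (a : Set V)) (hvb : v ∈ (b : Set V))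
    (huv : Untamed H u v) (hC : ∃ A ∈ contactNodes G X H Y a, A ≠ b)
    (hN : ∃ A ∈ missNodes G X H Y a, A ≠ b) : ∃ T, T ⊆ X ∪ Y ∧ IsSapling G T := by
  have hnet := S.net
  have hub : u ∉ (b : Set V) := huv.symm.notMem_node hvb
  have hva : v ∉ (a : Set V) := huv.notMem_node hua
  obtain ⟨A, B, P₁, P₂, Q₀, hfan₀, ⟨ha₁, ha₂, haQ₀⟩, ⟨E₁, hE₁, he₁, w, hw, hwa, hwM⟩,
    E₂, hE₂, he₂, w', hw', hwa', hwM'⟩ := S.exists_mixed (S.not_isLeafNode hu hua) hab hC hN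
  obtain ⟨B₀, hB₀, hadj, Q, hQ, hfan, hbQ⟩ := hfan₀.step₃ (S.not_isLeafNode hv hvb)
  have hb₁ : b ∉ P₁ := fun h => hfan₀.notMem₁₃ h hfan₀.mem₃
  have hb₂ : b ∉ P₂ := fun h => hfan₀.notMem₂₃ h hfan₀.mem₃
  have haQ : a ∉ Q := fun h => haQ₀ (hQ h)
  have hB₀a : B₀ ≠ a := by rintro rfl; exact haQ₀ hB₀
  clear hfan₀ hQ hB₀ haQ₀ hC hN
  obtain ⟨hbB₀, G₀, hG₀, hg₀⟩ := Net.graph_adj.1 hadj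
  have hAa : A ≠ a := by rintro rfl; exact ha₁ hfan.mem₁
  have hAb : A ≠ b := by rintro rfl; exact hb₁ hfan.mem₁
  have hBb : B ≠ b := by rintro rfl; exact hb₂ hfan.mem₂
  have hAB : A ≠ B := by rintro rfl; exact hfan.notMem₁₂ hfan.mem₁ hfan.mem₂
  have hne : ∀ {D D' : Set V} {C C' : H.nodes}, H.ends D = s((a : Set V), (C : Set V)) →
      H.ends D' = s((b : Set V), (C' : Set V)) → C ≠ b ∨ C' ≠ a → D ≠ D' := by
    rintro D _ C C' hD hD' h rfl
    rcases (ends_eq_iff hD).1 hD' with ⟨h', -⟩ | ⟨h', h''⟩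
    · exact hab h'
    · rcases h with h | h
      · exact h h''
      · exact h h'.symm
  have hMa : ∀ {D : Set V} {C : H.nodes}, D ∈ H.arcs → H.ends D = s((a : Set V), (C : Set V)) →
      C ≠ b → ∀ x ∈ nbrIn G X Y, x ∈ D → x ∈ (a : Set V) := fun hD hDe hC x hx hxD =>
    (hM x hx).resolve_right fun h =>
      (hnet.eq_or_eq_of_mem hD hDe hxD h).elim (fun h' => hab h'.symm) (fun h' => hC h'.symm)
  have hMb : ∀ {D : Set V} {C : H.nodes}, D ∈ H.arcs → H.ends D = s((b : Set V), (C : Set V)) →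
      C ≠ a → ∀ x ∈ nbrIn G X Y, x ∈ D → x ∈ (b : Set V) := fun hD hDe hC x hx hxD =>
    (hM x hx).resolve_left fun h =>
      (hnet.eq_or_eq_of_mem hD hDe hxD h).elim (fun h' => hab h') (fun h' => hC h'.symm)
  have finish : ∀ {Q₁ Q₂ Q₃ : Set H.nodes} {c₁ c₂ c₃ : H.nodes} {I₁ I₂ : Set H.nodes}
      {𝓕₁ 𝓕₂ : Set (Set V)} {K₁ K₂ : Set V}, Fan H c₁ c₂ c₃ Q₁ Q₂ Q₃ →
      (a ∉ Q₁ ∧ a ∉ Q₂ ∧ a ∉ Q₃) → (b ∉ Q₁ ∧ b ∉ Q₂ ∧ b ∉ Q₃) →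
      Piece G X H Y K₁ I₁ {c₁, c₂} 𝓕₁ → Piece G X H Y K₂ I₂ {c₃} 𝓕₂ →
      (∀ N ∈ I₁, N ∉ I₂) → (∀ N ∈ I₁, N ∉ Q₁ ∧ N ∉ Q₂ ∧ N ∉ Q₃) →
      (∀ N ∈ I₂, N ∉ Q₁ ∧ N ∉ Q₂ ∧ N ∉ Q₃) → (∀ D ∈ 𝓕₁, D ∉ 𝓕₂) →
      (∀ D, D ∈ 𝓕₁ ∨ D ∈ 𝓕₂ → ∃ C : H.nodes, H.ends D = s((a : Set V), (C : Set V)) ∨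
        H.ends D = s((b : Set V), (C : Set V))) → ∃ T, T ⊆ X ∪ Y ∧ IsSapling G T := by
    intro Q₁ Q₂ Q₃ c₁ c₂ c₃ I₁ I₂ 𝓕₁ 𝓕₂ K₁ K₂ hfan' ha hb hK₁ hK₂ hI hI₁ hI₂ h𝓕 hends
    have hin : ∀ D, D ∈ 𝓕₁ ∨ D ∈ 𝓕₂ → NotInside H Q₁ Q₂ Q₃ D := by
      intro D hD
      obtain ⟨C, h | h⟩ := hends D hD
      · exact notInside_of_notMem h ha.1 ha.2.1 ha.2.2
      · exact notInside_of_notMem h hb.1 hb.2.1 hb.2.2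
    refine S.sapling_of_pieces hfan' hK₁ hK₂ hI hI₁ hI₂ h𝓕 (fun D hD => hin D (Or.inl hD))
      (fun D hD => hin D (Or.inr hD)) ?_
    intro x hx D _ hxD
    rcases hM x hx with h | h
    · exact hnet.notInside_of_mem hxD h ha.1 ha.2.1 ha.2.2
    · exact hnet.notInside_of_mem hxD h hb.1 hb.2.1 hb.2.2
  have rung_piece : ∀ {e C : H.nodes} {D : Set V} {z : V}, D ∈ H.arcs →
      H.ends D = s((e : Set V), (C : Set V)) → z ∈ D → z ∈ (e : Set V) → z ∈ nbrIn G X Y →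
      (∀ x ∈ nbrIn G X Y, x ∈ D → x ∈ (e : Set V)) → ∃ K, Piece G X H Y K {e} {C} {D} := by
    intro e C D z hD hDe hzD hze hzM hMe
    obtain ⟨K, hK⟩ := exists_piece_of_mem_node hnet hD hDe hzD hze hzM hMe
    refine ⟨K, hK.mono (by simp) ?_⟩
    rintro N (⟨⟨⟩⟩ | rfl | rfl)
    · simp
    · simp
  have haP : a ∉ P₁ ∧ a ∉ P₂ ∧ a ∉ Q := ⟨ha₁, ha₂, haQ⟩
  have hbP : b ∉ P₁ ∧ b ∉ P₂ ∧ b ∉ Q := ⟨hb₁, hb₂, hbQ⟩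
  obtain ⟨K₁, hK₁⟩ := exists_piece_of_mixed hnet hE₁ hE₂ he₁ he₂ hAB hw hwa hwM hw' hwa' hwM'
    (hMa hE₁ he₁ hAb) (hMa hE₂ he₂ hBb)
  have direct : ∀ {Q' : Set H.nodes} {C : H.nodes} {D : Set V} {z : V}, Q' ⊆ Q →
      Fan H A B C P₁ P₂ Q' → C ≠ a → D ∈ H.arcs → H.ends D = s((b : Set V), (C : Set V)) → z ∈ D →
      z ∈ (b : Set V) → z ∈ nbrIn G X Y → ∃ T, T ⊆ X ∪ Y ∧ IsSapling G T := by
    intro Q' C D z hQ' hfan' hCa hD hDe hzD hzb hzM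
    have ha' : a ∉ P₁ ∧ a ∉ P₂ ∧ a ∉ Q' := ⟨ha₁, ha₂, fun h => haQ (hQ' h)⟩
    have hb' : b ∉ P₁ ∧ b ∉ P₂ ∧ b ∉ Q' := ⟨hb₁, hb₂, fun h => hbQ (hQ' h)⟩
    obtain ⟨K, hK⟩ := rung_piece hD hDe hzD hzb hzM (hMb hD hDe hCa)
    refine finish hfan' ha' hb' hK₁ hK ?_ ?_ ?_ ?_ ?_
    · rintro N rfl; exact hab
    · rintro N rfl; exact ha'
    · rintro N rfl; exact hb'
    · rintro _ (rfl | rfl)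
      · exact hne he₁ hDe (Or.inl hAb)
      · exact hne he₂ hDe (Or.inl hBb)
    · rintro _ ((rfl | rfl) | rfl)
      exacts [⟨A, Or.inl he₁⟩, ⟨B, Or.inl he₂⟩, ⟨C, Or.inr hDe⟩]
  by_cases hz : ∃ z ∈ G₀, z ∈ (b : Set V) ∧ z ∈ nbrIn G X Y
  · obtain ⟨z, hzG, hzb, hzM⟩ := hz
    exact direct subset_rfl hfan hB₀a hG₀ hg₀ hzG hzb hzM
  push Not at hz
  obtain ⟨b', hbG, hbb⟩ := hnet.inter_nonempty hG₀ hg₀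
  have hbM := hz b' hbG hbb
  obtain ⟨G₁, hG₁, hvG, D, -, hg₁⟩ := hnet.exists_arc_of_mem_node hvb
  have hDB₀ : D ≠ B₀ := by
    rintro rfl
    exact hz v (S.self.arc_unique hnet hG₁ hG₀ hg₁ hg₀ ▸ hvG) hvb hv
  by_cases hvD : ¬ (v ∈ (D : Set V) ∧ (D ∈ P₁ ∨ D ∈ P₂ ∨ D ∈ Q))
  · obtain ⟨K, hK⟩ := exists_piece_of_vertex hnet hG₁ hG₀ hg₁ hg₀ hDB₀ hvG hvb hv hbG hbb hbM
      (hMb hG₀ hg₀ hB₀a)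
    refine finish hfan haP hbP hK₁ hK ?_ ?_ ?_ ?_ ?_
    · rintro N rfl (h | ⟨rfl, h⟩)
      · exact hab h
      · exact hva h
    · rintro N rfl; exact haP
    · rintro N (rfl | ⟨rfl, h⟩)
      · exact hbP
      · refine ⟨fun h' => hvD ⟨h, ?_⟩, fun h' => hvD ⟨h, ?_⟩, fun h' => hvD ⟨h, ?_⟩⟩ <;> simp [h']
    · rintro _ (rfl | rfl) (h | h)
      · exact hne he₁ hg₁ (Or.inl hAb) h
      · exact hne he₁ hg₀ (Or.inl hAb) h
      · exact hne he₂ hg₁ (Or.inl hBb) h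
      · exact hne he₂ hg₀ (Or.inl hBb) h
    · rintro _ ((rfl | rfl) | (rfl | rfl))
      exacts [⟨A, Or.inl he₁⟩, ⟨B, Or.inl he₂⟩, ⟨D, Or.inr hg₁⟩, ⟨B₀, Or.inr hg₀⟩]
  rw [not_not] at hvD
  obtain ⟨hvD, hD⟩ := hvD
  have hDa : D ≠ a := by rintro rfl; exact hva hvD
  obtain ⟨Kb, hKb⟩ := exists_piece_of_mixed hnet hG₁ hG₀ hg₁ hg₀ hDB₀ hvG hvb hv hbG hbb hbM
    (hMb hG₁ hg₁ hDa) (hMb hG₀ hg₀ hB₀a)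
  rcases hD with hD | hD | hD
  · by_cases hDA : D = A
    · subst hDA
      have huD : u ∉ (D : Set V) := huv.symm.notMem_node hvD
      obtain ⟨F, hF, huF, A', -, hFe⟩ := hnet.exists_arc_of_mem_node hua
      by_cases hA₂ : A' ∈ P₂
      · obtain ⟨P', hP', hfan', -⟩ := hfan.suffix₂ hA₂
        have hAb' : A' ≠ b := by rintro rfl; exact hb₂ hA₂
        obtain ⟨K, hK⟩ := rung_piece hF hFe huF hua hu (hMa hF hFe hAb')
        refine finish hfan'.swap₂₃ ⟨ha₁, haQ, fun h => ha₂ (hP' h)⟩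
          ⟨hb₁, hbQ, fun h => hb₂ (hP' h)⟩ hKb hK ?_ ?_ ?_ ?_ ?_
        · rintro N rfl; exact hab.symm
        · rintro N rfl; exact ⟨hb₁, hbQ, fun h => hb₂ (hP' h)⟩
        · rintro N rfl; exact ⟨ha₁, haQ, fun h => ha₂ (hP' h)⟩
        · rintro _ (rfl | rfl)
          · exact (hne hFe hg₁ (Or.inl hAb')).symm
          · exact (hne hFe hg₀ (Or.inl hAb')).symm
        · rintro _ ((rfl | rfl) | rfl)
          exacts [⟨_, Or.inr hg₁⟩, ⟨_, Or.inr hg₀⟩, ⟨_, Or.inl hFe⟩]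
      have hAB' : A' ≠ B := by rintro rfl; exact hA₂ hfan.mem₂
      by_cases hA₁ : A' ∈ P₁ ∧ A' ≠ D
      · obtain ⟨hA₁, hAD⟩ := hA₁
        obtain ⟨P', hP', hfan', hDP⟩ := hfan.suffix₁ hA₁
        have hAb' : A' ≠ b := by rintro rfl; exact hb₁ hA₁
        obtain ⟨K, hK⟩ := exists_piece_of_mixed hnet hF hE₂ hFe he₂ hAB' huF hua hu hw' hwa' hwM'
          (hMa hF hFe hAb') (hMa hE₂ he₂ hBb)
        obtain ⟨K', hK'⟩ := exists_piece_of_vertex hnet hG₁ hG₀ hg₁ hg₀ hDB₀ hvG hvb hv hbG hbb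
          hbM (hMb hG₀ hg₀ hB₀a)
        have ha' : a ∉ P' ∧ a ∉ P₂ ∧ a ∉ Q := ⟨fun h => ha₁ (hP' h), ha₂, haQ⟩
        have hb' : b ∉ P' ∧ b ∉ P₂ ∧ b ∉ Q := ⟨fun h => hb₁ (hP' h), hb₂, hbQ⟩
        refine finish hfan' ha' hb' hK hK' ?_ ?_ ?_ ?_ ?_
        · rintro N rfl (h | ⟨h, -⟩)
          · exact hab h
          · exact hDa h.symm
        · rintro N rfl; exact ha'
        · rintro N (rfl | ⟨rfl, -⟩)
          · exact hb'
          · exact ⟨hDP hAD, hfan.notMem₁₂ hfan.mem₁, hfan.notMem₁₃ hfan.mem₁⟩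
        · rintro _ (rfl | rfl) (h | h)
          · exact hne hFe hg₁ (Or.inl hAb') h
          · exact hne hFe hg₀ (Or.inl hAb') h
          · exact hne he₂ hg₁ (Or.inl hBb) h
          · exact hne he₂ hg₀ (Or.inl hBb) h
        · rintro _ ((rfl | rfl) | (rfl | rfl))
          exacts [⟨_, Or.inl hFe⟩, ⟨_, Or.inl he₂⟩, ⟨_, Or.inr hg₁⟩, ⟨_, Or.inr hg₀⟩]
      by_cases hA₃ : A' ∈ Q
      · obtain ⟨Q', hQ', hfan', -⟩ := hfan.suffix₃ hA₃
        have hAb' : A' ≠ b := by rintro rfl; exact hbQ hA₃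
        obtain ⟨K, hK⟩ := exists_piece_of_mixed hnet hF hE₂ hFe he₂ hAB' huF hua hu hw' hwa' hwM'
          (hMa hF hFe hAb') (hMa hE₂ he₂ hBb)
        obtain ⟨K', hK'⟩ := rung_piece hG₁ hg₁ hvG hvb hv (hMb hG₁ hg₁ hDa)
        have ha' : a ∉ Q' ∧ a ∉ P₂ ∧ a ∉ P₁ := ⟨fun h => haQ (hQ' h), ha₂, ha₁⟩
        have hb' : b ∉ Q' ∧ b ∉ P₂ ∧ b ∉ P₁ := ⟨fun h => hbQ (hQ' h), hb₂, hb₁⟩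
        refine finish hfan'.swap₁₂.swap₂₃.swap₁₂ ha' hb' hK hK' ?_ ?_ ?_ ?_ ?_
        · rintro N rfl; exact hab
        · rintro N rfl; exact ha'
        · rintro N rfl; exact hb'
        · rintro _ (rfl | rfl)
          · exact hne hFe hg₁ (Or.inl hAb')
          · exact hne he₂ hg₁ (Or.inl hBb)
        · rintro _ ((rfl | rfl) | rfl)
          exacts [⟨_, Or.inl hFe⟩, ⟨_, Or.inl he₂⟩, ⟨_, Or.inr hg₁⟩]
      · obtain ⟨K, hK⟩ := exists_piece_of_vertex hnet hF hE₂ hFe he₂ hAB' huF hua hu hw' hwa' hwM'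
          (hMa hE₂ he₂ hBb)
        refine finish hfan.swap₂₃ ⟨ha₁, haQ, ha₂⟩ ⟨hb₁, hbQ, hb₂⟩ hKb hK ?_ ?_ ?_ ?_ ?_
        · rintro N rfl (h | ⟨rfl, h⟩)
          · exact hab h.symm
          · exact hub h
        · rintro N rfl; exact ⟨hb₁, hbQ, hb₂⟩
        · rintro N (rfl | ⟨rfl, h⟩)
          · exact ⟨ha₁, haQ, ha₂⟩
          · exact ⟨fun h' => hA₁ ⟨h', by rintro rfl; exact huD h⟩, hA₃, hA₂⟩
        · rintro _ (rfl | rfl) (h | h)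
          · exact hne hFe hg₁ (Or.inr hDa) h.symm
          · exact hne he₂ hg₁ (Or.inl hBb) h.symm
          · exact hne hFe hg₀ (Or.inr hB₀a) h.symm
          · exact hne he₂ hg₀ (Or.inl hBb) h.symm
        · rintro _ ((rfl | rfl) | (rfl | rfl))
          exacts [⟨_, Or.inr hg₁⟩, ⟨_, Or.inr hg₀⟩, ⟨_, Or.inl hFe⟩, ⟨_, Or.inl he₂⟩]
    · obtain ⟨P', hP', hfan', hAP⟩ := hfan.suffix₁ hD
      obtain ⟨K, hK⟩ := exists_piece_of_vertex hnet hE₁ hE₂ he₁ he₂ hAB hw hwa hwM hw' hwa' hwM'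
        (hMa hE₂ he₂ hBb)
      have ha' : a ∉ P' ∧ a ∉ Q ∧ a ∉ P₂ := ⟨fun h => ha₁ (hP' h), haQ, ha₂⟩
      have hb' : b ∉ P' ∧ b ∉ Q ∧ b ∉ P₂ := ⟨fun h => hb₁ (hP' h), hbQ, hb₂⟩
      refine finish hfan'.swap₂₃ ha' hb' hKb hK ?_ ?_ ?_ ?_ ?_
      · rintro N rfl (h | ⟨h, -⟩)
        · exact hab h.symm
        · exact hAb h.symm
      · rintro N rfl; exact hb'
      · rintro N (rfl | ⟨rfl, -⟩)
        · exact ha'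
        · exact ⟨hAP hDA, hfan.notMem₁₃ hfan.mem₁, hfan.notMem₁₂ hfan.mem₁⟩
      · rintro _ (rfl | rfl) (h | h)
        · exact hne he₁ hg₁ (Or.inl hAb) h.symm
        · exact hne he₂ hg₁ (Or.inl hBb) h.symm
        · exact hne he₁ hg₀ (Or.inl hAb) h.symm
        · exact hne he₂ hg₀ (Or.inl hBb) h.symm
      · rintro _ ((rfl | rfl) | (rfl | rfl))
        exacts [⟨_, Or.inr hg₁⟩, ⟨_, Or.inr hg₀⟩, ⟨_, Or.inl he₁⟩, ⟨_, Or.inl he₂⟩]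
  · obtain ⟨P', hP', hfan', -⟩ := hfan.suffix₂ hD
    obtain ⟨K, hK⟩ := rung_piece hE₁ he₁ hw hwa hwM (hMa hE₁ he₁ hAb)
    have ha' : a ∉ P' ∧ a ∉ Q ∧ a ∉ P₁ := ⟨fun h => ha₂ (hP' h), haQ, ha₁⟩
    have hb' : b ∉ P' ∧ b ∉ Q ∧ b ∉ P₁ := ⟨fun h => hb₂ (hP' h), hbQ, hb₁⟩
    refine finish hfan'.swap₁₂.swap₂₃ ha' hb' hKb hK ?_ ?_ ?_ ?_ ?_
    · rintro N rfl; exact hab.symm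
    · rintro N rfl; exact hb'
    · rintro N rfl; exact ha'
    · rintro _ (rfl | rfl)
      · exact (hne he₁ hg₁ (Or.inl hAb)).symm
      · exact (hne he₁ hg₀ (Or.inl hAb)).symm
    · rintro _ ((rfl | rfl) | rfl)
      exacts [⟨_, Or.inr hg₁⟩, ⟨_, Or.inr hg₀⟩, ⟨_, Or.inl he₁⟩]
  · obtain ⟨Q', hQ', hfan', -⟩ := hfan.suffix₃ hD
    exact direct hQ' hfan' hDa hG₁ hg₁ hvG hvb hv

/-- Outside the arc `E` from `a` to `b`, the vertices of `a` have the same neighbours in `Y`, if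
all vertices of `a` and `b` outside `E` have neighbours in `Y`. -/
theorem Setting.adj_iff_adj_of_full (S : Setting G X H Y) {E : Set V} (hE : E ∈ H.arcs)
    {a b : H.nodes} (hEe : H.ends E = s((a : Set V), (b : Set V)))
    (ha : ¬ H.IsLeafNode a) (hb : ¬ H.IsLeafNode b)
    (hfa : ∀ z ∈ (a : Set V), z ∉ E → z ∈ nbrIn G X Y)
    (hfb : ∀ z ∈ (b : Set V), z ∉ E → z ∈ nbrIn G X Y) {z z' : V} (hz : z ∈ (a : Set V))
    (hz' : z' ∈ (a : Set V)) (hzE : z ∉ E) (hzE' : z' ∉ E) {y : V} (hy : y ∈ Y) :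
    G.Adj y z ↔ G.Adj y z' := by
  have hnet := S.net
  have hab := hnet.ne_of_ends hE hEe
  have hunt : ∀ {D F : Set V} {A B : H.nodes} {s t : V}, D ∈ H.arcs → F ∈ H.arcs →
      H.ends D = s((a : Set V), (A : Set V)) → H.ends F = s((b : Set V), (B : Set V)) →
      A ≠ b → B ≠ a → A ≠ B → s ∈ D → t ∈ F → Untamed H s t := by
    intro D F A B s t hD hF hDe hFe hAb hBa hAB hs ht
    refine hnet.untamed hD hF ?_ hs ht fun N hsN htN => ?_
    · rintro rfl
      rcases (ends_eq_iff hDe).1 hFe with ⟨h, -⟩ | ⟨h, -⟩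
      · exact hab h
      · exact hBa h.symm
    · rcases hnet.eq_or_eq_of_mem hD hDe hs hsN with rfl | rfl <;>
        rcases hnet.eq_or_eq_of_mem hF hFe ht htN with h | h
      · exact hab h
      · exact hBa h.symm
      · exact hAb h
      · exact hAB h
  have harc : ∀ {z : V}, z ∈ (a : Set V) → z ∉ E → ∃ D ∈ H.arcs, z ∈ D ∧ ∃ A : H.nodes,
      H.ends D = s((a : Set V), (A : Set V)) ∧ A ≠ b := by
    intro z hz hzE
    obtain ⟨D, hD, hzD, A, -, hDe⟩ := hnet.exists_arc_of_mem_node hz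
    refine ⟨D, hD, hzD, A, hDe, ?_⟩
    rintro rfl
    exact hzE (S.self.arc_unique hnet hE hD hEe hDe ▸ hzD)
  have hnode : ∀ {c e C : H.nodes}, H.graph.Adj c C → H.ends E = s((c : Set V), (e : Set V)) →
      C ≠ e → ∃ F ∈ H.arcs, H.ends F = s((c : Set V), (C : Set V)) ∧
        ∃ t ∈ F, t ∈ (c : Set V) ∧ t ∉ E := by
    intro c e C hadj hce hCe
    obtain ⟨-, F, hF, hFe⟩ := Net.graph_adj.1 hadj
    obtain ⟨t, htF, htc⟩ := hnet.inter_nonempty hF hFe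
    refine ⟨F, hF, hFe, t, htF, htc, fun htE => ?_⟩
    obtain rfl := hnet.eq_of_mem hE hF htE htF
    rcases (ends_eq_iff hce).1 hFe with ⟨-, h⟩ | ⟨h, -⟩
    · exact hCe h.symm
    · exact hadj.ne h
  obtain ⟨D, hD, hzD, A, hDe, hAb⟩ := harc hz hzE
  obtain ⟨D', hD', hzD', A', hDe', hAb'⟩ := harc hz' hzE'
  have hzM := hfa z hz hzE
  have hzM' := hfa z' hz' hzE'
  by_cases hB : ∃ B, H.graph.Adj b B ∧ B ≠ a ∧ B ≠ A ∧ B ≠ A'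
  · obtain ⟨B, hadj, hBa, hBA, hBA'⟩ := hB
    obtain ⟨F, hF, hFe, t, htF, htb, htE⟩ := hnode hadj (ends_swap hEe) hBa
    exact S.wild.adj_iff_adj hzM hzM' (hfb t htb htE)
      (hunt hD hF hDe hFe hAb hBa hBA.symm hzD htF)
      (hunt hD' hF hDe' hFe hAb' hBa hBA'.symm hzD' htF) hy
  push Not at hB
  obtain ⟨B, hadj, hBa, hBA⟩ := S.self.exists_adj_ne hnet hb a A
  have hBA' := hB B hadj hBa hBA
  subst hBA'
  obtain ⟨B', hadj', hBa', hBA'⟩ := S.self.exists_adj_ne hnet hb a B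
  have hB'A : B' = A := by
    by_contra h
    exact hBA' (hB B' hadj' hBa' h)
  subst hB'A
  obtain ⟨C, hadjC, hCb, hCB', hCB⟩ : ∃ C, H.graph.Adj a C ∧ C ≠ b ∧ C ≠ B' ∧ C ≠ B := by
    by_contra hcon
    push Not at hcon
    obtain ⟨l, hl, hr⟩ := S.self.exists_leaf_reachAvoid hnet (S := {B', B})
      ((Set.ncard_insert_le _ _).trans (by rw [Set.ncard_singleton])) (v := a) (by
        rintro (h | h)
        · exact hBa' h.symm
        · exact hBa h.symm)
    by_cases hlab : l = a ∨ l = b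
    · rcases hlab with rfl | rfl
      · exact ha hl
      · exact hb hl
    · obtain ⟨s, hs, t, ht, -, htS, hst⟩ := hr.exists_boundary (D := {a, b})
        (fun c hc _ => Or.inl hc) hlab
      have htab : t ≠ a ∧ t ≠ b := ⟨fun h => ht (Or.inl h), fun h => ht (Or.inr h)⟩
      have htB' : t ≠ B' := fun h => htS (Or.inl h)
      rcases hs with rfl | rfl
      · exact htS (Or.inr (hcon t hst htab.2 htB'))
      · exact htS (Or.inr (hB t hst htab.1 htB'))
  obtain ⟨F, hF, hFe, t, htF, hta, htE⟩ := hnode hadjC hEe hCb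
  have htM := hfa t hta htE
  obtain ⟨F₁, hF₁, hFe₁, t₁, htF₁, htb₁, htE₁⟩ := hnode hadj (ends_swap hEe) hBa
  obtain ⟨F₂, hF₂, hFe₂, t₂, htF₂, htb₂, htE₂⟩ := hnode hadj' (ends_swap hEe) hBa'
  refine (S.wild.adj_iff_adj hzM htM (hfb t₁ htb₁ htE₁)
    (hunt hD hF₁ hDe hFe₁ hAb hBa hBA.symm hzD htF₁)
    (hunt hF hF₁ hFe hFe₁ hCb hBa hCB htF htF₁) hy).trans ?_
  exact S.wild.adj_iff_adj htM hzM' (hfb t₂ htb₂ htE₂)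
    (hunt hF hF₂ hFe hFe₂ hCb hBa' hCB' htF htF₂)
    (hunt hD' hF₂ hDe' hFe₂ hAb' hBa' hBA'.symm hzD' htF₂) hy

/-- The neighbours of `Y` lie in two nodes. -/
theorem Setting.sapling_of_nodes (S : Setting G X H Y) (hns : ¬ Sticky G X H Y) {a b : H.nodes}
    (hab : a ≠ b) (hM : ∀ x ∈ nbrIn G X Y, x ∈ (a : Set V) ∨ x ∈ (b : Set V)) :
    ∃ T, T ⊆ X ∪ Y ∧ IsSapling G T := by
  have hnet := S.net
  obtain ⟨u, hu, v, hv, hua, hvb, huv⟩ :=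
    S.wild.exists_untamed_of_cover hM (Or.inr a.2) (Or.inr b.2)
  by_cases hma : (∃ A ∈ contactNodes G X H Y a, A ≠ b) ∧ ∃ A ∈ missNodes G X H Y a, A ≠ b
  · exact S.sapling_of_mixed_node hab hM hu hv hua hvb huv hma.1 hma.2
  by_cases hmb : (∃ A ∈ contactNodes G X H Y b, A ≠ a) ∧ ∃ A ∈ missNodes G X H Y b, A ≠ a
  · exact S.sapling_of_mixed_node hab.symm (fun x hx => (hM x hx).symm) hv hu hvb hua huv.symm
      hmb.1 hmb.2
  have full : ∀ {c e : H.nodes}, ¬ ((∃ A ∈ contactNodes G X H Y c, A ≠ e) ∧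
      ∃ A ∈ missNodes G X H Y c, A ≠ e) → ∀ {x : V}, x ∈ nbrIn G X Y → x ∈ (c : Set V) →
      (∀ D ∈ H.arcs, x ∈ D → H.ends D ≠ s((c : Set V), (e : Set V))) →
      ∀ z ∈ (c : Set V), (∀ D ∈ H.arcs, z ∈ D → H.ends D ≠ s((c : Set V), (e : Set V))) →
      z ∈ nbrIn G X Y := by
    intro c e hmix x hx hxc hxD z hz hzD
    by_contra hzM
    obtain ⟨D, hD, hxD', A, -, hDe⟩ := hnet.exists_arc_of_mem_node hxc
    obtain ⟨D', hD', hzD', A', -, hDe'⟩ := hnet.exists_arc_of_mem_node hz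
    refine hmix ⟨⟨A, ⟨D, hD, hDe, x, hxD', hxc, hx⟩, ?_⟩, A', ⟨D', hD', hDe', z, hzD', hz, hzM⟩, ?_⟩
    · rintro rfl; exact hxD D hD hxD' hDe
    · rintro rfl; exact hzD D' hD' hzD' hDe'
  by_cases harc : ∃ E ∈ H.arcs, H.ends E = s((a : Set V), (b : Set V))
  · obtain ⟨E, hE, hEe⟩ := harc
    by_cases hMa : ∀ x ∈ nbrIn G X Y, x ∈ (a : Set V) → x ∈ E
    · exact S.sapling_of_arc_end hns hE (ends_swap hEe) fun x hx => (hM x hx).imp_left (hMa x hx)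
    by_cases hMb : ∀ x ∈ nbrIn G X Y, x ∈ (b : Set V) → x ∈ E
    · exact S.sapling_of_arc_end hns hE hEe fun x hx => (hM x hx).symm.imp_left (hMb x hx)
    exfalso
    push Not at hMa hMb
    obtain ⟨x, hx, hxa, hxE⟩ := hMa
    obtain ⟨x', hx', hxb, hxE'⟩ := hMb
    have hout : ∀ {z : V}, z ∉ E → ∀ D ∈ H.arcs, z ∈ D → H.ends D ≠ s((a : Set V), (b : Set V)) :=
      fun hz D hD hzD h => hz (S.self.arc_unique hnet hE hD hEe h ▸ hzD)
    have hfa : ∀ z ∈ (a : Set V), z ∉ E → z ∈ nbrIn G X Y := fun z hz hzE =>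
      full hma hx hxa (hout hxE) z hz (hout hzE)
    have hfb : ∀ z ∈ (b : Set V), z ∉ E → z ∈ nbrIn G X Y := fun z hz hzE =>
      full hmb hx' hxb (fun D hD h1 h2 => hout hxE' D hD h1 (ends_swap h2)) z hz
        (fun D hD h1 h2 => hout hzE D hD h1 (ends_swap h2))
    have hla := S.not_isLeafNode hu hua
    have hlb := S.not_isLeafNode hv hvb
    have uniform : ∀ {c : H.nodes}, (∀ y ∈ Y, ∀ z ∈ (c : Set V), z ∉ E → ∀ z' ∈ (c : Set V),
        z' ∉ E → (G.Adj y z ↔ G.Adj y z')) → ∀ y, IsEndOf G Y y →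
        G.neighborSet y ∩ (c : Set V) ⊆ E ∨ (c : Set V) ⊆ E ∪ G.neighborSet y := by
      intro c hc y hy
      by_cases h : G.neighborSet y ∩ (c : Set V) ⊆ E
      · exact Or.inl h
      · right
        rw [Set.not_subset] at h
        obtain ⟨z, ⟨hyz, hz⟩, hzE⟩ := h
        intro z' hz'
        by_cases hzE' : z' ∈ E
        · exact Or.inl hzE'
        · exact Or.inr ((hc y hy.1 z hz hzE z' hz' hzE').1 hyz)
    refine hns (Or.inr ⟨E, a, b, isChunk_arc hE hEe, ?_, ?_⟩)
    · intro z hz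
      rcases hM z hz with h | h
      · exact Or.inl (Or.inl h)
      · exact Or.inr h
    · rintro W (rfl | rfl)
      · exact uniform fun y hy z hz hzE z' hz' hzE' =>
          S.adj_iff_adj_of_full hE hEe hla hlb hfa hfb hz hz' hzE hzE' hy
      · exact uniform fun y hy z hz hzE z' hz' hzE' =>
          S.adj_iff_adj_of_full hE (ends_swap hEe) hlb hla hfb hfa hz hz' hzE hzE' hy
  · exfalso
    push Not at harc
    have harc' : ∀ D ∈ H.arcs, H.ends D ≠ s((b : Set V), (a : Set V)) :=
      fun D hD h => harc D hD (ends_swap h)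
    have hfa : ∀ z ∈ (a : Set V), z ∈ nbrIn G X Y := fun z hz =>
      full hma hu hua (fun D hD _ => harc D hD) z hz (fun D hD _ => harc D hD)
    have hfb : ∀ z ∈ (b : Set V), z ∈ nbrIn G X Y := fun z hz =>
      full hmb hv hvb (fun D hD _ => harc' D hD) z hz (fun D hD _ => harc' D hD)
    have partner : ∀ {c e : H.nodes}, c ≠ e → ¬ H.IsLeafNode e →
        (∀ D ∈ H.arcs, H.ends D ≠ s((c : Set V), (e : Set V))) →
        (∀ z ∈ (e : Set V), z ∈ nbrIn G X Y) → ∀ z ∈ (c : Set V),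
        ∃ t ∈ nbrIn G X Y, Untamed H z t := by
      intro c e hce hle hno hfe z hz
      obtain ⟨D, hD, hzD, A, -, hDe⟩ := hnet.exists_arc_of_mem_node hz
      obtain ⟨B, hadj, hBc, hBA⟩ := S.self.exists_adj_ne hnet hle c A
      obtain ⟨-, F, hF, hFe⟩ := Net.graph_adj.1 hadj
      obtain ⟨t, htF, hte⟩ := hnet.inter_nonempty hF hFe
      refine ⟨t, hfe t hte, hnet.untamed hD hF ?_ hzD htF fun N hzN htN => ?_⟩
      · rintro rfl
        rcases (ends_eq_iff hDe).1 hFe with ⟨h, -⟩ | ⟨h, -⟩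
        · exact hce h
        · exact hBc h.symm
      · rcases hnet.eq_or_eq_of_mem hD hDe hzD hzN with rfl | rfl <;>
          rcases hnet.eq_or_eq_of_mem hF hFe htF htN with h | h
        · exact hce h
        · exact hBc h.symm
        · exact hno D hD (h ▸ hDe)
        · exact hBA h.symm
    refine hns (Or.inl ⟨⟨a, b, Or.inl a.2, Or.inl b.2, ?_⟩, S.wild.nbrIn_internal ?_⟩)
    · ext z
      refine ⟨hM z, ?_⟩
      rintro (h | h)
      · exact hfa z h
      · exact hfb z h
    · intro z hz
      rcases hM z hz with h | h
      · exact partner hab (S.not_isLeafNode hv hvb) harc hfb z h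
      · exact partner hab.symm (S.not_isLeafNode hu hua) harc' hfa z h

/-- The neighbours of `Y` lie in an arc and a node. -/
theorem Setting.sapling_of_arc_of_node (S : Setting G X H Y) (hns : ¬ Sticky G X H Y) {E : Set V}
    (hE : E ∈ H.arcs) {a : H.nodes} (hM : ∀ x ∈ nbrIn G X Y, x ∈ E ∨ x ∈ (a : Set V)) :
    ∃ T, T ⊆ X ∪ Y ∧ IsSapling G T := by
  obtain ⟨c, d, -, hEe⟩ := S.net.arc_ends hE
  by_cases hac : a = c
  · subst hac
    exact S.sapling_of_arc_end hns hE hEe hM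
  by_cases had : a = d
  · subst had
    exact S.sapling_of_arc_end hns hE (ends_swap hEe) hM
  exact S.sapling_of_arc_node hns hE hEe hac had hM

/-- The neighbours of `Y` lie in two arcs. -/
theorem Setting.sapling_of_arcs (S : Setting G X H Y) (hns : ¬ Sticky G X H Y) {E F : Set V}
    (hE : E ∈ H.arcs) (hF : F ∈ H.arcs) (hM : ∀ x ∈ nbrIn G X Y, x ∈ E ∨ x ∈ F) :
    ∃ T, T ⊆ X ∪ Y ∧ IsSapling G T := by
  obtain ⟨a, b, -, hEe⟩ := S.net.arc_ends hE
  obtain ⟨c, d, -, hFe⟩ := S.net.arc_ends hF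
  have hEF : E ≠ F := by
    rintro rfl
    obtain ⟨u, hu, v, hv, huv⟩ := S.wild.exists_untamed
    exact huv (Or.inl ⟨E, hE, or_self_iff.1 (hM u hu), or_self_iff.1 (hM v hv)⟩)
  have common : ∀ {a b c : H.nodes}, H.ends E = s((a : Set V), (b : Set V)) →
      H.ends F = s((a : Set V), (c : Set V)) → ∃ T, T ⊆ X ∪ Y ∧ IsSapling G T := by
    intro a b c hEe hFe
    refine S.sapling_of_arcs_common hns hE hF hEe hFe ?_ hM
    rintro rfl
    exact hEF (S.self.arc_unique S.net hE hF hEe hFe)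
  by_cases hac : a = c
  · subst hac
    exact common hEe hFe
  by_cases had : a = d
  · subst had
    exact common hEe (ends_swap hFe)
  by_cases hbc : b = c
  · subst hbc
    exact common (ends_swap hEe) hFe
  by_cases hbd : b = d
  · subst hbd
    exact common (ends_swap hEe) (ends_swap hFe)
  exact S.sapling_of_arcs_disjoint hns hE hF hEe hFe hac had hbc hbd hM

end TwoNodes

end ThreeInATree

theorem self_aiding_two_pieces_gives_sapling
    {V : Type*} [Finite V] (G : SimpleGraph V)
    (hconn : G.Connected) (hleaves : {v | ThreeInATree.IsLeaf G v}.ncard = 3)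
    (X : Set V) (H : ThreeInATree.Net V) (hnet : ThreeInATree.IsNet G X H)
    (hself : ThreeInATree.SelfAiding H)
    (Y : Set V) (hwild : ThreeInATree.Wild G X H Y)
    (hnonsticky : ¬ ThreeInATree.Sticky G X H Y)
    (M₁ M₂ : Set V) (hM : ThreeInATree.nbrIn G X Y = M₁ ∪ M₂)
    (hM₁ : (∃ N ∈ H.nodes, M₁ ⊆ N) ∨ ∃ E ∈ H.arcs, M₁ ⊆ E)
    (hM₂ : (∃ N ∈ H.nodes, M₂ ⊆ N) ∨ ∃ E ∈ H.arcs, M₂ ⊆ E) :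
    ∃ T, T ⊆ X ∪ Y ∧ ThreeInATree.IsSapling G T := by
  have S : ThreeInATree.Setting G X H Y := ⟨hnet, hself, hleaves, hwild⟩
  have hM' : ∀ x ∈ ThreeInATree.nbrIn G X Y, x ∈ M₁ ∨ x ∈ M₂ := fun x hx => by rwa [hM] at hx
  rcases hM₁ with ⟨a, ha, h₁⟩ | ⟨E, hE, h₁⟩ <;> rcases hM₂ with ⟨b, hb, h₂⟩ | ⟨F, hF, h₂⟩
  · have hM'' : ∀ x ∈ ThreeInATree.nbrIn G X Y, x ∈ a ∨ x ∈ b := fun x hx => (hM' x hx).imp (@h₁ x) (@h₂ x)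
    have hab : (⟨a, ha⟩ : H.nodes) ≠ ⟨b, hb⟩ := by
      intro h
      obtain rfl : a = b := congrArg Subtype.val h
      obtain ⟨u, hu, v, hv, huv⟩ := hwild.exists_untamed
      exact huv (Or.inr ⟨a, ha, or_self_iff.1 (hM'' u hu), or_self_iff.1 (hM'' v hv)⟩)
    exact S.sapling_of_nodes hnonsticky hab hM''
  · exact S.sapling_of_arc_of_node hnonsticky hF (a := ⟨a, ha⟩)
      fun x hx => (hM' x hx).symm.imp (@h₂ x) (@h₁ x)
  · exact S.sapling_of_arc_of_node hnonsticky hE (a := ⟨b, hb⟩)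
      fun x hx => (hM' x hx).imp (@h₁ x) (@h₂ x)
  · exact S.sapling_of_arcs hnonsticky hE hF fun x hx => (hM' x hx).imp (@h₁ x) (@h₂ x)
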